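/- Let N ≥ 2 be an integer and let α be a real number with (4−N)/2 < α < 2. Then there exists a constant B = B(N,α) > 0 such that for every radial function u ∈ C_c^∞(ℝ^N): ∫_{ℝ^N} |div(|x|^α ∇u)(x)|² dx − S^{rad}_{N,α} (∫_{ℝ^N} |u(x)|^{2**_α} dx)^{2/2**_α} ≥ B · inf_{c ∈ ℝ, λ > 0} ∫_{ℝ^N} |div(|x|^α ∇(u − c U_{λ,α}))(x)|² dx. (Quantitative stability / remainder term for the radial weighted inequality, measuring the squared distance to the manifold of extremals {c U_{λ,α} : c ∈ ℝ, λ > 0}.) -/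

import Mathlib

open Real MeasureTheory Filter

noncomputable section

/-- Laplacian of a real-valued function on Euclidean space. -/
def lap {N : ℕ} (u : EuclideanSpace ℝ (Fin N) → ℝ) (x : EuclideanSpace ℝ (Fin N)) : ℝ :=
  ∑ i : Fin N, fderiv ℝ (fun y => fderiv ℝ u y (EuclideanSpace.single i 1)) x
    (EuclideanSpace.single i 1)

/-- The weighted operator `div(|x|^α ∇u)(x) = |x|^α Δu(x) + α |x|^(α-2) (x · ∇u(x))`.
Note that `x · ∇u(x)` is the directional derivative of `u` at `x` along `x`. -/
def wOp {N : ℕ} (α : ℝ) (u : EuclideanSpace ℝ (Fin N) → ℝ) (x : EuclideanSpace ℝ (Fin N)) : ℝ :=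
  ‖x‖ ^ α * lap u x + α * ‖x‖ ^ (α - 2) * fderiv ℝ u x x

/-- The constant `C_{N,α} = [(N−4+2α)(N−2+α)N(N+2−α)]^{(N−4+2α)/(8−4α)}`. -/
def Cconst (N : ℕ) (α : ℝ) : ℝ :=
  (((N : ℝ) - 4 + 2*α) * ((N : ℝ) - 2 + α) * (N : ℝ) * ((N : ℝ) + 2 - α)) ^
    (((N : ℝ) - 4 + 2*α) / (8 - 4*α))

/-- The radial solution `U_{λ,α}(x) = C_{N,α} λ^{(N−4+2α)/2} (1+λ^{2−α}|x|^{2−α})^{−(N−4+2α)/(2−α)}`. -/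
def Usol (N : ℕ) (α lam : ℝ) (x : EuclideanSpace ℝ (Fin N)) : ℝ :=
  Cconst N α * lam ^ (((N : ℝ) - 4 + 2*α)/2) *
    (1 + lam ^ (2-α) * ‖x‖ ^ (2-α)) ^ (-(((N : ℝ) - 4 + 2*α)/(2-α)))

/-- The critical exponent `2**_α = 2N/(N-4+2α)`. -/
def pexp (N : ℕ) (α : ℝ) : ℝ := 2*(N : ℝ)/((N : ℝ) - 4 + 2*α)

/-- The constant `C(M) = (M−4)(M−2)M(M+2)(Γ(M/2)²/(2Γ(M)))^{4/M}`. -/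
def CM (M : ℝ) : ℝ :=
  (M-4)*(M-2)*M*(M+2) * (Real.Gamma (M/2)^2 / (2*Real.Gamma M)) ^ ((4 : ℝ)/M)

/-- The sharp radial constant `S^{rad}_{N,α}`. -/
def Srad (N : ℕ) (α : ℝ) : ℝ :=
  ((2-α)/2) ^ ((4 : ℝ) - (4-2*α)/(N : ℝ)) *
    (2 * Real.pi ^ ((N : ℝ)/2) / Real.Gamma ((N : ℝ)/2)) ^ ((4-2*α)/(N : ℝ)) *
    CM (2*(N : ℝ)/(2-α))

/-- The odd power `|x|^(p-2) x`, which is `1/p` times the derivative of `|x|^p`. -/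
def signedPow (p x : ℝ) : ℝ := |x| ^ (p - 2) * x

lemma continuous_abs_rpow {p : ℝ} (hp : 0 ≤ p) : Continuous fun x : ℝ => |x| ^ p :=
  continuous_abs.rpow_const fun _ => Or.inr hp

lemma continuous_signedPow {p : ℝ} (hp : 2 ≤ p) : Continuous (signedPow p) :=
  (continuous_abs_rpow (by linarith)).mul continuous_id

lemma hasDerivAt_signedPow {p : ℝ} (hp : 2 < p) (x : ℝ) :
    HasDerivAt (signedPow p) ((p - 1) * |x| ^ (p - 2)) x := by
  rcases eq_or_ne x 0 with rfl | hx
  · have h0 : (0 : ℝ) ^ (p - 2) = 0 := Real.zero_rpow (by linarith)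
    rw [hasDerivAt_iff_tendsto_slope]
    simp only [abs_zero, h0, mul_zero]
    have h1 : Tendsto (fun y : ℝ => |y| ^ (p - 2)) (nhdsWithin 0 {0}ᶜ) (nhds 0) := by
      have := (continuous_abs_rpow (p := p - 2) (by linarith)).tendsto 0
      simp only [abs_zero, h0] at this
      exact this.mono_left nhdsWithin_le_nhds
    refine h1.congr' ?_
    filter_upwards [self_mem_nhdsWithin] with y hy
    have hy : y ≠ 0 := hy
    simp only [slope, signedPow, vsub_eq_sub, sub_zero, smul_eq_mul, mul_zero]
    field_simp
  · have h1 : HasDerivAt (fun y : ℝ => |y| ^ (p - 2)) ((SignType.sign x : ℝ) * (p - 2) * |x| ^ (p - 2 - 1)) x := by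
      exact (hasDerivAt_abs hx).rpow_const (Or.inl (abs_ne_zero.2 hx))
    have h2 := h1.mul (hasDerivAt_id x)
    refine h2.congr_deriv ?_
    have h3 : |x| ^ (p - 2) = |x| ^ (p - 2 - 1) * |x| := by
      rw [← Real.rpow_add_one (abs_ne_zero.2 hx)]; ring_nf
    have h4 : (SignType.sign x : ℝ) * x = |x| := by
      exact sign_mul_self x
    simp only [id, mul_one]
    rw [h3]
    linear_combination (p - 2) * |x| ^ (p - 2 - 1) * h4

lemma hasDerivAt_abs_rpow_signedPow {p : ℝ} (hp : 2 < p) (x : ℝ) :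
    HasDerivAt (fun y : ℝ => |y| ^ p) (p * signedPow p x) x := by
  have := hasDerivAt_abs_rpow x (p := p) (by linarith)
  rwa [mul_assoc] at this

/-- Mean value theorem on the (unordered) segment between `x` and `y`. -/
lemma exists_sub_eq_deriv_mul_sub {f f' : ℝ → ℝ} (h : ∀ x, HasDerivAt f (f' x) x) (x y : ℝ) :
    ∃ z ∈ Set.uIcc x y, f y - f x = f' z * (y - x) := by
  rcases lt_trichotomy x y with hxy | rfl | hxy
  · obtain ⟨z, hz, hz'⟩ := exists_hasDerivAt_eq_slope f f' hxy
      (fun t _ => (h t).continuousAt.continuousWithinAt) (fun t _ => h t)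
    refine ⟨z, Set.uIcc_of_le hxy.le ▸ Set.Ioo_subset_Icc_self hz, ?_⟩
    rw [hz', div_mul_cancel₀ _ (by linarith)]
  · exact ⟨x, Set.left_mem_uIcc, by simp⟩
  · obtain ⟨z, hz, hz'⟩ := exists_hasDerivAt_eq_slope f f' hxy
      (fun t _ => (h t).continuousAt.continuousWithinAt) (fun t _ => h t)
    refine ⟨z, Set.uIcc_of_ge hxy.le ▸ Set.Ioo_subset_Icc_self hz, ?_⟩
    rw [hz']
    have : x - y ≠ 0 := by linarith
    field_simp
    ring

lemma abs_le_of_mem_uIcc {x y z : ℝ} (hz : z ∈ Set.uIcc x y) : |z| ≤ max |x| |y| := by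
  rw [Set.mem_uIcc] at hz
  rcases hz with hz | hz
  · exact abs_le_max_abs_abs hz.1 hz.2
  · rw [max_comm]; exact abs_le_max_abs_abs hz.1 hz.2

lemma exists_signedPow_sub {p : ℝ} (hp : 2 < p) (x y : ℝ) :
    ∃ q, 0 ≤ q ∧ q ≤ (p - 1) * (max |x| |y|) ^ (p - 2) ∧
      signedPow p y - signedPow p x = q * (y - x) := by
  obtain ⟨z, hz, h⟩ := exists_sub_eq_deriv_mul_sub (hasDerivAt_signedPow hp) x y
  refine ⟨_, ?_, ?_, h⟩
  · have := Real.rpow_nonneg (abs_nonneg z) (p - 2)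
    nlinarith
  · exact mul_le_mul_of_nonneg_left
      (Real.rpow_le_rpow (abs_nonneg _) (abs_le_of_mem_uIcc hz) (by linarith)) (by linarith)

/-- Pointwise form of the Brezis-Lieb splitting, for bounded arguments. -/
lemma abs_abs_add_rpow_sub_le {p : ℝ} (hp : 2 < p) {R x y : ℝ} (hx : |x| ≤ R) (hy : |y| ≤ R) :
    |(|x + y| ^ p - |x| ^ p - |y| ^ p)| ≤ p * ((p - 1) * (2 * R) ^ (p - 2)) * |x| * |y| := by
  have hd : ∀ t, HasDerivAt (fun t => |t + y| ^ p - |t| ^ p)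
      (p * signedPow p (t + y) - p * signedPow p t) t := fun t =>
    ((hasDerivAt_abs_rpow_signedPow hp (t + y)).comp_add_const t y).sub
      (hasDerivAt_abs_rpow_signedPow hp t)
  obtain ⟨z, hz, h⟩ := exists_sub_eq_deriv_mul_sub hd 0 x
  have hz' : |z| ≤ R := (abs_le_of_mem_uIcc hz).trans (by simp [hx])
  obtain ⟨q, hq0, hq, hq'⟩ := exists_signedPow_sub hp z (z + y)
  have hR : 0 ≤ R := (abs_nonneg x).trans hx
  have hq2 : q ≤ (p - 1) * (2 * R) ^ (p - 2) := hq.trans <| by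
    refine mul_le_mul_of_nonneg_left (Real.rpow_le_rpow (by positivity) ?_ (by linarith))
      (by linarith)
    exact max_le (by linarith) ((abs_add_le _ _).trans (by linarith))
  have h0 : (|(0 : ℝ)|) ^ p = 0 := by rw [abs_zero, Real.zero_rpow (by linarith)]
  simp only [zero_add, h0, sub_zero] at h
  have e : |x + y| ^ p - |x| ^ p - |y| ^ p = p * q * y * x := by
    linear_combination h + p * x * hq'
  rw [e, abs_mul, abs_mul, abs_mul, abs_of_nonneg hq0, abs_of_pos (by linarith : (0 : ℝ) < p)]
  have : p * q * |y| * |x| = q * (p * |x| * |y|) := by ring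
  rw [this]
  calc q * (p * |x| * |y|) ≤ ((p - 1) * (2 * R) ^ (p - 2)) * (p * |x| * |y|) :=
        mul_le_mul_of_nonneg_right hq2 (by positivity)
    _ = _ := by ring

/-- Second order Taylor expansion of `|x|^p`, uniform for bounded `x`. -/
lemma exists_taylor_abs_rpow {p : ℝ} (hp : 2 < p) (R : ℝ) {ε : ℝ} (hε : 0 < ε) :
    ∃ ρ > 0, ∀ x y : ℝ, |x| ≤ R → |y| ≤ ρ →
      |(|x + y| ^ p - |x| ^ p - p * signedPow p x * y -
        p * (p - 1) / 2 * |x| ^ (p - 2) * y ^ 2)| ≤ ε * y ^ 2 := by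
  have hc : UniformContinuousOn (fun x : ℝ => |x| ^ (p - 2)) (Set.Icc (-(R + 1)) (R + 1)) :=
    isCompact_Icc.uniformContinuousOn_of_continuous
      (continuous_abs_rpow (by linarith)).continuousOn
  rw [Metric.uniformContinuousOn_iff] at hc
  have hpp : 0 < p * (p - 1) := mul_pos (by linarith) (by linarith)
  obtain ⟨ρ, hρ, H⟩ := hc (ε / (p * (p - 1))) (by positivity)
  refine ⟨min (ρ / 2) 1, by positivity, fun x y hx hy => ?_⟩
  have hy1 : |y| ≤ 1 := hy.trans (min_le_right _ _)
  have hy2 : |y| < ρ := (hy.trans (min_le_left _ _)).trans_lt (by linarith)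
  have hd : ∀ t, HasDerivAt (fun t => |x + t| ^ p - p * signedPow p x * t -
        p * (p - 1) / 2 * |x| ^ (p - 2) * t ^ 2)
      (p * signedPow p (x + t) - p * signedPow p x - p * (p - 1) * |x| ^ (p - 2) * t) t := by
    intro t
    have h1 := (hasDerivAt_abs_rpow_signedPow hp (x + t)).comp_const_add x t
    have h2 := (hasDerivAt_id t).const_mul (p * signedPow p x)
    have h3 := (hasDerivAt_pow 2 t).const_mul (p * (p - 1) / 2 * |x| ^ (p - 2))
    refine ((h1.sub h2).sub h3).congr_deriv ?_
    push_cast; ring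
  obtain ⟨z, hz, h⟩ := exists_sub_eq_deriv_mul_sub hd 0 y
  obtain ⟨w, hw, h'⟩ := exists_sub_eq_deriv_mul_sub (hasDerivAt_signedPow hp) x (x + z)
  have hzy : |z| ≤ |y| := (abs_le_of_mem_uIcc hz).trans (by simp)
  have hwx : |w - x| ≤ |z| := by
    have := Set.abs_sub_left_of_mem_uIcc hw
    simpa using this
  have hxw : |(|w| ^ (p - 2) - |x| ^ (p - 2))| < ε / (p * (p - 1)) := by
    refine H w ?_ x ?_ ?_
    · rw [Set.mem_Icc, ← abs_le]
      calc |w| = |x + (w - x)| := by ring_nf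
        _ ≤ |x| + |w - x| := abs_add_le _ _
        _ ≤ R + 1 := by linarith
    · rw [Set.mem_Icc, ← abs_le]; linarith
    · rw [Real.dist_eq]; linarith
  simp only [add_zero, mul_zero, ne_eq, OfNat.ofNat_ne_zero, not_false_eq_true, zero_pow,
    sub_zero] at h
  have e : |x + y| ^ p - |x| ^ p - p * signedPow p x * y -
        p * (p - 1) / 2 * |x| ^ (p - 2) * y ^ 2 =
      (p * (p - 1)) * (|w| ^ (p - 2) - |x| ^ (p - 2)) * z * y := by
    linear_combination h + p * y * h'
  rw [e, abs_mul, abs_mul, abs_mul, abs_of_pos hpp]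
  have h5 : p * (p - 1) * |(|w| ^ (p - 2) - |x| ^ (p - 2))| ≤ ε := by
    rw [lt_div_iff₀ hpp] at hxw; linarith
  rw [← sq_abs y, sq]
  calc _ ≤ ε * |z| * |y| := by gcongr
    _ ≤ ε * (|y| * |y|) := by rw [mul_assoc]; gcongr

/-- A bounded sequence in a separable Hilbert space has a weakly convergent subsequence. -/
lemma exists_subseq_weak_tendsto {H : Type*} [NormedAddCommGroup H] [InnerProductSpace ℝ H]
    [CompleteSpace H] [TopologicalSpace.SeparableSpace H] (g : ℕ → H) (hg : ∀ n, ‖g n‖ ≤ 1) :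
    ∃ (w : H) (θ : ℕ → ℕ), StrictMono θ ∧ ‖w‖ ≤ 1 ∧
      ∀ h, Tendsto (fun n => inner ℝ (g (θ n)) h) atTop (nhds (inner ℝ w h)) := by
  have hs := WeakDual.isSeqCompact_closedBall ℝ H 0 1
  obtain ⟨a, ha, θ, hθ, hlim⟩ := hs (x := fun n => StrongDual.toWeakDual
    (InnerProductSpace.toDual ℝ H (g n))) (fun n => by
      simpa using hg n)
  have hlim' := fun h => ((WeakDual.eval_continuous h).tendsto a).comp hlim
  refine ⟨(InnerProductSpace.toDual ℝ H).symm (WeakDual.toStrongDual a), θ, hθ, ?_, fun h => ?_⟩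
  · simpa using ha
  · have := hlim' h
    rw [InnerProductSpace.toDual_symm_apply]
    exact this

/-- A translation invariant family of vectors in a Hilbert space, giving rise to an embedding
`h ↦ (t ↦ ⟪K t, h⟫)` into `L²(ℝ) ∩ L^∞(ℝ)`. -/
structure KernelSystem (H : Type*) [NormedAddCommGroup H] [InnerProductSpace ℝ H] where
  /-- the evaluation vectors -/
  K : ℝ → H
  /-- the translations -/
  V : ℝ → H ≃ₗᵢ[ℝ] H
  /-- the constant of the `L²` bound -/
  C : ℝ
  C_nonneg : 0 ≤ C
  continuous_K : Continuous K
  K_ne_zero : K 0 ≠ 0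
  V_K : ∀ τ t, V τ (K t) = K (t + τ)
  V_add : ∀ s t h, V (s + t) h = V s (V t h)
  integrable_sq : ∀ h, Integrable fun t => (inner ℝ (K t) h : ℝ) ^ 2
  integral_sq_le : ∀ h, ∫ t, (inner ℝ (K t) h : ℝ) ^ 2 ≤ C * ‖h‖ ^ 2

namespace KernelSystem

variable {H : Type*} [NormedAddCommGroup H] [InnerProductSpace ℝ H] (S : KernelSystem H)

/-- The function on the line attached to a vector. -/
def ev (h : H) (t : ℝ) : ℝ := inner ℝ (S.K t) h

/-- The `p`-th power of the `L^p` norm of the function attached to a vector. -/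
def F (p : ℝ) (h : H) : ℝ := ∫ t, |S.ev h t| ^ p

/-- The best constant in `F p h ≤ κ ‖h‖ ^ p`. -/
def kap (p : ℝ) : ℝ := sSup (S.F p '' Metric.sphere 0 1)

lemma V_zero (h : H) : S.V 0 h = h := by
  have := S.V_add 0 0 h
  rw [add_zero] at this
  exact ((S.V 0).injective this).symm

lemma V_neg_V (τ : ℝ) (h : H) : S.V (-τ) (S.V τ h) = h := by
  rw [← S.V_add, neg_add_cancel, S.V_zero]

lemma ev_V (τ t : ℝ) (h : H) : S.ev (S.V τ h) t = S.ev h (t - τ) := by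
  rw [ev, ev, ← (S.V τ).inner_map_map (S.K (t - τ)) h, S.V_K, sub_add_cancel]

lemma norm_K (t : ℝ) : ‖S.K t‖ = ‖S.K 0‖ := by
  have := (S.V t).norm_map (S.K 0)
  rwa [S.V_K, zero_add] at this

lemma continuous_ev (h : H) : Continuous (S.ev h) := S.continuous_K.inner continuous_const

lemma ev_add (g h : H) (t : ℝ) : S.ev (g + h) t = S.ev g t + S.ev h t := inner_add_right _ _ _

lemma ev_sub (g h : H) (t : ℝ) : S.ev (g - h) t = S.ev g t - S.ev h t := inner_sub_right _ _ _

lemma ev_smul (c : ℝ) (h : H) (t : ℝ) : S.ev (c • h) t = c * S.ev h t :=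
  real_inner_smul_right _ _ _

lemma abs_ev_le (h : H) (t : ℝ) : |S.ev h t| ≤ ‖S.K 0‖ * ‖h‖ := by
  rw [← S.norm_K t]; exact abs_real_inner_le_norm _ _

lemma integrable_ev_sq (h : H) : Integrable fun t => S.ev h t ^ 2 := S.integrable_sq h

lemma integral_ev_sq_le (h : H) : ∫ t, S.ev h t ^ 2 ≤ S.C * ‖h‖ ^ 2 := S.integral_sq_le h

lemma integrable_ev_mul_ev (g h : H) : Integrable fun t => S.ev g t * S.ev h t := by
  refine ((S.integrable_ev_sq g).add (S.integrable_ev_sq h)).mono'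
    ((S.continuous_ev g).mul (S.continuous_ev h)).aestronglyMeasurable (.of_forall fun t => ?_)
  rw [Real.norm_eq_abs, abs_mul]
  simp only [Pi.add_apply]
  nlinarith [sq_abs (S.ev g t), sq_abs (S.ev h t), sq_nonneg (|S.ev g t| - |S.ev h t|),
    sq_nonneg (S.ev g t), sq_nonneg (S.ev h t)]

/-- Products of two attached functions with a bounded continuous weight are integrable. -/
lemma integrable_weight_mul {q : ℝ → ℝ} (hq : Continuous q) {B : ℝ} (hB : ∀ t, |q t| ≤ B)
    (g h : H) : Integrable fun t => q t * (S.ev g t * S.ev h t) :=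
  (S.integrable_ev_mul_ev g h).bdd_mul hq.aestronglyMeasurable (.of_forall hB)

lemma abs_rpow_ev_le {r : ℝ} (hr : 0 ≤ r) (h : H) (t : ℝ) :
    |(|S.ev h t| ^ r)| ≤ (‖S.K 0‖ * ‖h‖) ^ r := by
  rw [abs_of_nonneg (by positivity)]
  exact Real.rpow_le_rpow (abs_nonneg _) (S.abs_ev_le h t) hr

lemma continuous_rpow_ev {r : ℝ} (hr : 0 ≤ r) (h : H) : Continuous fun t => |S.ev h t| ^ r :=
  (continuous_abs_rpow hr).comp (S.continuous_ev h)

lemma integrable_rpow_mul {p : ℝ} (hp : 2 < p) (f g h : H) :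
    Integrable fun t => |S.ev f t| ^ (p - 2) * (S.ev g t * S.ev h t) :=
  S.integrable_weight_mul (S.continuous_rpow_ev (by linarith) f)
    (S.abs_rpow_ev_le (by linarith) f) g h

lemma integrable_signedPow_mul {p : ℝ} (hp : 2 < p) (g h : H) :
    Integrable fun t => signedPow p (S.ev g t) * S.ev h t := by
  simpa only [signedPow, mul_assoc] using S.integrable_rpow_mul hp g g h

lemma abs_rpow_eq_mul {p : ℝ} (hp : 2 < p) (x : ℝ) : |x| ^ p = |x| ^ (p - 2) * (x * x) := by
  have : |x| ^ p = |x| ^ (p - 2) * |x| ^ (2 : ℝ) := by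
    rw [← Real.rpow_add' (abs_nonneg x) (by linarith)]; ring_nf
  rw [this, Real.rpow_two, sq_abs, sq]

lemma signedPow_mul_self {p : ℝ} (hp : 2 < p) (x : ℝ) : signedPow p x * x = |x| ^ p := by
  rw [abs_rpow_eq_mul hp, signedPow, mul_assoc]

lemma integrable_rpow_ev {p : ℝ} (hp : 2 < p) (h : H) : Integrable fun t => |S.ev h t| ^ p := by
  simpa only [abs_rpow_eq_mul hp] using S.integrable_rpow_mul hp h h h

lemma F_nonneg (p : ℝ) (h : H) : 0 ≤ S.F p h := integral_nonneg fun _ => by positivity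

lemma F_le_sup {p : ℝ} (hp : 2 < p) (h : H) {B : ℝ} (hB : ∀ t, |S.ev h t| ≤ B) :
    S.F p h ≤ B ^ (p - 2) * (S.C * ‖h‖ ^ 2) := by
  have hB0 : 0 ≤ B := (abs_nonneg _).trans (hB 0)
  calc S.F p h ≤ ∫ t, B ^ (p - 2) * S.ev h t ^ 2 := by
        refine integral_mono (S.integrable_rpow_ev hp h) ((S.integrable_ev_sq h).const_mul _)
          fun t => ?_
        simp only [abs_rpow_eq_mul hp, ← sq]
        exact mul_le_mul_of_nonneg_right
          (Real.rpow_le_rpow (abs_nonneg _) (hB t) (by linarith)) (sq_nonneg _)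
    _ ≤ _ := by
        rw [integral_const_mul]
        exact mul_le_mul_of_nonneg_left (S.integral_ev_sq_le h) (by positivity)

lemma F_V (p τ : ℝ) (h : H) : S.F p (S.V τ h) = S.F p h := by
  simp only [F, ev_V]
  exact integral_sub_right_eq_self (fun t => |S.ev h t| ^ p) τ

lemma F_smul (p c : ℝ) (h : H) : S.F p (c • h) = |c| ^ p * S.F p h := by
  simp only [F, ev_smul, abs_mul, ← integral_const_mul]
  congr 1; ext t
  exact Real.mul_rpow (abs_nonneg _) (abs_nonneg _)

lemma bddAbove_F {p : ℝ} (hp : 2 < p) : BddAbove (S.F p '' Metric.sphere 0 1) := by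
  refine ⟨(‖S.K 0‖) ^ (p - 2) * S.C, ?_⟩
  rintro _ ⟨h, hh, rfl⟩
  have hh : ‖h‖ = 1 := by simpa using hh
  have := S.F_le_sup hp h (S.abs_ev_le h)
  simpa [hh] using this

lemma F_le_kap {p : ℝ} (hp : 2 < p) {h : H} (hh : ‖h‖ = 1) : S.F p h ≤ S.kap p :=
  le_csSup (S.bddAbove_F hp) ⟨h, by simpa using hh, rfl⟩

lemma F_le {p : ℝ} (hp : 2 < p) (h : H) : S.F p h ≤ S.kap p * ‖h‖ ^ p := by
  rcases eq_or_ne h 0 with rfl | hh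
  · have : S.F p (0 : H) = 0 := by
      simp [F, ev, Real.zero_rpow (by linarith : p ≠ 0)]
    rw [this, norm_zero, Real.zero_rpow (by linarith), mul_zero]
  · have hn : 0 < ‖h‖ := norm_pos_iff.2 hh
    have h1 : h = ‖h‖ • (‖h‖⁻¹ • h) := by
      rw [smul_smul, mul_inv_cancel₀ hn.ne', one_smul]
    have h2 : ‖‖h‖⁻¹ • h‖ = 1 := by
      rw [norm_smul, norm_inv, norm_norm, inv_mul_cancel₀ hn.ne']
    conv_lhs => rw [h1, F_smul, abs_of_pos hn]
    rw [mul_comm]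
    exact mul_le_mul_of_nonneg_right (S.F_le_kap hp h2) (by positivity)

lemma F_pos {p : ℝ} (hp : 2 < p) {h : H} {t : ℝ} (ht : S.ev h t ≠ 0) : 0 < S.F p h := by
  refine (integral_pos_iff_support_of_nonneg (fun _ => by positivity)
    (S.integrable_rpow_ev hp h)).2 ?_
  refine IsOpen.measure_pos _ ?_ ⟨t, ?_⟩
  · exact (S.continuous_rpow_ev (by linarith) h).isOpen_support
  · exact (Real.rpow_pos_of_pos (abs_pos.2 ht) p).ne'

lemma kap_pos {p : ℝ} (hp : 2 < p) : 0 < S.kap p := by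
  have h0 : S.ev (S.K 0) 0 ≠ 0 := by
    rw [ev, real_inner_self_eq_norm_sq]
    exact pow_ne_zero _ (norm_ne_zero_iff.2 S.K_ne_zero)
  have h1 := (S.F_pos hp h0).trans_le (S.F_le hp (S.K 0))
  exact pos_of_mul_pos_left h1 (by positivity)

lemma exists_seq_kap (p : ℝ) :
    ∃ g : ℕ → H, (∀ n, ‖g n‖ = 1) ∧ (BddAbove (S.F p '' Metric.sphere 0 1) →
      Tendsto (fun n => S.F p (g n)) atTop (nhds (S.kap p))) := by
  have hne : (S.F p '' Metric.sphere 0 1).Nonempty := by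
    refine ⟨_, ‖S.K 0‖⁻¹ • S.K 0, ?_, rfl⟩
    simp [norm_smul, inv_mul_cancel₀ (norm_ne_zero_iff.2 S.K_ne_zero)]
  by_cases hb : BddAbove (S.F p '' Metric.sphere 0 1)
  · obtain ⟨u, -, hu, hu'⟩ := exists_seq_tendsto_sSup hne hb
    choose g hg hg' using hu'
    exact ⟨g, fun n => by simpa using hg n, fun _ => by simpa only [hg', kap] using hu⟩
  · obtain ⟨_, h, hh, -⟩ := hne
    exact ⟨fun _ => h, fun _ => by simpa using hh, fun h => absurd h hb⟩

lemma tendsto_integral_abs_mul {x : ℕ → H} {R : ℝ} (hx : ∀ n, ‖x n‖ ≤ R)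
    (h0 : ∀ t, Tendsto (fun n => S.ev (x n) t) atTop (nhds 0)) (w : H) :
    Tendsto (fun n => ∫ t, |S.ev (x n) t| * |S.ev w t|) atTop (nhds 0) := by
  have hInt : ∀ n, Integrable fun t => |S.ev (x n) t| * |S.ev w t| := fun n => by
    simpa only [abs_mul] using (S.integrable_ev_mul_ev (x n) w).abs
  have hR : 0 ≤ R := (norm_nonneg _).trans (hx 0)
  rw [Metric.tendsto_atTop]
  intro ε hε
  set δ := ε / (2 * (S.C * R ^ 2 + 1)) with hδ
  have hD : 0 < S.C * R ^ 2 + 1 := by have := S.C_nonneg; positivity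
  have hδ0 : 0 < δ := by positivity
  set W : ℕ → ℝ → ℝ := fun n t => max (|S.ev (x n) t| * |S.ev w t| - δ * S.ev (x n) t ^ 2) 0
  have hWc : ∀ n, Continuous (W n) := fun n =>
    (((S.continuous_ev _).abs.mul (S.continuous_ev _).abs).sub
      (((S.continuous_ev _).pow 2).const_mul δ)).max continuous_const
  have hWb : ∀ n t, W n t ≤ (4 * δ)⁻¹ * S.ev w t ^ 2 := fun n t => by
    refine max_le ?_ (by positivity)
    rw [← sq_abs (S.ev (x n) t), ← sq_abs (S.ev w t)]
    have : 0 ≤ (δ * |S.ev (x n) t| - |S.ev w t| / 2) ^ 2 / δ := by positivity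
    have e : (δ * |S.ev (x n) t| - |S.ev w t| / 2) ^ 2 / δ = δ * |S.ev (x n) t| ^ 2 -
      |S.ev (x n) t| * |S.ev w t| + (4 * δ)⁻¹ * |S.ev w t| ^ 2 := by field_simp; ring
    linarith
  have hWn : ∀ n t, ‖W n t‖ ≤ (4 * δ)⁻¹ * S.ev w t ^ 2 := fun n t => by
    rw [Real.norm_eq_abs, abs_of_nonneg (le_max_right _ _)]; exact hWb n t
  have hWi : Integrable fun t => (4 * δ)⁻¹ * S.ev w t ^ 2 := (S.integrable_ev_sq w).const_mul _
  have hW : Tendsto (fun n => ∫ t, W n t) atTop (nhds (∫ _ : ℝ, (0 : ℝ))) := by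
    refine tendsto_integral_of_dominated_convergence _
      (fun n => (hWc n).aestronglyMeasurable) hWi (fun n => .of_forall (hWn n))
      (.of_forall fun t => ?_)
    have := (((h0 t).abs.mul_const |S.ev w t|).sub (((h0 t).pow 2).const_mul δ)).max
      (tendsto_const_nhds (x := (0 : ℝ)))
    simpa [W] using this
  rw [integral_zero, Metric.tendsto_atTop] at hW
  obtain ⟨N, hN⟩ := hW (ε / 2) (by positivity)
  refine ⟨N, fun n hn => ?_⟩
  have h1 := hN n hn
  rw [Real.dist_eq, sub_zero] at h1 ⊢
  rw [abs_of_nonneg (integral_nonneg fun t => by positivity)]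
  have h2 : ∫ t, |S.ev (x n) t| * |S.ev w t| ≤ ∫ t, (W n t + δ * S.ev (x n) t ^ 2) := by
    refine integral_mono (hInt n) ((hWi.mono' (hWc n).aestronglyMeasurable
      (.of_forall (hWn n))).add ((S.integrable_ev_sq _).const_mul _)) fun t => ?_
    have := le_max_left (|S.ev (x n) t| * |S.ev w t| - δ * S.ev (x n) t ^ 2) 0
    change _ ≤ max _ _ + _
    linarith
  rw [integral_add (hWi.mono' (hWc n).aestronglyMeasurable (.of_forall (hWn n)))
    ((S.integrable_ev_sq _).const_mul _), integral_const_mul] at h2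
  have h3 : ∫ t, S.ev (x n) t ^ 2 ≤ S.C * R ^ 2 := (S.integral_ev_sq_le _).trans <|
    mul_le_mul_of_nonneg_left (pow_le_pow_left₀ (norm_nonneg _) (hx n) 2) S.C_nonneg
  have h4 : δ * ∫ t, S.ev (x n) t ^ 2 < ε / 2 := by
    calc δ * ∫ t, S.ev (x n) t ^ 2 ≤ δ * (S.C * R ^ 2) := by gcongr
      _ < δ * (S.C * R ^ 2 + 1) := by gcongr; linarith
      _ = ε / 2 := by rw [hδ]; field_simp
  linarith [le_abs_self (∫ t, W n t)]

/-- Along weakly convergent sequences, the functional splits. -/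
lemma tendsto_F_sub {p : ℝ} (hp : 2 < p) {g : ℕ → H} {w : H} {R : ℝ} (hg : ∀ n, ‖g n‖ ≤ R)
    (hw : ∀ h, Tendsto (fun n => inner ℝ (g n) h) atTop (nhds (inner ℝ w h))) :
    Tendsto (fun n => S.F p (g n) - S.F p (g n - w)) atTop (nhds (S.F p w)) := by
  have hev : ∀ t, Tendsto (fun n => S.ev (g n - w) t) atTop (nhds 0) := fun t => by
    have := (hw (S.K t)).sub_const (inner ℝ w (S.K t))
    rw [sub_self] at this
    refine this.congr fun n => ?_
    rw [ev, inner_sub_right, real_inner_comm, real_inner_comm w]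
  have hb : ∀ n, ‖g n - w‖ ≤ R + ‖w‖ := fun n => (norm_sub_le _ _).trans (by gcongr; exact hg n)
  have hlim := S.tendsto_integral_abs_mul hb hev w
  set A := ‖S.K 0‖ * (R + ‖w‖) with hA
  have hR : 0 ≤ R := (norm_nonneg _).trans (hg 0)
  set M := p * ((p - 1) * (2 * A) ^ (p - 2))
  rw [← tendsto_sub_nhds_zero_iff]
  refine squeeze_zero_norm (fun n => ?_) (by simpa using hlim.const_mul M)
  have e : S.F p (g n) - S.F p (g n - w) - S.F p w =
      ∫ t, (|S.ev (g n - w) t + S.ev w t| ^ p - |S.ev (g n - w) t| ^ p - |S.ev w t| ^ p) := by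
    have hs : ∀ t, S.ev (g n - w) t + S.ev w t = S.ev (g n) t := fun t => by rw [ev_sub]; ring
    simp only [hs]
    have i1 := integral_sub ((S.integrable_rpow_ev hp (g n)).sub
      (S.integrable_rpow_ev hp (g n - w))) (S.integrable_rpow_ev hp w)
    have i2 := integral_sub (S.integrable_rpow_ev hp (g n)) (S.integrable_rpow_ev hp (g n - w))
    simp only [Pi.sub_apply] at i1
    rw [i1, i2]
    rfl
  rw [e, ← integral_const_mul]
  refine norm_integral_le_of_norm_le ?_ (.of_forall fun t => ?_)
  · simpa only [abs_mul] using (S.integrable_ev_mul_ev (g n - w) w).abs.const_mul M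
  · rw [Real.norm_eq_abs, ← mul_assoc]
    refine abs_abs_add_rpow_sub_le hp ((S.abs_ev_le _ t).trans ?_) ((S.abs_ev_le _ t).trans ?_)
    · exact mul_le_mul_of_nonneg_left (hb n) (norm_nonneg _)
    · exact mul_le_mul_of_nonneg_left (by linarith) (norm_nonneg _)

lemma exists_le_abs_ev {p : ℝ} (hp : 2 < p) {κ : ℝ} (hκ : 0 < κ) :
    ∃ c > 0, ∀ h : H, ‖h‖ = 1 → κ < S.F p h → ∃ t, c ≤ |S.ev h t| := by
  have hC := S.C_nonneg
  refine ⟨(κ / (S.C + 1)) ^ (p - 2)⁻¹, by positivity, fun h hh hF => ?_⟩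
  by_contra! hlt
  have h1 := S.F_le_sup hp h fun t => (hlt t).le
  rw [Real.rpow_inv_rpow (by positivity) (by linarith), hh, one_pow, mul_one] at h1
  have h2 : κ / (S.C + 1) * S.C ≤ κ := by
    rw [div_mul_eq_mul_div, div_le_iff₀ (by positivity)]; nlinarith
  linarith

/-- A maximizing sequence on the sphere converges, up to translations and along a subsequence, to a
maximizer. -/
lemma exists_subseq_tendsto [CompleteSpace H] [TopologicalSpace.SeparableSpace H] {p : ℝ}
    (hp : 2 < p) (g : ℕ → H) (hg : ∀ n, ‖g n‖ = 1)
    (hF : Tendsto (fun n => S.F p (g n)) atTop (nhds (S.kap p))) :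
    ∃ (w : H) (θ : ℕ → ℕ) (τ : ℕ → ℝ), StrictMono θ ∧ ‖w‖ = 1 ∧ S.F p w = S.kap p ∧
      Tendsto (fun n => S.V (τ n) (g (θ n))) atTop (nhds w) := by
  have hκ := S.kap_pos hp
  obtain ⟨c, hc, hc'⟩ := S.exists_le_abs_ev hp (half_pos hκ)
  have hex : ∀ n, ∃ t, S.kap p / 2 < S.F p (g n) → c ≤ |S.ev (g n) t| := fun n => by
    by_cases h : S.kap p / 2 < S.F p (g n)
    · obtain ⟨t, ht⟩ := hc' _ (hg n) h
      exact ⟨t, fun _ => ht⟩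
    · exact ⟨0, fun h' => absurd h' h⟩
  choose t ht using hex
  set G : ℕ → H := fun n => S.V (-t n) (g n) with hG
  have hGn : ∀ n, ‖G n‖ = 1 := fun n => by rw [hG]; simp [hg]
  obtain ⟨w, θ, hθ, hw1, hw⟩ := exists_subseq_weak_tendsto G fun n => (hGn n).le
  have hFθ : Tendsto (fun n => S.F p (G (θ n))) atTop (nhds (S.kap p)) := by
    simp only [hG, F_V]; exact hF.comp hθ.tendsto_atTop
  have hw0 : w ≠ 0 := by
    rintro rfl
    have h1 := (hw (S.K 0)).abs
    rw [inner_zero_left, abs_zero] at h1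
    refine absurd (ge_of_tendsto h1 ?_) (not_le.2 hc)
    filter_upwards [hFθ.eventually_const_lt (half_lt_self hκ)] with n hn
    have := ht (θ n) (by rwa [hG, F_V] at hn)
    rw [real_inner_comm]
    change _ ≤ |S.ev (G (θ n)) 0|
    rw [hG, ev_V]
    simpa using this
  have hnorm : Tendsto (fun n => ‖G (θ n) - w‖ ^ 2) atTop (nhds (1 - ‖w‖ ^ 2)) := by
    have h1 := ((hw w).const_mul 2).const_sub (1 + ‖w‖ ^ 2)
    rw [real_inner_self_eq_norm_sq] at h1
    refine (h1.congr fun n => ?_).congr' .rfl |>.trans (by ring_nf; rfl)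
    rw [norm_sub_sq_real, hGn]; ring
  have hsplit := S.tendsto_F_sub hp (fun n => (hGn (θ n)).le) hw
  have hdiff : Tendsto (fun n => S.F p (G (θ n) - w)) atTop (nhds (S.kap p - S.F p w)) := by
    refine (hFθ.sub hsplit).congr fun n => by ring
  have hle : S.kap p - S.F p w ≤ S.kap p * (1 - ‖w‖ ^ 2) ^ (p / 2) := by
    refine le_of_tendsto_of_tendsto hdiff
      ((hnorm.rpow_const (Or.inr (by linarith : 0 ≤ p / 2))).const_mul _) (.of_forall fun n => ?_)
    refine (S.F_le hp _).trans_eq ?_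
    beta_reduce
    rw [← Real.rpow_two, ← Real.rpow_mul (norm_nonneg _)]
    ring_nf
  have hle' : S.F p w ≤ S.kap p * (‖w‖ ^ 2) ^ (p / 2) := by
    refine (S.F_le hp _).trans_eq ?_
    rw [← Real.rpow_two, ← Real.rpow_mul (norm_nonneg _)]
    ring_nf
  have hwpos : 0 < ‖w‖ ^ 2 := by have := norm_pos_iff.2 hw0; positivity
  have hwone : ‖w‖ ^ 2 = 1 := by
    by_contra hne
    have hlt : ‖w‖ ^ 2 < 1 := lt_of_le_of_ne (by nlinarith [norm_nonneg w]) hne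
    have h1 : (‖w‖ ^ 2) ^ (p / 2) < ‖w‖ ^ 2 := by
      simpa using Real.rpow_lt_rpow_of_exponent_gt hwpos hlt (by linarith : 1 < p / 2)
    have h2 : (1 - ‖w‖ ^ 2) ^ (p / 2) < 1 - ‖w‖ ^ 2 := by
      simpa using Real.rpow_lt_rpow_of_exponent_gt (by linarith : 0 < 1 - ‖w‖ ^ 2) (by linarith)
        (by linarith : 1 < p / 2)
    nlinarith
  have hw1' : ‖w‖ = 1 := (pow_eq_one_iff_of_nonneg (norm_nonneg w) two_ne_zero).1 hwone
  refine ⟨w, θ, fun n => -t (θ n), hθ, hw1', le_antisymm (S.F_le_kap hp hw1') ?_, ?_⟩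
  · rw [hwone, sub_self, Real.zero_rpow (by linarith)] at hle
    linarith
  · rw [tendsto_iff_norm_sub_tendsto_zero]
    rw [hwone, sub_self] at hnorm
    have := hnorm.sqrt
    simpa using this

end KernelSystem

lemma exists_one_add_rpow_le (q : ℝ) {ε : ℝ} (hε : 0 < ε) :
    ∃ ρ > 0, ∀ x, 0 ≤ x → x ≤ ρ → (1 + x) ^ q ≤ 1 + (q + ε) * x := by
  have hd : HasDerivAt (fun x : ℝ => (1 + x) ^ q) q 0 := by
    have := ((hasDerivAt_id (0 : ℝ)).const_add 1).rpow_const (p := q) (Or.inl (by simp))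
    simpa using this
  have := (hd.isLittleO.def hε)
  obtain ⟨ρ, hρ, H⟩ := Metric.eventually_nhds_iff_ball.1 this
  refine ⟨ρ / 2, by positivity, fun x hx hxρ => ?_⟩
  have h1 := H x (by rw [Metric.mem_ball, Real.dist_eq, sub_zero, abs_of_nonneg hx]; linarith)
  simp only [add_zero, one_rpow, sub_zero, smul_eq_mul, Real.norm_eq_abs, abs_of_nonneg hx] at h1
  have := (abs_le.1 h1).2
  linarith

/-- A number is nonpositive once it is dominated by `ε + C s` for all small `s`. -/
lemma eq_zero_of_mul_le_sq {L C ρ : ℝ} (hρ : 0 < ρ)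
    (h : ∀ s, |s| ≤ ρ → s * L ≤ C * s ^ 2) : L = 0 := by
  have key : ∀ L : ℝ, (∀ s, 0 < s → s ≤ ρ → s * L ≤ C * s ^ 2) → L ≤ 0 := by
    intro L h
    by_contra! hL
    set s := min ρ (L / (2 * (|C| + 1)))
    have hs : 0 < s := by positivity
    have h1 := h s hs (min_le_left _ _)
    have h2 : L ≤ C * s := by
      by_contra! h2
      nlinarith
    have h3 : C * s ≤ (|C| + 1) * (L / (2 * (|C| + 1))) :=
      mul_le_mul (by linarith [le_abs_self C]) (min_le_right _ _) hs.le (by positivity)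
    have h4 : (|C| + 1) * (L / (2 * (|C| + 1))) = L / 2 := by field_simp
    linarith
  refine le_antisymm (key L fun s hs hs' => h s (by rwa [abs_of_pos hs])) ?_
  have := key (-L) fun s hs hs' => by
    have := h (-s) (by rwa [abs_neg, abs_of_pos hs])
    linarith
  linarith

namespace KernelSystem

variable {H : Type*} [NormedAddCommGroup H] [InnerProductSpace ℝ H] (S : KernelSystem H)

/-- Second order expansion of the functional. -/
lemma exists_expansion {p : ℝ} (hp : 2 < p) (g : H) {ε : ℝ} (hε : 0 < ε) :
    ∃ ρ > 0, ∀ h : H, ‖h‖ ≤ ρ →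
      |S.F p (g + h) - S.F p g - p * (∫ t, signedPow p (S.ev g t) * S.ev h t) -
        p * (p - 1) / 2 * ∫ t, |S.ev g t| ^ (p - 2) * (S.ev h t * S.ev h t)| ≤ ε * ‖h‖ ^ 2 := by
  have hC := S.C_nonneg
  obtain ⟨ρ, hρ, H⟩ := exists_taylor_abs_rpow hp (‖S.K 0‖ * ‖g‖)
    (show 0 < ε / (S.C + 1) by positivity)
  refine ⟨ρ / (‖S.K 0‖ + 1), by positivity, fun h hh => ?_⟩
  have hsmall : ∀ t, |S.ev h t| ≤ ρ := fun t => by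
    refine (S.abs_ev_le h t).trans ?_
    calc ‖S.K 0‖ * ‖h‖ ≤ (‖S.K 0‖ + 1) * (ρ / (‖S.K 0‖ + 1)) := by gcongr; linarith
      _ = ρ := by field_simp
  have i1 := S.integrable_rpow_ev hp (g + h)
  have i2 := S.integrable_rpow_ev hp g
  have i3 := (S.integrable_signedPow_mul hp g h).const_mul p
  have i4 := (S.integrable_rpow_mul hp g h h).const_mul (p * (p - 1) / 2)
  have e : S.F p (g + h) - S.F p g - p * (∫ t, signedPow p (S.ev g t) * S.ev h t) -
        p * (p - 1) / 2 * ∫ t, |S.ev g t| ^ (p - 2) * (S.ev h t * S.ev h t) =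
      ∫ t, (|S.ev (g + h) t| ^ p - |S.ev g t| ^ p - p * (signedPow p (S.ev g t) * S.ev h t) -
        p * (p - 1) / 2 * (|S.ev g t| ^ (p - 2) * (S.ev h t * S.ev h t))) := by
    rw [integral_sub (by exact (i1.sub i2).sub i3) i4, integral_sub (by exact i1.sub i2) i3,
      integral_sub i1 i2, integral_const_mul, integral_const_mul]
    rfl
  rw [e, ← Real.norm_eq_abs]
  calc _ ≤ ∫ t, ε / (S.C + 1) * S.ev h t ^ 2 := by
        refine norm_integral_le_of_norm_le ((S.integrable_ev_sq h).const_mul _)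
          (.of_forall fun t => ?_)
        have := H (S.ev g t) (S.ev h t) (S.abs_ev_le g t) (hsmall t)
        rw [Real.norm_eq_abs, ev_add]
        convert this using 2
        ring
    _ ≤ ε / (S.C + 1) * (S.C * ‖h‖ ^ 2) := by
        rw [integral_const_mul]
        exact mul_le_mul_of_nonneg_left (S.integral_ev_sq_le h) (by positivity)
    _ ≤ ε / (S.C + 1) * ((S.C + 1) * ‖h‖ ^ 2) := by gcongr; linarith
    _ = ε * ‖h‖ ^ 2 := by field_simp

lemma integral_signedPow_add {p : ℝ} (hp : 2 < p) (g h k : H) :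
    ∫ t, signedPow p (S.ev g t) * S.ev (h + k) t =
      (∫ t, signedPow p (S.ev g t) * S.ev h t) + ∫ t, signedPow p (S.ev g t) * S.ev k t := by
  rw [← integral_add (S.integrable_signedPow_mul hp g h) (S.integrable_signedPow_mul hp g k)]
  simp only [ev_add, mul_add]

lemma integral_signedPow_smul (p c : ℝ) (g h : H) :
    ∫ t, signedPow p (S.ev g t) * S.ev (c • h) t =
      c * ∫ t, signedPow p (S.ev g t) * S.ev h t := by
  rw [← integral_const_mul]
  simp only [ev_smul, mul_left_comm]

/-- The quadratic form of the second variation, in polarized form. -/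
def Q (p : ℝ) (g h k : H) : ℝ := ∫ t, |S.ev g t| ^ (p - 2) * (S.ev h t * S.ev k t)

lemma Q_comm (p : ℝ) (g h k : H) : S.Q p g h k = S.Q p g k h := by
  simp only [Q, mul_comm (S.ev h _)]

lemma Q_add {p : ℝ} (hp : 2 < p) (g h k l : H) :
    S.Q p g h (k + l) = S.Q p g h k + S.Q p g h l := by
  rw [Q, Q, Q, ← integral_add (S.integrable_rpow_mul hp g h k) (S.integrable_rpow_mul hp g h l)]
  simp only [ev_add, mul_add]

lemma Q_smul (p c : ℝ) (g h k : H) : S.Q p g h (c • k) = c * S.Q p g h k := by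
  rw [Q, Q, ← integral_const_mul]
  simp only [ev_smul, mul_left_comm]

lemma Q_self (p : ℝ) (g k : H) : S.Q p g g k = ∫ t, signedPow p (S.ev g t) * S.ev k t := by
  simp only [Q, signedPow, mul_assoc]

lemma Q_add_smul {p : ℝ} (hp : 2 < p) (g h k : H) (s : ℝ) :
    S.Q p g (h + s • k) (h + s • k) = S.Q p g h h + 2 * s * S.Q p g h k + s ^ 2 * S.Q p g k k := by
  rw [Q_add S hp, Q_smul, S.Q_comm p g (h + s • k) h, S.Q_comm p g (h + s • k) k,
    Q_add S hp, Q_add S hp, Q_smul, Q_smul, S.Q_comm p g k h]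
  ring

section Maximizer

variable {p : ℝ} (hp : 2 < p) {w : H} (hw : ‖w‖ = 1) (hFw : S.F p w = S.kap p)
include hp hw hFw

lemma variation_bound {h : H} (hh : inner ℝ w h = 0) {ε : ℝ} (hε : 0 < ε) :
    ∃ ρ > 0, ∀ s, |s| ≤ ρ → s * (p * ∫ t, signedPow p (S.ev w t) * S.ev h t) ≤
      (S.kap p * ((p / 2 + ε) * ‖h‖ ^ 2) + ε * ‖h‖ ^ 2 - p * (p - 1) / 2 * S.Q p w h h) *
        s ^ 2 := by
  obtain ⟨ρ₁, hρ₁, H₁⟩ := S.exists_expansion hp w hε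
  obtain ⟨ρ₂, hρ₂, H₂⟩ := exists_one_add_rpow_le (p / 2) hε
  have hκ := S.kap_pos hp
  set n := ‖h‖ + 1 with hn
  have hn0 : 0 < n := by positivity
  have hhn : ‖h‖ ≤ n := by linarith
  refine ⟨min (ρ₁ / n) (min 1 (ρ₂ / n ^ 2)), by positivity, fun s hs => ?_⟩
  have hs1 : |s| * n ≤ ρ₁ := (le_div_iff₀ hn0).1 (hs.trans (min_le_left _ _))
  have hs2 : |s| ≤ 1 := hs.trans ((min_le_right _ _).trans (min_le_left _ _))
  have hs3 : |s| * n ^ 2 ≤ ρ₂ := (le_div_iff₀ (by positivity)).1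
    (hs.trans ((min_le_right _ _).trans (min_le_right _ _)))
  have hsq : s ^ 2 ≤ |s| := by rw [← sq_abs]; nlinarith [abs_nonneg s]
  have h1 := H₁ (s • h) (by
    rw [norm_smul, Real.norm_eq_abs]; exact (by gcongr : _ ≤ |s| * n).trans hs1)
  have h2 := H₂ (s ^ 2 * ‖h‖ ^ 2) (by positivity) (le_trans (by gcongr) hs3)
  have h3 := S.F_le hp (w + s • h)
  have h4 : ‖w + s • h‖ ^ p = (1 + s ^ 2 * ‖h‖ ^ 2) ^ (p / 2) := by
    have : 1 + s ^ 2 * ‖h‖ ^ 2 = ‖w + s • h‖ ^ 2 := by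
      rw [norm_add_sq_real, hw, real_inner_smul_right, hh, norm_smul, mul_pow, Real.norm_eq_abs,
        sq_abs]
      ring
    rw [this, ← Real.rpow_two, ← Real.rpow_mul (norm_nonneg _)]
    ring_nf
  rw [h4] at h3
  have h5 := mul_le_mul_of_nonneg_left h2 hκ.le
  change |_ - p * (p - 1) / 2 * S.Q p w (s • h) (s • h)| ≤ _ at h1
  rw [integral_signedPow_smul, hFw, Q_smul, Q_comm, Q_smul, norm_smul, mul_pow,
    Real.norm_eq_abs, sq_abs] at h1
  have h6 := (abs_le.1 h1).1
  nlinarith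

/-- The Euler-Lagrange equation of a maximizer. -/
lemma euler_lagrange (h : H) :
    ∫ t, signedPow p (S.ev w t) * S.ev h t = S.kap p * inner ℝ w h := by
  have key : ∀ k, inner ℝ w k = 0 → ∫ t, signedPow p (S.ev w t) * S.ev k t = 0 := by
    intro k hk
    obtain ⟨ρ, hρ, H⟩ := S.variation_bound hp hw hFw hk one_pos
    have := eq_zero_of_mul_le_sq hρ H
    exact (mul_eq_zero.1 this).resolve_left (by linarith)
  have hk : inner ℝ w (h - (inner ℝ w h : ℝ) • w) = 0 := by
    rw [inner_sub_right, real_inner_smul_right, real_inner_self_eq_norm_sq, hw]; ring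
  have h1 := S.integral_signedPow_add hp w (h - (inner ℝ w h : ℝ) • w) ((inner ℝ w h : ℝ) • w)
  rw [sub_add_cancel, key _ hk, zero_add, integral_signedPow_smul] at h1
  simp only [signedPow_mul_self hp] at h1
  rw [h1, mul_comm, ← hFw]; rfl

/-- The second variation at a maximizer. -/
lemma second_variation {h : H} (hh : inner ℝ w h = 0) :
    (p - 1) * S.Q p w h h ≤ S.kap p * ‖h‖ ^ 2 := by
  have hκ := S.kap_pos hp
  refine le_of_forall_pos_le_add fun ε hε => ?_
  set D := 2 / p * (S.kap p * ‖h‖ ^ 2 + ‖h‖ ^ 2) + 1 with hD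
  have hD0 : 0 < D := by positivity
  obtain ⟨ρ, hρ, H⟩ := S.variation_bound hp hw hFw hh (show 0 < ε / D by positivity)
  have h1 := H ρ (abs_of_pos hρ).le
  rw [S.euler_lagrange hp hw hFw, hh, mul_zero, mul_zero, mul_zero] at h1
  have h2 := nonneg_of_mul_nonneg_left h1 (by positivity)
  have h3 : (p - 1) * S.Q p w h h ≤ S.kap p * ‖h‖ ^ 2 + ε / D * (D - 1) := by
    have h4 : (2 / p) * (S.kap p * ((p / 2 + ε / D) * ‖h‖ ^ 2) + ε / D * ‖h‖ ^ 2 -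
      p * (p - 1) / 2 * S.Q p w h h) =
        S.kap p * ‖h‖ ^ 2 + ε / D * (D - 1) - (p - 1) * S.Q p w h h := by
      rw [hD]; field_simp; ring
    have : 0 ≤ (2 / p) * (S.kap p * ((p / 2 + ε / D) * ‖h‖ ^ 2) + ε / D * ‖h‖ ^ 2 -
      p * (p - 1) / 2 * S.Q p w h h) := mul_nonneg (by positivity) h2
    linarith
  have h5 : ε / D * (D - 1) ≤ ε := by
    rw [div_mul_eq_mul_div, div_le_iff₀ hD0]; nlinarith
  linarith

/-- Equality in the second variation yields the linearized Euler-Lagrange equation. -/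
lemma linearized_eq {h : H} (hh : inner ℝ w h = 0)
    (heq : S.kap p * ‖h‖ ^ 2 ≤ (p - 1) * S.Q p w h h) (k : H) :
    (p - 1) * S.Q p w h k = S.kap p * inner ℝ h k := by
  have hw' : (p - 1) * S.Q p w h w = 0 := by
    rw [Q_comm, Q_self, S.euler_lagrange hp hw hFw, hh, mul_zero, mul_zero]
  have key : ∀ k, inner ℝ w k = 0 → (p - 1) * S.Q p w h k - S.kap p * inner ℝ h k = 0 := by
    intro k hk
    have : (2 : ℝ) * ((p - 1) * S.Q p w h k - S.kap p * inner ℝ h k) = 0 := by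
      refine eq_zero_of_mul_le_sq (C := S.kap p * ‖k‖ ^ 2 - (p - 1) * S.Q p w k k) one_pos
        fun s _ => ?_
      have h1 := S.second_variation hp hw hFw (h := h + s • k) (by
        rw [inner_add_right, real_inner_smul_right, hh, hk]; ring)
      rw [Q_add_smul S hp, norm_add_sq_real, real_inner_smul_right, norm_smul, mul_pow,
        Real.norm_eq_abs, sq_abs] at h1
      linarith
    linarith
  have h1 := key (k - (inner ℝ w k : ℝ) • w) (by
    rw [inner_sub_right, real_inner_smul_right, real_inner_self_eq_norm_sq, hw]; ring)
  have h2 := S.Q_add hp w h (k - (inner ℝ w k : ℝ) • w) ((inner ℝ w k : ℝ) • w)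
  rw [sub_add_cancel, Q_smul] at h2
  rw [inner_sub_right, real_inner_smul_right, real_inner_comm w h, hh] at h1
  linear_combination h1 + (p - 1) * h2 + inner ℝ w k * hw'

end Maximizer

end KernelSystem

namespace KernelSystem

variable {H : Type*} [NormedAddCommGroup H] [InnerProductSpace ℝ H] (S : KernelSystem H)

/-- The deficit in the inequality `κ^(-2/p) F(g)^(2/p) ≤ ‖g‖²`. -/
def deficit (p : ℝ) (g : H) : ℝ := ‖g‖ ^ 2 - S.kap p ^ (-(2 / p)) * S.F p g ^ (2 / p)

/-- The squared distance to the two-parameter family `c • V τ w`. -/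
def orbitDist (w g : H) : ℝ := ⨅ x : ℝ × ℝ, ‖g - x.1 • S.V x.2 w‖ ^ 2

lemma orbitDist_le (w g : H) (c τ : ℝ) : S.orbitDist w g ≤ ‖g - c • S.V τ w‖ ^ 2 :=
  ciInf_le (f := fun x : ℝ × ℝ => ‖g - x.1 • S.V x.2 w‖ ^ 2)
    ⟨0, by rintro _ ⟨x, rfl⟩; positivity⟩ (c, τ)

lemma orbitDist_nonneg (w g : H) : 0 ≤ S.orbitDist w g := Real.iInf_nonneg fun _ => by positivity

lemma orbitDist_smul_le (w g : H) (c : ℝ) : S.orbitDist w (c • g) ≤ c ^ 2 * S.orbitDist w g := by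
  rw [orbitDist, orbitDist, Real.mul_iInf_of_nonneg (sq_nonneg c)]
  refine le_ciInf fun x => (S.orbitDist_le w (c • g) (c * x.1) x.2).trans_eq ?_
  rw [mul_smul, ← smul_sub, norm_smul, mul_pow, Real.norm_eq_abs, sq_abs]

lemma deficit_smul (p c : ℝ) (hp : 0 < p) (g : H) :
    S.deficit p (c • g) = c ^ 2 * S.deficit p g := by
  rw [deficit, deficit, F_smul, Real.mul_rpow (by positivity) (S.F_nonneg p g),
    ← Real.rpow_mul (abs_nonneg c), mul_div_cancel₀ _ hp.ne', Real.rpow_two, norm_smul, mul_pow,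
    Real.norm_eq_abs, sq_abs]
  ring

lemma deficit_V (p τ : ℝ) (g : H) : S.deficit p (S.V τ g) = S.deficit p g := by
  rw [deficit, deficit, F_V, LinearIsometryEquiv.norm_map]

lemma kap_mul_rpow_le {p : ℝ} (hp : 2 < p) (g : H) {x : ℝ} (hx : 0 ≤ x)
    (h : x ≤ S.kap p ^ (-(2 / p)) * S.F p g ^ (2 / p)) : S.kap p * x ^ (p / 2) ≤ S.F p g := by
  have hκ := S.kap_pos hp
  have h1 := Real.rpow_le_rpow hx h (show 0 ≤ p / 2 by positivity)
  have hF := S.F_nonneg p g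
  rw [Real.mul_rpow (by positivity) (by positivity), ← Real.rpow_mul hκ.le,
    ← Real.rpow_mul hF, show 2 / p * (p / 2) = 1 by field_simp,
    show -(2 / p) * (p / 2) = -1 by field_simp, Real.rpow_one, Real.rpow_neg_one] at h1
  calc S.kap p * x ^ (p / 2) ≤ S.kap p * ((S.kap p)⁻¹ * S.F p g) := by gcongr
    _ = S.F p g := by field_simp

/-- Weak continuity of the weighted quadratic form, for integrable weights. -/
lemma tendsto_Q {p : ℝ} (hp : 2 < p) {w h : H} {g : ℕ → H}
    (hInt : Integrable fun t => |S.ev w t| ^ (p - 2)) (hg : ∀ n, ‖g n‖ ≤ 1)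
    (hw : ∀ k, Tendsto (fun n => inner ℝ (g n) k) atTop (nhds (inner ℝ h k))) :
    Tendsto (fun n => S.Q p w (g n) (g n)) atTop (nhds (S.Q p w h h)) := by
  refine tendsto_integral_of_dominated_convergence
    (fun t => |S.ev w t| ^ (p - 2) * (‖S.K 0‖ * ‖S.K 0‖)) (fun n => ?_)
    (hInt.mul_const _) (fun n => .of_forall fun t => ?_) (.of_forall fun t => ?_)
  · exact (S.integrable_rpow_mul hp w (g n) (g n)).aestronglyMeasurable
  · rw [norm_mul, norm_mul, Real.norm_eq_abs, Real.norm_eq_abs, abs_of_nonneg (by positivity)]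
    have h1 : |S.ev (g n) t| ≤ ‖S.K 0‖ := (S.abs_ev_le _ _).trans
      (mul_le_of_le_one_right (norm_nonneg _) (hg n))
    gcongr
  · have h1 : Tendsto (fun n => S.ev (g n) t) atTop (nhds (S.ev h t)) := by
      simpa only [ev, real_inner_comm] using hw (S.K t)
    exact (h1.mul h1).const_mul _

section Stability

variable [CompleteSpace H] [TopologicalSpace.SeparableSpace H]
  {p : ℝ} (hp : 2 < p) {w η : H} (hw : ‖w‖ = 1) (hFw : S.F p w = S.kap p)
  (hInt : Integrable fun t => |S.ev w t| ^ (p - 2))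
  (hη : HasDerivAt (fun τ => S.V τ w) η 0)
  (hnd : ∀ h : H, (∀ k, (p - 1) * S.Q p w h k = S.kap p * inner ℝ h k) → ∃ θ : ℝ, h = θ • η)
include hp hw hFw hInt hη hnd

/-- Stability near a nondegenerate maximizer. -/
lemma exists_local_stability : ∃ ε > 0, ∀ e : ℝ, ∀ h : H, 0 < e → e ≤ ε → ‖h‖ = 1 →
    inner ℝ w h = 0 → (∀ τ, e ^ 2 / 2 ≤ ‖w + e • h - S.V τ w‖ ^ 2) →
    ε * e ^ 2 ≤ S.deficit p (w + e • h) := by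
  by_contra! hcon
  have hκ := S.kap_pos hp
  choose e h he hen hh hwh hV hD using fun n : ℕ => hcon (1 / ((n : ℝ) + 1)) (by positivity)
  have he0 : Tendsto e atTop (nhds 0) := squeeze_zero (fun n => (he n).le) hen
    tendsto_one_div_add_atTop_nhds_zero_nat
  have hF : ∀ n, S.kap p * (1 + p / 2 * (e n ^ 2 * (1 - 1 / ((n : ℝ) + 1)))) ≤
      S.F p (w + e n • h n) := by
    intro n
    have h1 := hD n
    have h01 : 1 / ((n : ℝ) + 1) ≤ 1 := by
      rw [div_le_one (by positivity)]; linarith [(Nat.cast_nonneg n : (0 : ℝ) ≤ n)]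
    have hx : 0 ≤ e n ^ 2 * (1 - 1 / ((n : ℝ) + 1)) := mul_nonneg (by positivity) (by linarith)
    rw [deficit, norm_add_sq_real, real_inner_smul_right, hwh, hw, norm_smul, hh,
      Real.norm_eq_abs, mul_one, sq_abs] at h1
    refine le_trans ?_ (S.kap_mul_rpow_le hp (w + e n • h n)
      (x := 1 + e n ^ 2 * (1 - 1 / ((n : ℝ) + 1))) (by linarith) (by linarith))
    exact mul_le_mul_of_nonneg_left (one_add_mul_self_le_rpow_one_add (by linarith)
      (by linarith)) hκ.le
  obtain ⟨k, θ, hθ, hk1, hk⟩ := exists_subseq_weak_tendsto h fun n => (hh n).le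
  have hQ := S.tendsto_Q hp hInt (fun n => (hh (θ n)).le) hk
  have hkQ : S.kap p ≤ (p - 1) * S.Q p w k k := by
    refine le_of_forall_pos_le_add fun ε hε => ?_
    obtain ⟨ρ, hρ, hexp⟩ := S.exists_expansion hp w (show 0 < p / 2 * ε by positivity)
    have hl : Tendsto (fun n : ℕ => S.kap p * (1 - 1 / ((θ n : ℝ) + 1))) atTop
        (nhds (S.kap p * (1 - 0))) :=
      ((tendsto_one_div_add_atTop_nhds_zero_nat.comp hθ.tendsto_atTop).const_sub 1).const_mul _
    rw [sub_zero, mul_one] at hl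
    refine le_of_tendsto_of_tendsto hl ((hQ.const_mul (p - 1)).add_const ε) ?_
    filter_upwards [(he0.comp hθ.tendsto_atTop).eventually_lt_const hρ] with n hn
    have hn : e (θ n) < ρ := hn
    have hp0 := he (θ n)
    have h1 := hexp (e (θ n) • h (θ n)) (by
      rw [norm_smul, hh, Real.norm_eq_abs, abs_of_pos hp0, mul_one]; exact hn.le)
    change |_ - p * (p - 1) / 2 * S.Q p w (e (θ n) • h (θ n)) (e (θ n) • h (θ n))| ≤ _ at h1
    rw [integral_signedPow_smul, S.euler_lagrange hp hw hFw, hwh, hFw, Q_smul, Q_comm, Q_smul,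
      norm_smul, mul_pow, hh, Real.norm_eq_abs, sq_abs] at h1
    have h2 := (abs_le.1 h1).2
    have h3 := hF (θ n)
    have h4 : p / 2 * e (θ n) ^ 2 * (S.kap p * (1 - 1 / ((θ n : ℝ) + 1))) ≤
        p / 2 * e (θ n) ^ 2 * ((p - 1) * S.Q p w (h (θ n)) (h (θ n)) + ε) := by linarith
    exact le_of_mul_le_mul_left h4 (by positivity)
  have hwk : inner ℝ w k = 0 := by
    have h1 := hk w
    simp only [real_inner_comm w, hwh] at h1
    exact tendsto_nhds_unique h1 tendsto_const_nhds
  have hk2 : ‖k‖ ^ 2 = 1 := by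
    have h1 := S.second_variation hp hw hFw hwk
    have h2 : ‖k‖ ^ 2 ≤ 1 := by nlinarith [norm_nonneg k]
    nlinarith
  obtain ⟨ϑ, hϑ⟩ := hnd k (S.linearized_eq hp hw hFw hwk (by rw [hk2, mul_one]; exact hkQ))
  have hstrong : Tendsto (fun n => ‖h (θ n) - k‖) atTop (nhds 0) := by
    have h1 : Tendsto (fun n => ‖h (θ n) - k‖ ^ 2) atTop (nhds 0) := by
      have h2 := ((hk k).const_mul 2).const_sub 2
      rw [real_inner_self_eq_norm_sq, hk2, mul_one, sub_self] at h2
      refine h2.congr fun n => ?_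
      rw [norm_sub_sq_real, hh, hk2]; ring
    simpa using h1.sqrt
  have hder : Tendsto (fun n => (e (θ n))⁻¹ * ‖S.V (e (θ n) * ϑ) w - w - (e (θ n) * ϑ) • η‖)
      atTop (nhds 0) := by
    have h1 : HasDerivAt (fun s => S.V (s * ϑ) w) (ϑ • η) 0 := by
      have h2 := (hasDerivAt_id (0 : ℝ)).mul_const ϑ
      have h3 : HasDerivAt (fun τ => S.V τ w) η ((id (0 : ℝ)) * ϑ) := by simpa using hη
      have h4 := h3.scomp (0 : ℝ) h2
      rw [one_mul] at h4
      exact h4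
    have h2 := (hasDerivAt_iff_isLittleO.1 h1).norm_left
    have h4 := (h2.comp_tendsto (he0.comp hθ.tendsto_atTop)).tendsto_div_nhds_zero
    refine h4.congr fun n => ?_
    simp only [Function.comp_apply, sub_zero, zero_mul, S.V_zero, smul_smul]
    rw [div_eq_inv_mul]
  have hsum := hstrong.add hder
  rw [add_zero] at hsum
  obtain ⟨n, hn⟩ := (hsum.eventually_lt_const (show (0 : ℝ) < 1 / 2 by norm_num)).exists
  have hp0 := he (θ n)
  have h1 := hV (θ n) (e (θ n) * ϑ)
  have h2 : ‖w + e (θ n) • h (θ n) - S.V (e (θ n) * ϑ) w‖ ≤ e (θ n) * (1 / 2) := by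
    have e1 : w + e (θ n) • h (θ n) - S.V (e (θ n) * ϑ) w =
        e (θ n) • (h (θ n) - k) - (S.V (e (θ n) * ϑ) w - w - (e (θ n) * ϑ) • η) := by
      rw [mul_smul, ← hϑ, smul_sub]; abel
    rw [e1]
    refine (norm_sub_le _ _).trans ?_
    rw [norm_smul, Real.norm_eq_abs, abs_of_pos hp0]
    have := mul_le_mul_of_nonneg_left hn.le hp0.le
    rwa [mul_add, mul_inv_cancel_left₀ hp0.ne'] at this
  have h3 := pow_le_pow_left₀ (norm_nonneg _) h2 2
  nlinarith [sq_pos_of_pos hp0]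

omit hw hFw hInt hη hnd in
/-- Almost maximizers are close to the orbit of the maximizers. -/
lemma exists_deficit_le (hmax : ∀ g : H, ‖g‖ = 1 → S.F p g = S.kap p → ∃ c τ : ℝ, g = c • S.V τ w)
    {ε : ℝ} (hε : 0 < ε) : ∃ δ > 0, ∀ g : H, ‖g‖ = 1 → ε ≤ S.orbitDist w g →
      δ ≤ S.deficit p g := by
  by_contra! hcon
  have hκ := S.kap_pos hp
  choose g hg hgε hD using fun n : ℕ => hcon (1 / ((n : ℝ) + 1)) (by positivity)
  have hF : Tendsto (fun n => S.F p (g n)) atTop (nhds (S.kap p)) := by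
    have h1 : Tendsto (fun n : ℕ => S.kap p * (1 - 1 / ((n : ℝ) + 1)) ^ (p / 2)) atTop
        (nhds (S.kap p * (1 - 0) ^ (p / 2))) :=
      ((tendsto_one_div_add_atTop_nhds_zero_nat.const_sub 1).rpow_const
        (Or.inr (by positivity))).const_mul _
    rw [sub_zero, one_rpow, mul_one] at h1
    refine tendsto_of_tendsto_of_tendsto_of_le_of_le h1 tendsto_const_nhds (fun n => ?_)
      fun n => S.F_le_kap hp (hg n)
    have h01 : 1 / ((n : ℝ) + 1) ≤ 1 := by
      rw [div_le_one (by positivity)]; linarith [(Nat.cast_nonneg n : (0 : ℝ) ≤ n)]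
    refine S.kap_mul_rpow_le hp (g n) (by linarith) ?_
    have := hD n
    rw [deficit, hg] at this
    linarith
  obtain ⟨k, θ, τ, hθ, hk1, hkF, hk⟩ := S.exists_subseq_tendsto hp g hg hF
  obtain ⟨c, σ, hc⟩ := hmax k hk1 hkF
  rw [tendsto_iff_norm_sub_tendsto_zero] at hk
  have hk2 := hk.pow 2
  rw [zero_pow two_ne_zero] at hk2
  refine absurd (ge_of_tendsto hk2 (.of_forall fun n => ?_)) (not_le.2 hε)
  refine (hgε (θ n)).trans ((S.orbitDist_le w _ c (-τ n + σ)).trans_eq ?_)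
  rw [← (S.V (-τ n)).norm_map (S.V (τ n) (g (θ n)) - k), map_sub, V_neg_V, hc, map_smul,
    S.V_add]

/-- Stability of the inequality `F(g) ≤ κ ‖g‖^p` when the maximizers form a nondegenerate orbit. -/
theorem exists_stability
    (hmax : ∀ g : H, ‖g‖ = 1 → S.F p g = S.kap p → ∃ c τ : ℝ, g = c • S.V τ w) :
    ∃ B > 0, ∀ g : H, B * S.orbitDist w g ≤ S.deficit p g := by
  obtain ⟨ε, hε, hloc⟩ := S.exists_local_stability hp hw hFw hInt hη hnd
  set ρ := min (1 / 4) (ε ^ 2 / 4) with hρ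
  have hρ0 : 0 < ρ := by positivity
  obtain ⟨δ, hδ, hglob⟩ := S.exists_deficit_le hp hmax hρ0
  suffices key : ∀ g : H, ‖g‖ = 1 → min ε δ * S.orbitDist w g ≤ S.deficit p g by
    refine ⟨min ε δ, by positivity, fun g => ?_⟩
    rcases eq_or_ne g 0 with rfl | hg
    · have h1 := S.orbitDist_smul_le w 0 0
      have h2 := S.deficit_smul p 0 (by linarith) 0
      have h3 := S.orbitDist_nonneg w 0
      rw [smul_zero] at h1 h2
      have h4 : S.orbitDist w 0 = 0 := by linarith
      rw [h4, h2]; simp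
    · have hn : 0 < ‖g‖ := norm_pos_iff.2 hg
      have h1 : ‖g‖ • (‖g‖⁻¹ • g) = g := by rw [smul_smul, mul_inv_cancel₀ hn.ne', one_smul]
      have h2 := key (‖g‖⁻¹ • g) (by rw [norm_smul, norm_inv, norm_norm, inv_mul_cancel₀ hn.ne'])
      have h3 := S.orbitDist_smul_le w (‖g‖⁻¹ • g) ‖g‖
      have h4 := S.deficit_smul p ‖g‖ (by linarith) (‖g‖⁻¹ • g)
      rw [h1] at h3 h4
      rw [h4]
      calc min ε δ * S.orbitDist w g ≤ min ε δ * (‖g‖ ^ 2 * S.orbitDist w (‖g‖⁻¹ • g)) := by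
            gcongr
        _ = ‖g‖ ^ 2 * (min ε δ * S.orbitDist w (‖g‖⁻¹ • g)) := by ring
        _ ≤ _ := by gcongr
  intro g hg
  have hdist1 : S.orbitDist w g ≤ 1 := by
    have := S.orbitDist_le w g 0 0
    rwa [zero_smul, sub_zero, hg, one_pow] at this
  have hdef0 : 0 ≤ S.deficit p g := by
    have hκ := S.kap_pos hp
    have h1 := S.F_le_kap hp hg
    have h2 := Real.rpow_le_rpow (S.F_nonneg p g) h1 (show 0 ≤ 2 / p by positivity)
    rw [deficit, hg, Real.rpow_neg hκ.le]
    have : (S.kap p ^ (2 / p))⁻¹ * S.F p g ^ (2 / p) ≤ 1 := by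
      rw [inv_mul_le_one₀ (by positivity)]; exact h2
    linarith
  rcases le_or_gt ρ (S.orbitDist w g) with hfar | hnear
  · calc min ε δ * S.orbitDist w g ≤ δ * 1 := by
          refine mul_le_mul (min_le_right _ _) hdist1 (S.orbitDist_nonneg _ _) hδ.le
      _ ≤ S.deficit p g := by rw [mul_one]; exact hglob g hg hfar
  rcases (S.orbitDist_nonneg w g).eq_or_lt with h0 | hpos
  · rw [← h0, mul_zero]; exact hdef0
  obtain ⟨⟨c₁, τ⟩, hcτ⟩ := exists_lt_of_ciInf_lt
    (show (⨅ x : ℝ × ℝ, ‖g - x.1 • S.V x.2 w‖ ^ 2) < 2 * S.orbitDist w g by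
      change S.orbitDist w g < _; linarith)
  simp only at hcτ
  set f := S.V (-τ) g with hf
  have hgf : g = S.V τ f := by
    have := S.V_neg_V (-τ) g
    rw [neg_neg] at this; exact this.symm
  have hfn : ‖f‖ = 1 := by rw [hf, LinearIsometryEquiv.norm_map, hg]
  set c : ℝ := inner ℝ w f with hc
  set d := f - c • w with hd
  have hwd : inner ℝ w d = 0 := by
    rw [hd, inner_sub_right, real_inner_smul_right, real_inner_self_eq_norm_sq, hw]; ring
  have hfd : ∀ x : ℝ, ‖f - x • w‖ ^ 2 = (c - x) ^ 2 + ‖d‖ ^ 2 := fun x => by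
    have : f - x • w = (c - x) • w + d := by rw [hd, sub_smul]; abel
    rw [this, norm_add_sq_real, real_inner_smul_left, hwd, norm_smul, mul_pow, hw,
      Real.norm_eq_abs, sq_abs]
    ring
  have hd2 : ‖d‖ ^ 2 < 2 * S.orbitDist w g := by
    have h1 : ‖g - c₁ • S.V τ w‖ = ‖f - c₁ • w‖ := by
      rw [hgf, ← map_smul, ← map_sub, LinearIsometryEquiv.norm_map]
    rw [h1, hfd] at hcτ
    nlinarith [sq_nonneg (c - c₁)]
  have hcd : c ^ 2 + ‖d‖ ^ 2 = 1 := by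
    have := hfd 0
    rw [zero_smul, sub_zero, hfn] at this
    linarith
  have hdle : S.orbitDist w g ≤ ‖d‖ ^ 2 := by
    refine (S.orbitDist_le w g c τ).trans_eq ?_
    rw [hgf, ← map_smul, ← map_sub, LinearIsometryEquiv.norm_map]
  have hdpos : 0 < ‖d‖ := by
    by_contra! h
    have : ‖d‖ = 0 := le_antisymm h (norm_nonneg _)
    rw [this] at hdle; linarith
  have hρ1 : ρ ≤ 1 / 4 := min_le_left _ _
  have hρ2 : ρ ≤ ε ^ 2 / 4 := min_le_right _ _
  have hc2 : 1 / 2 < c ^ 2 := by linarith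
  have hc0 : c ≠ 0 := by rintro h; rw [h] at hc2; norm_num at hc2
  have hcabs : 0 < |c| := abs_pos.2 hc0
  set e := ‖d‖ / |c| with he
  have he0 : 0 < e := by positivity
  have he2 : c ^ 2 * e ^ 2 = ‖d‖ ^ 2 := by
    rw [he, div_pow, sq_abs]; field_simp
  set h := (c * e)⁻¹ • d with hh
  have hfe : f = c • (w + e • h) := by
    rw [smul_add, smul_smul, hh, smul_smul, mul_inv_cancel₀ (by positivity), one_smul, hd]; abel
  have hh1 : ‖h‖ = 1 := by
    rw [hh, norm_smul, norm_inv, norm_mul, Real.norm_eq_abs, Real.norm_eq_abs, abs_of_pos he0, he,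
      mul_div_cancel₀ _ hcabs.ne', inv_mul_cancel₀ hdpos.ne']
  have hle := hloc e h he0 ?_ hh1 ?_ ?_
  · have h1 : S.deficit p g = c ^ 2 * S.deficit p (w + e • h) := by
      rw [hgf, deficit_V, hfe, deficit_smul _ _ _ (by linarith)]
    rw [h1]
    calc min ε δ * S.orbitDist w g ≤ ε * ‖d‖ ^ 2 :=
          mul_le_mul (min_le_left _ _) hdle (S.orbitDist_nonneg _ _) hε.le
      _ = c ^ 2 * (ε * e ^ 2) := by rw [← he2]; ring
      _ ≤ _ := mul_le_mul_of_nonneg_left hle (sq_nonneg c)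
  · refine abs_le_of_sq_le_sq' ?_ hε.le |>.2
    nlinarith
  · rw [hh, real_inner_smul_right, hwd, mul_zero]
  · intro σ
    have h1 : S.orbitDist w g ≤ c ^ 2 * ‖w + e • h - S.V σ w‖ ^ 2 := by
      refine (S.orbitDist_le w g c (τ + σ)).trans_eq ?_
      rw [hgf, S.V_add, ← map_smul, ← map_sub, LinearIsometryEquiv.norm_map, hfe, ← smul_sub,
        norm_smul, mul_pow, Real.norm_eq_abs, sq_abs]
    have h2 : c ^ 2 * (e ^ 2 / 2) ≤ c ^ 2 * ‖w + e • h - S.V σ w‖ ^ 2 := by linarith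
    exact le_of_mul_le_mul_left h2 (by positivity)

end Stability

end KernelSystem

lemma integrable_exp_neg_mul_abs {c : ℝ} (hc : 0 < c) :
    Integrable fun x : ℝ => exp (-(c * |x|)) := by
  rw [← integrableOn_univ, ← Set.Iic_union_Ioi (a := (0 : ℝ))]
  refine IntegrableOn.union ?_ ?_
  · refine (integrableOn_exp_mul_Iic hc 0).congr_fun (fun x hx => ?_) measurableSet_Iic
    have hx : x ≤ 0 := hx
    simp only [abs_of_nonpos hx]; ring_nf
  · refine (integrableOn_exp_mul_Ioi (neg_neg_iff_pos.2 hc) 0).congr_fun (fun x hx => ?_)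
      measurableSet_Ioi
    have hx : 0 < x := hx
    simp only [abs_of_pos hx]; ring_nf

/-- Exponential decay at `-∞` of bounded solutions of convolution inequalities whose coefficient
vanishes at `-∞`. -/
lemma exists_le_exp_of_le_convolution {a η C P W : ℝ} (hη : 0 ≤ η) (hηa : η < a) (hC : 0 ≤ C)
    {w q : ℝ → ℝ} (hw : ∀ t, |w t| ≤ W) (hq0 : ∀ t, 0 ≤ q t) (hqP : ∀ t, q t ≤ P)
    (hq : Tendsto q atBot (nhds 0))
    (h : ∀ t, |w t| ≤ C * ∫ τ, exp (-(a * |t - τ|)) * (q τ * |w τ|)) :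
    ∃ D, ∀ t, |w t| ≤ D * exp (η * t) := by
  have hW : 0 ≤ W := (abs_nonneg _).trans (hw 0)
  have hP : 0 ≤ P := (hq0 0).trans (hqP 0)
  have hi := integrable_exp_neg_mul_abs (show 0 < a - η by linarith)
  set k := ∫ x : ℝ, exp (-((a - η) * |x|)) with hk
  have hk0 : 0 ≤ k := integral_nonneg fun _ => (exp_pos _).le
  set ε := 1 / (2 * (C * k + 1)) with hε
  have hε0 : 0 < ε := by positivity
  have hCk : C * k * ε ≤ 1 / 2 := by
    rw [hε, mul_one_div, div_le_div_iff₀ (by positivity) (by norm_num)]; linarith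
  obtain ⟨T, hT⟩ := eventually_atBot.1 (hq.eventually_le_const hε0)
  set D' := P * W * exp (-(η * T)) with hD'
  have hD'0 : 0 ≤ D' := by positivity
  refine ⟨2 * (C * k * D'), fun t => ?_⟩
  have main : ∀ d, 0 < d → ∀ t, |w t| ≤ 2 * (C * k * D') * (exp (η * t) + d) := by
    intro d hd
    set θ : ℝ → ℝ := fun t => exp (η * t) + d with hθ
    have hθ0 : ∀ t, 0 < θ t := fun t => by positivity
    have hb : BddAbove (Set.range fun t => |w t| / θ t) := by
      refine ⟨W / d, ?_⟩
      rintro _ ⟨t, rfl⟩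
      refine div_le_div₀ hW (hw t) hd ?_
      have := exp_pos (η * t)
      simp only [hθ]; linarith
    set M := ⨆ t, |w t| / θ t with hM
    have hwM : ∀ t, |w t| ≤ M * θ t := fun t => by
      rw [← div_le_iff₀ (hθ0 t)]; exact le_ciSup hb t
    have hM0 : 0 ≤ M := Real.iSup_nonneg fun t => div_nonneg (abs_nonneg _) (hθ0 t).le
    have hqw : ∀ τ, q τ * |w τ| ≤ (ε * M + D') * θ τ := by
      intro τ
      rcases le_or_gt τ T with hτ | hτ
      · have h1 := mul_le_mul (hT τ hτ) (hwM τ) (abs_nonneg _) hε0.le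
        have h2 := mul_nonneg hD'0 (hθ0 τ).le
        linarith
      · have h1 := mul_le_mul (hqP τ) (hw τ) (abs_nonneg _) hP
        have h2 : (1 : ℝ) ≤ exp (-(η * T)) * θ τ := by
          have : exp (-(η * T)) * exp (η * τ) ≥ 1 := by
            rw [← exp_add]; refine one_le_exp ?_; nlinarith
          have h3 : 0 < exp (-(η * T)) * d := by positivity
          simp only [hθ, mul_add]; linarith
        have h3 : P * W ≤ D' * θ τ := by
          rw [hD', mul_assoc]; exact le_mul_of_one_le_right (by positivity) h2
        have h4 : 0 ≤ ε * M * θ τ := mul_nonneg (by positivity) (hθ0 τ).le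
        linarith
    have hexp : ∀ t τ, exp (-(a * |t - τ|)) * θ τ ≤ exp (-((a - η) * |t - τ|)) * θ t := by
      intro t τ
      have h1 : exp (η * τ) ≤ exp (η * |t - τ|) * exp (η * t) := by
        rw [← exp_add, exp_le_exp]
        have := neg_abs_le (t - τ)
        nlinarith
      have h2 : d ≤ exp (η * |t - τ|) * d :=
        le_mul_of_one_le_left hd.le (one_le_exp (by positivity))
      calc exp (-(a * |t - τ|)) * θ τ ≤ exp (-(a * |t - τ|)) * (exp (η * |t - τ|) * θ t) := by
            refine mul_le_mul_of_nonneg_left ?_ (exp_pos _).le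
            simp only [hθ, mul_add]; linarith
        _ = _ := by rw [← mul_assoc, ← exp_add]; ring_nf
    have hstep : ∀ t, |w t| ≤ (M / 2 + C * k * D') * θ t := by
      intro t
      have hi' : Integrable fun τ => exp (-((a - η) * |t - τ|)) * ((ε * M + D') * θ t) :=
        (hi.comp_sub_left t).mul_const _
      have h1 : ∫ τ, exp (-(a * |t - τ|)) * (q τ * |w τ|) ≤ k * ((ε * M + D') * θ t) := by
        rw [hk, ← integral_sub_left_eq_self (fun x : ℝ => exp (-((a - η) * |x|))) volume t,
          ← integral_mul_const]
        refine integral_mono_of_nonneg (.of_forall fun τ => ?_) hi' (.of_forall fun τ => ?_)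
        · exact mul_nonneg (exp_pos _).le (mul_nonneg (hq0 τ) (abs_nonneg _))
        · have h2 := mul_le_mul_of_nonneg_left (hqw τ) (exp_pos (-(a * |t - τ|))).le
          have h3 := mul_le_mul_of_nonneg_left (hexp t τ) (show 0 ≤ ε * M + D' by positivity)
          simp only
          linarith
      have h2 := mul_le_mul_of_nonneg_left h1 hC
      have h3 : C * k * ε * (M * θ t) ≤ 1 / 2 * (M * θ t) :=
        mul_le_mul_of_nonneg_right hCk (mul_nonneg hM0 (hθ0 t).le)
      have h4 := h t
      nlinarith
    have hMle : M ≤ M / 2 + C * k * D' := ciSup_le fun t => by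
      rw [div_le_iff₀ (hθ0 t)]; exact hstep t
    intro t
    exact (hwM t).trans (mul_le_mul_of_nonneg_right (by linarith) (hθ0 t).le)
  set E := 2 * (C * k * D') with hE
  have hE0 : 0 ≤ E := by positivity
  refine le_of_forall_pos_le_add fun ε' hε' => ?_
  have h1 := main (ε' / (E + 1)) (by positivity) t
  have h2 : E * (ε' / (E + 1)) ≤ ε' := by
    rw [mul_div_assoc', div_le_iff₀ (by positivity)]; nlinarith
  linarith

/-- A Gronwall lemma on `(-∞, t]`. -/
lemma eq_zero_of_le_integral_Iic {v : ℝ → ℝ} {C ζ M : ℝ} (hC : 0 < C) (hζ : 0 < ζ)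
    (hv0 : ∀ t, 0 ≤ v t) (hvM : ∀ t, v t ≤ M)
    (h : ∀ t, v t ≤ ∫ τ in Set.Iic t, C * exp (ζ * τ) * v τ) (t : ℝ) : v t = 0 := by
  have hM : 0 ≤ M := (hv0 0).trans (hvM 0)
  set L := 2 * C / ζ with hL
  have hL0 : 0 < L := by positivity
  set E : ℝ → ℝ := fun t => exp (L * exp (ζ * t)) with hE
  have hE1 : ∀ t, 1 ≤ E t := fun t => one_le_exp (by positivity)
  have hEd : ∀ t, HasDerivAt E (2 * (C * exp (ζ * t) * E t)) t := by
    intro t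
    have h1 := ((((hasDerivAt_id t).const_mul ζ).exp).const_mul L).exp
    refine h1.congr_deriv ?_
    simp only [id, hE, mul_one, hL]
    field_simp
  have hElim : Tendsto E atBot (nhds 1) := by
    have h1 : Tendsto (fun t : ℝ => L * exp (ζ * t)) atBot (nhds (L * 0)) :=
      (tendsto_exp_atBot.comp (tendsto_id.const_mul_atBot hζ)).const_mul L
    rw [mul_zero] at h1
    have h2 := (Real.continuous_exp.tendsto 0).comp h1
    rwa [exp_zero] at h2
  have hEi : ∀ t, IntegrableOn (fun τ => 2 * (C * exp (ζ * τ) * E τ)) (Set.Iic t) := by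
    intro t
    refine ((integrableOn_exp_mul_Iic hζ t).const_mul (2 * C * E t)).mono' ?_ ?_
    · exact (by fun_prop : Continuous fun τ => 2 * (C * exp (ζ * τ) * E τ)).aestronglyMeasurable
    · refine (ae_restrict_iff' measurableSet_Iic).2 (.of_forall fun τ hτ => ?_)
      have hτ : τ ≤ t := hτ
      rw [Real.norm_eq_abs, abs_of_nonneg (by positivity)]
      have h1 : E τ ≤ E t := exp_le_exp.2 (by gcongr)
      have : 0 ≤ C * exp (ζ * τ) := by positivity
      nlinarith
  have hInt : ∀ t, ∫ τ in Set.Iic t, 2 * (C * exp (ζ * τ) * E τ) = E t - 1 := fun t =>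
    integral_Iic_of_hasDerivAt_of_tendsto' (fun x _ => hEd x) (hEi t) hElim
  have key : ∀ n : ℕ, ∀ t, v t ≤ M * (1 / 2) ^ n * E t := by
    intro n
    induction n with
    | zero =>
      intro t
      have := hvM t
      have h1 := mul_le_mul_of_nonneg_left (hE1 t) hM
      simp only [pow_zero]; linarith
    | succ n ih =>
      intro t
      have h1 : ∫ τ in Set.Iic t, C * exp (ζ * τ) * v τ ≤
          ∫ τ in Set.Iic t, M * (1 / 2) ^ (n + 1) * (2 * (C * exp (ζ * τ) * E τ)) := by
        refine integral_mono_of_nonneg (.of_forall fun τ => ?_) ((hEi t).const_mul _)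
          (.of_forall fun τ => ?_)
        · exact mul_nonneg (by positivity) (hv0 τ)
        · have := mul_le_mul_of_nonneg_left (ih τ) (show 0 ≤ C * exp (ζ * τ) by positivity)
          simp only [pow_succ]
          linarith
      rw [integral_const_mul, hInt] at h1
      refine (h t).trans (h1.trans ?_)
      have : 0 ≤ M * (1 / 2) ^ (n + 1) := by positivity
      nlinarith
  refine le_antisymm ?_ (hv0 t)
  have hl : Tendsto (fun n : ℕ => M * (1 / 2) ^ n * E t) atTop (nhds (M * 0 * E t)) :=
    ((tendsto_pow_atTop_nhds_zero_of_lt_one (by norm_num) (by norm_num)).const_mul M).mul_const _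
  rw [mul_zero, zero_mul] at hl
  exact ge_of_tendsto' hl fun n => key n t

/-- The Green function of `(a² - D²)(b² - D²)`, up to a factor. -/
def green (a b c x : ℝ) : ℝ := c * (exp (-(a * |x|)) / a - exp (-(b * |x|)) / b)

/-- The initial value (Volterra) kernel associated with `green`. -/
def volterra (a b c x : ℝ) : ℝ :=
  c * ((exp (b * x) - exp (-(b * x))) / b - (exp (a * x) - exp (-(a * x))) / a)

lemma green_of_le {a b c x : ℝ} (hx : 0 ≤ x) :
    green a b c x = c * (exp (a * x) / a - exp (b * x) / b) + volterra a b c x := by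
  rw [green, volterra, abs_of_nonneg hx]; ring

lemma green_of_neg {a b c x : ℝ} (hx : x < 0) :
    green a b c x = c * (exp (a * x) / a - exp (b * x) / b) := by
  rw [green, abs_of_neg hx]; ring_nf

lemma abs_green_le {a b c x : ℝ} (ha : 0 < a) (hab : a < b) (hc : 0 ≤ c) :
    |green a b c x| ≤ c / a * exp (-(a * |x|)) := by
  have hb : 0 < b := ha.trans hab
  have h0 : exp (-(b * |x|)) ≤ exp (-(a * |x|)) :=
    exp_le_exp.2 (by nlinarith [abs_nonneg x])
  have h1 : exp (-(b * |x|)) / b ≤ exp (-(a * |x|)) / a :=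
    div_le_div₀ (exp_pos _).le h0 ha hab.le
  have h2 : 0 ≤ exp (-(b * |x|)) / b := by positivity
  rw [green, abs_of_nonneg (mul_nonneg hc (by linarith)), div_mul_eq_mul_div, mul_div_assoc]
  exact mul_le_mul_of_nonneg_left (by linarith) hc

lemma volterra_nonneg {a b c x : ℝ} (ha : 0 < a) (hab : a < b) (hc : 0 ≤ c) (hx : 0 ≤ x) :
    0 ≤ volterra a b c x := by
  have hb : 0 < b := ha.trans hab
  refine mul_nonneg hc (sub_nonneg.2 ?_)
  have hd : ∀ r : ℝ, ∀ y, HasDerivAt (fun y => r⁻¹ * (exp (r * y) - exp (-(r * y))))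
      (r⁻¹ * (r * (exp (r * y) + exp (-(r * y))))) y := by
    intro r y
    have h1 := (((hasDerivAt_id y).const_mul r).exp.sub ((hasDerivAt_id y).const_mul r).neg.exp)
    refine (h1.const_mul r⁻¹).congr_deriv ?_
    simp only [id, Pi.neg_apply]; ring
  have hmono : MonotoneOn (fun y => b⁻¹ * (exp (b * y) - exp (-(b * y))) -
      a⁻¹ * (exp (a * y) - exp (-(a * y)))) (Set.Ici 0) := by
    refine monotoneOn_of_deriv_nonneg (convex_Ici 0) (by fun_prop) (by fun_prop) fun y hy => ?_
    rw [interior_Ici] at hy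
    have hy : 0 < y := hy
    rw [((hd b y).fun_sub (hd a y)).deriv, inv_mul_cancel_left₀ hb.ne', inv_mul_cancel_left₀ ha.ne']
    have h1 : Real.cosh (a * y) ≤ Real.cosh (b * y) := by
      rw [Real.cosh_le_cosh, abs_of_pos (by positivity), abs_of_pos (by positivity)]
      gcongr
    rw [Real.cosh_eq, Real.cosh_eq] at h1
    linarith
  have := hmono (Set.self_mem_Ici) (Set.mem_Ici.2 hx) hx
  simp only [mul_zero, neg_zero, sub_self] at this
  rw [div_eq_inv_mul, div_eq_inv_mul]
  linarith

lemma volterra_le {a b c x : ℝ} (ha : 0 < a) (hab : a < b) (hc : 0 ≤ c) (hx : 0 ≤ x) :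
    volterra a b c x ≤ c / b * exp (b * x) := by
  have hb : 0 < b := ha.trans hab
  have h1 : 0 ≤ (exp (a * x) - exp (-(a * x))) / a :=
    div_nonneg (sub_nonneg.2 (exp_le_exp.2 (by nlinarith))) ha.le
  have h2 : (exp (b * x) - exp (-(b * x))) / b ≤ exp (b * x) / b := by
    gcongr; linarith [exp_pos (-(b * x))]
  rw [div_mul_eq_mul_div, mul_div_assoc]
  exact mul_le_mul_of_nonneg_left (by linarith) hc

lemma continuous_volterra (a b c : ℝ) : Continuous (volterra a b c) := by
  unfold volterra; fun_prop

lemma integrable_indicator_volterra {a b c : ℝ} (ha : 0 < a) (hab : a < b) (hc : 0 ≤ c)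
    {ψ : ℝ → ℝ} (hψ : Continuous ψ) (hB : Integrable fun τ => exp (-(b * τ)) * ψ τ) (t : ℝ) :
    IntegrableOn (fun τ => volterra a b c (t - τ) * ψ τ) (Set.Iic t) := by
  refine ((hB.abs.const_mul (c / b * exp (b * t))).integrableOn (s := Set.Iic t)).mono'
    (((continuous_volterra a b c).comp (continuous_sub_left t)).mul hψ).aestronglyMeasurable
    ((ae_restrict_iff' measurableSet_Iic).2 (.of_forall fun τ hτ => ?_))
  have hτ : 0 ≤ t - τ := sub_nonneg.2 hτ
  rw [norm_mul, Real.norm_eq_abs, abs_of_nonneg (volterra_nonneg ha hab hc hτ), Real.norm_eq_abs,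
    abs_mul, abs_of_pos (exp_pos _)]
  calc _ ≤ c / b * exp (b * (t - τ)) * |ψ τ| :=
        mul_le_mul_of_nonneg_right (volterra_le ha hab hc hτ) (abs_nonneg _)
    _ = _ := by rw [mul_sub, sub_eq_add_neg, exp_add]; ring

/-- The convolution with `green` in Volterra form. -/
lemma integral_green_mul {a b c : ℝ} (ha : 0 < a) (hab : a < b) (hc : 0 ≤ c)
    {ψ : ℝ → ℝ} (hψ : Continuous ψ) (hA : Integrable fun τ => exp (-(a * τ)) * ψ τ)
    (hB : Integrable fun τ => exp (-(b * τ)) * ψ τ) (t : ℝ) :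
    ∫ τ, green a b c (t - τ) * ψ τ = c / a * exp (a * t) * (∫ τ, exp (-(a * τ)) * ψ τ) -
      c / b * exp (b * t) * (∫ τ, exp (-(b * τ)) * ψ τ) +
      ∫ τ in Set.Iic t, volterra a b c (t - τ) * ψ τ := by
  have hI := integrable_indicator_volterra ha hab hc hψ hB t
  rw [← integral_indicator measurableSet_Iic, ← integral_const_mul, ← integral_const_mul,
    ← integral_sub (hA.const_mul _) (hB.const_mul _),
    ← integral_add (by exact (hA.const_mul _).sub (hB.const_mul _))
      ((integrable_indicator_iff measurableSet_Iic).2 hI)]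
  congr 1; ext τ
  have e : ∀ r, exp (r * (t - τ)) = exp (r * t) * exp (-(r * τ)) := fun r => by
    rw [← exp_add]; ring_nf
  by_cases hτ : τ ≤ t
  · rw [Set.indicator_of_mem (show τ ∈ Set.Iic t from hτ), green_of_le (by linarith), e, e]; ring
  · rw [Set.indicator_of_notMem (show τ ∉ Set.Iic t from hτ), green_of_neg (by linarith), e, e]
    ring

/-- Positivity for the Volterra form of the equation. -/
lemma nonneg_of_volterra_eq {a b c C ζ W Y : ℝ} (ha : 0 < a) (hab : a < b) (hc : 0 < c)
    (hC : 0 < C) (hζ : 0 < ζ) {w ψ : ℝ → ℝ} (hw : Continuous w) (hψ : Continuous ψ)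
    (hwb : ∀ t, |w t| ≤ W) (hq : ∀ t, ∃ q, 0 ≤ q ∧ q ≤ C * exp (ζ * t) ∧ ψ t = q * w t)
    (hB : Integrable fun τ => exp (-(b * τ)) * ψ τ) (hY : 0 ≤ Y)
    (heq : ∀ t, w t = c / b * exp (b * t) * Y +
      ∫ τ in Set.Iic t, volterra a b c (t - τ) * ψ τ) : (∀ t, 0 ≤ w t) ∧ Y = 0 := by
  have hb : 0 < b := ha.trans hab
  have hI := integrable_indicator_volterra ha hab hc.le hψ hB
  set v : ℝ → ℝ := fun t => exp (-(b * t)) * max (-w t) 0 with hv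
  have hv0 : ∀ t, 0 ≤ v t := fun t => mul_nonneg (exp_pos _).le (le_max_right _ _)
  have hvc : Continuous v := by fun_prop
  have hcancel : ∀ t, exp (-(b * t)) * exp (b * t) = 1 := fun t => by rw [← exp_add]; simp
  have hlow : ∀ t, -w t ≤ ∫ τ in Set.Iic t, volterra a b c (t - τ) * -ψ τ := by
    intro t
    simp only [mul_neg, integral_neg]
    have : 0 ≤ c / b * exp (b * t) * Y := by positivity
    linarith [heq t]
  set M := c / b * ∫ τ, |exp (-(b * τ)) * ψ τ| with hM
  have hM0 : 0 ≤ M := mul_nonneg (by positivity) (integral_nonneg fun _ => abs_nonneg _)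
  have hvM : ∀ t, v t ≤ M := by
    intro t
    have h1 : ∫ τ in Set.Iic t, volterra a b c (t - τ) * -ψ τ ≤ exp (b * t) * M := by
      rw [hM, ← mul_assoc, ← integral_const_mul]
      refine le_trans ?_ (setIntegral_le_integral (s := Set.Iic t) (hB.abs.const_mul _)
        (.of_forall fun τ => by positivity))
      refine setIntegral_mono_on (by simpa using (hI t).neg) (hB.abs.const_mul _).integrableOn
        measurableSet_Iic fun τ hτ => ?_
      have hτ : 0 ≤ t - τ := sub_nonneg.2 hτ
      rw [abs_mul, abs_of_pos (exp_pos _)]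
      calc _ ≤ volterra a b c (t - τ) * |ψ τ| :=
            mul_le_mul_of_nonneg_left (neg_le_abs _) (volterra_nonneg ha hab hc.le hτ)
        _ ≤ c / b * exp (b * (t - τ)) * |ψ τ| :=
            mul_le_mul_of_nonneg_right (volterra_le ha hab hc.le hτ) (abs_nonneg _)
        _ = _ := by rw [mul_sub, sub_eq_add_neg, exp_add]; ring
    have h2 : max (-w t) 0 ≤ exp (b * t) * M :=
      max_le ((hlow t).trans h1) (by positivity)
    calc v t ≤ exp (-(b * t)) * (exp (b * t) * M) :=
          mul_le_mul_of_nonneg_left h2 (exp_pos _).le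
      _ = M := by rw [← mul_assoc, hcancel, one_mul]
  have hInt : ∀ t, IntegrableOn (fun τ => c / b * C * exp (ζ * τ) * v τ) (Set.Iic t) := by
    intro t
    refine ((integrableOn_exp_mul_Iic hζ t).const_mul (c / b * C * M)).mono'
      (by fun_prop : Continuous fun τ => c / b * C * exp (ζ * τ) * v τ).aestronglyMeasurable
      (.of_forall fun τ => ?_)
    rw [Real.norm_eq_abs, abs_of_nonneg (mul_nonneg (by positivity) (hv0 τ))]
    have := mul_le_mul_of_nonneg_left (hvM τ) (show 0 ≤ c / b * C * exp (ζ * τ) by positivity)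
    linarith
  have hgron : ∀ t, v t ≤ ∫ τ in Set.Iic t, c / b * C * exp (ζ * τ) * v τ := by
    intro t
    have h1 : ∫ τ in Set.Iic t, volterra a b c (t - τ) * -ψ τ ≤
        exp (b * t) * ∫ τ in Set.Iic t, c / b * C * exp (ζ * τ) * v τ := by
      rw [← integral_const_mul]
      refine setIntegral_mono_on (by simpa using (hI t).neg) ((hInt t).const_mul _)
        measurableSet_Iic fun τ hτ => ?_
      have hτ : 0 ≤ t - τ := sub_nonneg.2 hτ
      obtain ⟨q, hq0, hqC, hqe⟩ := hq τ
      have hm := le_max_right (-w τ) 0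
      have h2 : -ψ τ ≤ C * exp (ζ * τ) * max (-w τ) 0 := by
        calc -ψ τ = q * -w τ := by rw [hqe]; ring
          _ ≤ q * max (-w τ) 0 := mul_le_mul_of_nonneg_left (le_max_left _ _) hq0
          _ ≤ _ := mul_le_mul_of_nonneg_right hqC hm
      calc _ ≤ volterra a b c (t - τ) * (C * exp (ζ * τ) * max (-w τ) 0) :=
            mul_le_mul_of_nonneg_left h2 (volterra_nonneg ha hab hc.le hτ)
        _ ≤ c / b * exp (b * (t - τ)) * (C * exp (ζ * τ) * max (-w τ) 0) :=
            mul_le_mul_of_nonneg_right (volterra_le ha hab hc.le hτ) (by positivity)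
        _ = _ := by rw [mul_sub, sub_eq_add_neg, exp_add]; simp only [hv]; ring
    have h0 : 0 ≤ ∫ τ in Set.Iic t, c / b * C * exp (ζ * τ) * v τ :=
      integral_nonneg fun τ => mul_nonneg (by positivity) (hv0 τ)
    have h2 : max (-w t) 0 ≤ exp (b * t) * ∫ τ in Set.Iic t, c / b * C * exp (ζ * τ) * v τ :=
      max_le ((hlow t).trans h1) (by positivity)
    calc v t ≤ exp (-(b * t)) * (exp (b * t) * _) :=
          mul_le_mul_of_nonneg_left h2 (exp_pos _).le
      _ = _ := by rw [← mul_assoc, hcancel, one_mul]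
  have hvz := eq_zero_of_le_integral_Iic (by positivity) hζ hv0 hvM hgron
  have hpos : ∀ t, 0 ≤ w t := by
    intro t
    have h1 : max (-w t) 0 = 0 := (mul_eq_zero.1 (hvz t)).resolve_left (exp_pos _).ne'
    have := le_max_left (-w t) 0
    linarith
  refine ⟨hpos, ?_⟩
  by_contra hY0
  have hY1 : 0 < Y := lt_of_le_of_ne hY (Ne.symm hY0)
  have hge : ∀ t, c / b * exp (b * t) * Y ≤ W := by
    intro t
    have h1 : 0 ≤ ∫ τ in Set.Iic t, volterra a b c (t - τ) * ψ τ := by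
      refine setIntegral_nonneg measurableSet_Iic fun τ hτ => ?_
      obtain ⟨q, hq0, -, hqe⟩ := hq τ
      rw [hqe]
      exact mul_nonneg (volterra_nonneg ha hab hc.le (sub_nonneg.2 hτ)) (mul_nonneg hq0 (hpos τ))
    linarith [heq t, le_abs_self (w t), hwb t]
  have h1 := hge (W / (c * Y))
  have h2 := add_one_le_exp (b * (W / (c * Y)))
  have h3 : c / b * (b * (W / (c * Y)) + 1) * Y ≤ W :=
    (mul_le_mul_of_nonneg_right (mul_le_mul_of_nonneg_left h2 (by positivity)) hY).trans h1
  have h4 : c / b * (b * (W / (c * Y)) + 1) * Y = W + c / b * Y := by field_simp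
  have h5 : 0 < c / b * Y := by positivity
  linarith

lemma integrable_exp_neg_mul_mul {r θ D P : ℝ} (hr : 0 < r) (hrθ : r < θ) {ψ : ℝ → ℝ}
    (hψ : Continuous ψ) (hψb : ∀ t, |ψ t| ≤ P) (hψd : ∀ t, |ψ t| ≤ D * exp (θ * t)) :
    Integrable fun τ => exp (-(r * τ)) * ψ τ := by
  have hm : AEStronglyMeasurable fun τ => exp (-(r * τ)) * ψ τ :=
    (by fun_prop : Continuous fun τ => exp (-(r * τ)) * ψ τ).aestronglyMeasurable
  rw [← integrableOn_univ, ← Set.Iic_union_Ioi (a := (0 : ℝ))]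
  refine IntegrableOn.union ?_ ?_
  · refine ((integrableOn_exp_mul_Iic (sub_pos.2 hrθ) 0).const_mul
      D).mono' hm.restrict (.of_forall fun τ => ?_)
    rw [norm_mul, Real.norm_eq_abs, abs_of_pos (exp_pos _), Real.norm_eq_abs]
    calc _ ≤ exp (-(r * τ)) * (D * exp (θ * τ)) :=
          mul_le_mul_of_nonneg_left (hψd τ) (exp_pos _).le
      _ = D * (exp (-(r * τ)) * exp (θ * τ)) := by ring
      _ = _ := by rw [← exp_add]; ring_nf
  · refine ((integrableOn_exp_mul_Ioi (neg_neg_iff_pos.2 hr) 0).mul_const P).mono'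
      hm.restrict (.of_forall fun τ => ?_)
    rw [norm_mul, Real.norm_eq_abs, abs_of_pos (exp_pos _), Real.norm_eq_abs, ← neg_mul]
    exact mul_le_mul_of_nonneg_left (hψb τ) (exp_pos _).le

/-- Uniqueness for the linear equation `w = green * (q w)`. -/
lemma eq_zero_of_green_eq {a b c C ζ η D P W : ℝ} (ha : 0 < a) (hab : a < b) (hc : 0 < c)
    (hC : 0 < C) (hζ : 0 < ζ) (hηζ : b < η + ζ) {w ψ : ℝ → ℝ} (hw : Continuous w)
    (hψ : Continuous ψ) (hwb : ∀ t, |w t| ≤ W) (hwd : ∀ t, |w t| ≤ D * exp (η * t))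
    (hq : ∀ t, ∃ q, 0 ≤ q ∧ q ≤ C * exp (ζ * t) ∧ ψ t = q * w t) (hψb : ∀ t, |ψ t| ≤ P)
    (heq : ∀ t, w t = ∫ τ, green a b c (t - τ) * ψ τ)
    (hA : ∫ τ, exp (-(a * τ)) * ψ τ = 0) (t : ℝ) : w t = 0 := by
  have hb : 0 < b := ha.trans hab
  have hψd : ∀ t, |ψ t| ≤ C * D * exp ((η + ζ) * t) := by
    intro t
    obtain ⟨q, hq0, hqC, hqe⟩ := hq t
    rw [hqe, abs_mul, abs_of_nonneg hq0]
    calc q * |w t| ≤ C * exp (ζ * t) * (D * exp (η * t)) :=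
          mul_le_mul hqC (hwd t) (abs_nonneg _) (by positivity)
      _ = _ := by rw [add_mul, exp_add]; ring
  have hInt : ∀ r, 0 < r → r ≤ b → Integrable fun τ => exp (-(r * τ)) * ψ τ := fun r hr hrb =>
    integrable_exp_neg_mul_mul hr (hrb.trans_lt hηζ) hψ hψb hψd
  have hvol : ∀ t, w t = c / b * exp (b * t) * (-∫ τ, exp (-(b * τ)) * ψ τ) +
      ∫ τ in Set.Iic t, volterra a b c (t - τ) * ψ τ := fun t => by
    rw [heq t, integral_green_mul ha hab hc.le hψ (hInt a ha hab.le) (hInt b hb le_rfl), hA]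
    ring
  have hwn : Continuous fun t => -w t := hw.neg
  have hψn : Continuous fun t => -ψ t := hψ.neg
  have hqn : ∀ t, ∃ q, 0 ≤ q ∧ q ≤ C * exp (ζ * t) ∧ -ψ t = q * -w t := fun t => by
    obtain ⟨q, h1, h2, h3⟩ := hq t
    exact ⟨q, h1, h2, by rw [h3]; ring⟩
  have hBn : Integrable fun τ => exp (-(b * τ)) * -ψ τ := by
    simpa only [mul_neg] using (hInt b hb le_rfl).fun_neg
  have hvoln : ∀ t, -w t = c / b * exp (b * t) * (∫ τ, exp (-(b * τ)) * ψ τ) +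
      ∫ τ in Set.Iic t, volterra a b c (t - τ) * -ψ τ := fun t => by
    simp only [mul_neg, integral_neg]
    rw [hvol t]; ring
  have hpos : ∀ _ : 0 ≤ -∫ τ, exp (-(b * τ)) * ψ τ, (∀ t, 0 ≤ w t) ∧ _ := fun hY =>
    nonneg_of_volterra_eq ha hab hc hC hζ hw hψ hwb hq (hInt b hb le_rfl) hY hvol
  have hneg : ∀ _ : 0 ≤ ∫ τ, exp (-(b * τ)) * ψ τ, (∀ t, 0 ≤ -w t) ∧ _ := fun hY =>
    nonneg_of_volterra_eq ha hab hc hC hζ hwn hψn (by simpa using hwb) hqn hBn hY hvoln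
  rcases le_total 0 (∫ τ, exp (-(b * τ)) * ψ τ) with hY | hY
  · obtain ⟨h1, h2⟩ := hneg hY
    have h3 := (hpos (by rw [h2, neg_zero])).1 t
    linarith [h1 t]
  · obtain ⟨h1, h2⟩ := hpos (by linarith)
    have h3 := (hneg (by linarith)).1 t
    linarith [h1 t]

lemma continuous_green (a b c : ℝ) : Continuous (green a b c) := by
  unfold green; fun_prop

lemma green_neg (a b c x : ℝ) : green a b c (-x) = green a b c x := by
  rw [green, green, abs_neg]

namespace KernelSystem

variable {H : Type*} [NormedAddCommGroup H] [InnerProductSpace ℝ H] (S : KernelSystem H)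

/-- The reproducing kernel of the system is the Green function `green a b c`. -/
structure IsGreen (a b c : ℝ) : Prop where
  a_pos : 0 < a
  a_lt_b : a < b
  c_pos : 0 < c
  inner_K : ∀ s t, inner ℝ (S.K s) (S.K t) = green a b c (s - t)

/-- The weak form of the linear equation `h = L T* (q T h)`. -/
def Weak (L : ℝ) (q : ℝ → ℝ) (h : H) : Prop :=
  ∀ k, inner ℝ h k = L * ∫ t, q t * (S.ev h t * S.ev k t)

/-- The weak form of the Euler-Lagrange equation. -/
def Crit (p l : ℝ) (g : H) : Prop := S.Weak l (fun t => |S.ev g t| ^ (p - 2)) g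

variable {S} {a b c p l L : ℝ}

lemma Crit.inner_eq {g : H} (hg : S.Crit p l g) (k : H) :
    inner ℝ g k = l * ∫ t, signedPow p (S.ev g t) * S.ev k t := by
  rw [hg k]
  simp only [signedPow, mul_assoc]

lemma crit_iff {g : H} :
    S.Crit p l g ↔ ∀ k, inner ℝ g k = l * ∫ t, signedPow p (S.ev g t) * S.ev k t := by
  refine ⟨fun h => h.inner_eq, fun h k => ?_⟩
  rw [h k]
  simp only [signedPow, mul_assoc]

lemma Crit.V {g : H} (hg : S.Crit p l g) (τ : ℝ) : S.Crit p l (S.V τ g) := by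
  rw [crit_iff]
  intro k
  have h1 : inner ℝ (S.V τ g) k = inner ℝ g (S.V (-τ) k) := by
    rw [← (S.V (-τ)).inner_map_map, S.V_neg_V]
  rw [h1, hg.inner_eq, ← integral_sub_right_eq_self _ τ]
  simp only [S.ev_V, sub_neg_eq_add, sub_add_cancel]

lemma Crit.neg {g : H} (hg : S.Crit p l g) : S.Crit p l (-g) := by
  intro k
  have h1 : ∀ t, S.ev (-g) t = -S.ev g t := fun t => inner_neg_right _ _
  simp only [h1, abs_neg, neg_mul, mul_neg, integral_neg, inner_neg_left]
  rw [hg k]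

lemma crit_zero : S.Crit p l 0 := by
  intro k
  have h1 : ∀ t, S.ev (0 : H) t = 0 := fun t => inner_zero_right _
  simp [h1]

lemma IsGreen.ev_K (hS : S.IsGreen a b c) (t τ : ℝ) : S.ev (S.K t) τ = green a b c (t - τ) := by
  rw [ev, hS.inner_K, ← neg_sub, green_neg]

lemma Weak.ev_eq (hS : S.IsGreen a b c) {q : ℝ → ℝ} {h : H} (hh : S.Weak L q h) (t : ℝ) :
    S.ev h t = ∫ τ, green a b c (t - τ) * (L * q τ * S.ev h τ) := by
  rw [ev, real_inner_comm, hh, ← integral_const_mul]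
  congr 1; ext τ
  rw [hS.ev_K]; ring

lemma IsGreen.tendsto_K (hS : S.IsGreen a b c) (s : ℝ) :
    Tendsto (S.ev (S.K s)) atBot (nhds 0) := by
  have h1 : Tendsto (fun t : ℝ => c / a * exp (-(a * |s - t|))) atBot (nhds (c / a * 0)) := by
    refine Tendsto.const_mul _ (tendsto_exp_neg_atTop_nhds_zero.comp
      (Tendsto.const_mul_atTop hS.a_pos (tendsto_abs_atTop_atTop.comp ?_)))
    exact tendsto_atTop_add_const_left _ s tendsto_neg_atBot_atTop
  rw [mul_zero] at h1
  refine squeeze_zero_norm (fun t => ?_) h1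
  rw [hS.ev_K]
  exact abs_green_le hS.a_pos hS.a_lt_b hS.c_pos.le

/-- The functions attached to vectors vanish at `-∞`. -/
lemma IsGreen.tendsto_ev [CompleteSpace H] (hS : S.IsGreen a b c) (h : H) :
    Tendsto (S.ev h) atBot (nhds 0) := by
  let W : Submodule ℝ H :=
    { carrier := {h | Tendsto (S.ev h) atBot (nhds 0)}
      add_mem' := fun {x y} hx hy => by
        have := Tendsto.add hx hy
        rw [add_zero] at this
        exact this.congr fun t => (S.ev_add x y t).symm
      zero_mem' := by
        refine tendsto_const_nhds.congr fun t => ?_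
        exact (inner_zero_right _).symm
      smul_mem' := fun r x hx => by
        have := Tendsto.const_mul r hx
        rw [mul_zero] at this
        exact this.congr fun t => (S.ev_smul r x t).symm }
  have hcl : IsClosed (W : Set H) := by
    refine isClosed_of_closure_subset fun x hx => ?_
    change Tendsto (S.ev x) atBot (nhds 0)
    rw [Metric.tendsto_nhds]
    intro ε hε
    have hK : 0 < ‖S.K 0‖ := norm_pos_iff.2 S.K_ne_zero
    obtain ⟨y, hy, hxy⟩ := Metric.mem_closure_iff.1 hx (ε / 2 / ‖S.K 0‖) (by positivity)
    filter_upwards [Metric.tendsto_nhds.1 (show Tendsto (S.ev y) atBot (nhds 0) from hy) (ε / 2)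
      (by positivity)] with t ht
    rw [dist_zero_right, Real.norm_eq_abs] at ht ⊢
    have h1 := S.abs_ev_le (x - y) t
    rw [lt_div_iff₀ hK, dist_eq_norm] at hxy
    have h2 : S.ev x t = S.ev (x - y) t + S.ev y t := by rw [S.ev_sub]; ring
    rw [h2]
    have := abs_add_le (S.ev (x - y) t) (S.ev y t)
    linarith
  have : CompleteSpace W := hcl.completeSpace_coe
  have hperp : Wᗮ ≤ W := fun x hx => by
    have h1 : ∀ t, S.ev x t = 0 := fun t => hx (S.K t) (hS.tendsto_K t)
    exact tendsto_const_nhds.congr fun t => (h1 t).symm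
  have htop : W = ⊤ := by
    rw [← W.sup_orthogonal_of_hasOrthogonalProjection, sup_eq_left.2 hperp]
  have : h ∈ W := htop ▸ Submodule.mem_top
  exact this

/-- Exponential decay of solutions at `-∞`. -/
lemma Weak.exists_le_exp [CompleteSpace H] (hS : S.IsGreen a b c) (hp : 2 < p) (hL : 0 ≤ L)
    {f h : H} (hh : S.Weak L (fun t => |S.ev f t| ^ (p - 2)) h) {η : ℝ} (hη : 0 ≤ η)
    (hηa : η < a) : ∃ D, ∀ t, |S.ev h t| ≤ D * exp (η * t) := by
  have hp2 : 0 < p - 2 := by linarith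
  refine exists_le_exp_of_le_convolution (C := c / a * L) (W := ‖S.K 0‖ * ‖h‖)
    (P := (‖S.K 0‖ * ‖f‖) ^ (p - 2)) (q := fun t => |S.ev f t| ^ (p - 2)) hη hηa
    (mul_nonneg (div_nonneg hS.c_pos.le hS.a_pos.le) hL) (S.abs_ev_le h) (fun t => by positivity)
    (fun t => (le_abs_self _).trans (S.abs_rpow_ev_le hp2.le f t)) ?_ fun t => ?_
  · have h1 := (hS.tendsto_ev f).abs
    have h2 := h1.rpow_const (p := p - 2) (Or.inr hp2.le)
    rwa [abs_zero, Real.zero_rpow hp2.ne'] at h2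
  · rw [hh.ev_eq hS, ← integral_const_mul]
    refine (abs_integral_le_integral_abs).trans (integral_mono_of_nonneg
      (.of_forall fun τ => abs_nonneg _) ?_ (.of_forall fun τ => ?_))
    · refine Integrable.const_mul ?_ _
      refine (((integrable_exp_neg_mul_abs hS.a_pos).comp_sub_left t).mul_bdd
        (c := (‖S.K 0‖ * ‖f‖) ^ (p - 2) * (‖S.K 0‖ * ‖h‖)) ?_ (.of_forall fun τ => ?_))
      · exact ((S.continuous_rpow_ev hp2.le f).mul
          (S.continuous_ev h).abs).aestronglyMeasurable
      · rw [norm_mul, Real.norm_eq_abs, Real.norm_eq_abs, abs_abs]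
        exact mul_le_mul (S.abs_rpow_ev_le hp2.le f τ) (S.abs_ev_le h τ) (abs_nonneg _)
          (by positivity)
    · simp only [abs_mul]
      rw [abs_of_nonneg hL, abs_of_nonneg (show (0:ℝ) ≤ |S.ev f τ| ^ (p - 2) by positivity)]
      calc _ ≤ c / a * exp (-(a * |t - τ|)) * (L * |S.ev f τ| ^ (p - 2) * |S.ev h τ|) :=
            mul_le_mul_of_nonneg_right (abs_green_le hS.a_pos hS.a_lt_b hS.c_pos.le)
              (by positivity)
        _ = _ := by ring

lemma exists_rate (ha : 0 < a) (hab : a < b) (hp : 2 < p) (hpb : b < (p - 1) * a) :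
    ∃ η, 0 < η ∧ η < a ∧ b < η + (p - 2) * η := by
  obtain ⟨η, h1, h2⟩ := exists_between ((div_lt_iff₀ (by linarith : 0 < p - 1)).2
    (by rwa [mul_comm] : b < a * (p - 1)))
  have hb : 0 < b := ha.trans hab
  refine ⟨η, (div_pos hb (by linarith)).trans h1, h2, ?_⟩
  rw [div_lt_iff₀ (by linarith)] at h1
  linarith

lemma Weak.eq_zero_of_ev {q : ℝ → ℝ} {h : H} (hh : S.Weak L q h) (h0 : ∀ t, S.ev h t = 0) :
    h = 0 := by
  have := hh h
  simp only [h0, mul_zero, integral_zero] at this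
  exact inner_self_eq_zero.1 this

/-- The linear functional on solutions singled out by the growing mode `exp (a t)`. -/
lemma Weak.integrable_coeff [CompleteSpace H] (hS : S.IsGreen a b c) (hp : 2 < p)
    (hpb : b < (p - 1) * a) (hL : 0 ≤ L) {f h : H} (hl : 0 ≤ l) (hf : S.Crit p l f)
    (hh : S.Weak L (fun t => |S.ev f t| ^ (p - 2)) h) :
    Integrable fun τ => exp (-(a * τ)) * (|S.ev f τ| ^ (p - 2) * S.ev h τ) := by
  obtain ⟨η, hη0, hηa, hηb⟩ := exists_rate hS.a_pos hS.a_lt_b hp hpb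
  have hp2 : 0 < p - 2 := by linarith
  obtain ⟨D, hD⟩ := hf.exists_le_exp hS hp hl hη0.le hηa
  obtain ⟨E, hE⟩ := hh.exists_le_exp hS hp hL hη0.le hηa
  have hD0 : 0 ≤ D := nonneg_of_mul_nonneg_left ((abs_nonneg _).trans (hD 0)) (exp_pos _)
  refine integrable_exp_neg_mul_mul (D := D ^ (p - 2) * E) (P := (‖S.K 0‖ * ‖f‖) ^ (p - 2) *
    (‖S.K 0‖ * ‖h‖)) hS.a_pos (hS.a_lt_b.trans hηb)
    ((S.continuous_rpow_ev hp2.le f).mul (S.continuous_ev h)) (fun t => ?_) fun t => ?_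
  · rw [abs_mul]
    exact mul_le_mul (S.abs_rpow_ev_le hp2.le f t) (S.abs_ev_le h t) (abs_nonneg _)
      (by positivity)
  · rw [abs_mul, abs_of_nonneg (show (0:ℝ) ≤ |S.ev f t| ^ (p - 2) by positivity)]
    calc _ ≤ (D * exp (η * t)) ^ (p - 2) * (E * exp (η * t)) :=
          mul_le_mul (Real.rpow_le_rpow (abs_nonneg _) (hD t) hp2.le) (hE t) (abs_nonneg _)
            (by positivity)
      _ = D ^ (p - 2) * E * (exp (η * t) * exp ((p - 2) * η * t)) := by
          rw [Real.mul_rpow hD0 (exp_pos _).le, ← Real.exp_mul]; ring_nf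
      _ = _ := by rw [← exp_add]; ring_nf

lemma Weak.eq_zero [CompleteSpace H] (hS : S.IsGreen a b c) (hp : 2 < p)
    (hpb : b < (p - 1) * a) (hL : 0 ≤ L) {f h : H} (hl : 0 ≤ l) (hf : S.Crit p l f)
    (hh : S.Weak L (fun t => |S.ev f t| ^ (p - 2)) h)
    (hA : ∫ τ, exp (-(a * τ)) * (|S.ev f τ| ^ (p - 2) * S.ev h τ) = 0) : h = 0 := by
  obtain ⟨η, hη0, hηa, hηb⟩ := exists_rate hS.a_pos hS.a_lt_b hp hpb
  have hp2 : 0 < p - 2 := by linarith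
  obtain ⟨D, hD⟩ := hf.exists_le_exp hS hp hl hη0.le hηa
  obtain ⟨E, hE⟩ := hh.exists_le_exp hS hp hL hη0.le hηa
  have hD0 : 0 ≤ D := nonneg_of_mul_nonneg_left ((abs_nonneg _).trans (hD 0)) (exp_pos _)
  refine hh.eq_zero_of_ev fun t => eq_zero_of_green_eq (ψ := fun τ =>
    L * |S.ev f τ| ^ (p - 2) * S.ev h τ) (C := L * D ^ (p - 2) + 1) (ζ := (p - 2) * η)
    (P := L * (‖S.K 0‖ * ‖f‖) ^ (p - 2) * (‖S.K 0‖ * ‖h‖)) hS.a_pos hS.a_lt_b hS.c_pos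
    (by positivity) (by positivity) hηb (S.continuous_ev h)
    (((S.continuous_rpow_ev hp2.le f).const_mul L).mul (S.continuous_ev h)) (S.abs_ev_le h) hE
    (fun t => ⟨_, by positivity, ?_, rfl⟩) (fun t => ?_) (hh.ev_eq hS) ?_ t
  · have h1 := Real.rpow_le_rpow (abs_nonneg _) (hD t) hp2.le
    rw [Real.mul_rpow hD0 (exp_pos _).le, ← Real.exp_mul] at h1
    have h2 := mul_le_mul_of_nonneg_left h1 hL
    have h3 : η * t * (p - 2) = (p - 2) * η * t := by ring
    rw [h3] at h2
    linarith [exp_pos ((p - 2) * η * t)]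
  · rw [abs_mul, abs_mul, abs_of_nonneg hL]
    exact mul_le_mul (mul_le_mul_of_nonneg_left (S.abs_rpow_ev_le hp2.le f t) hL)
      (S.abs_ev_le h t) (abs_nonneg _) (by positivity)
  · rw [← mul_zero L, ← hA, ← integral_const_mul]
    congr 1; ext τ; ring

/-- Critical vectors are determined by the coefficient of the growing mode. -/
lemma Crit.eq_of_coeff_eq [CompleteSpace H] (hS : S.IsGreen a b c) (hp : 2 < p)
    (hpb : b < (p - 1) * a) (hl : 0 ≤ l) {f g : H} (hf : S.Crit p l f) (hg : S.Crit p l g)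
    (hA : ∫ τ, exp (-(a * τ)) * signedPow p (S.ev f τ) =
      ∫ τ, exp (-(a * τ)) * signedPow p (S.ev g τ)) : f = g := by
  obtain ⟨η, hη0, hηa, hηb⟩ := exists_rate hS.a_pos hS.a_lt_b hp hpb
  have hp2 : 0 < p - 2 := by linarith
  obtain ⟨D, hD⟩ := hf.exists_le_exp hS hp hl hη0.le hηa
  obtain ⟨E, hE⟩ := hg.exists_le_exp hS hp hl hη0.le hηa
  have hif := hf.integrable_coeff hS hp hpb hl hl hf
  have hig := hg.integrable_coeff hS hp hpb hl hl hg
  have hcont : ∀ h : H, Continuous fun t => signedPow p (S.ev h t) := fun h =>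
    (continuous_signedPow hp.le).comp (S.continuous_ev h)
  have hbd : ∀ h t, |signedPow p (S.ev h t)| ≤ (‖S.K 0‖ * ‖h‖) ^ (p - 2) * (‖S.K 0‖ * ‖h‖) :=
    fun h t => by
      rw [signedPow, abs_mul]
      exact mul_le_mul (S.abs_rpow_ev_le hp2.le h t) (S.abs_ev_le h t) (abs_nonneg _)
        (by positivity)
  have hev : ∀ t, S.ev (f - g) t = 0 := by
    set D' := max (max D E) 0 with hD'
    have hfD : ∀ t, |S.ev f t| ≤ D' * exp (η * t) := fun t => (hD t).trans
      (mul_le_mul_of_nonneg_right ((le_max_left D E).trans (le_max_left _ _)) (exp_pos _).le)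
    have hgD : ∀ t, |S.ev g t| ≤ D' * exp (η * t) := fun t => (hE t).trans
      (mul_le_mul_of_nonneg_right ((le_max_right D E).trans (le_max_left _ _)) (exp_pos _).le)
    have hD'0 : 0 ≤ D' := le_max_right _ _
    refine fun t => eq_zero_of_green_eq (ψ := fun τ =>
      l * (signedPow p (S.ev f τ) - signedPow p (S.ev g τ)))
      (C := l * ((p - 1) * D' ^ (p - 2)) + 1) (ζ := (p - 2) * η) (D := 2 * D')
      (P := l * ((‖S.K 0‖ * ‖f‖) ^ (p - 2) * (‖S.K 0‖ * ‖f‖) +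
        (‖S.K 0‖ * ‖g‖) ^ (p - 2) * (‖S.K 0‖ * ‖g‖)))
      hS.a_pos hS.a_lt_b hS.c_pos ?_ (by positivity) hηb (S.continuous_ev _)
      (((hcont f).sub (hcont g)).const_mul l) (S.abs_ev_le _) (fun t => ?_)
      (fun t => ?_) (fun t => ?_) (fun t => ?_) ?_ t
    · have : 0 ≤ p - 1 := by linarith
      positivity
    · rw [S.ev_sub]
      linarith [abs_sub (S.ev f t) (S.ev g t), hfD t, hgD t]
    · obtain ⟨q, hq0, hq1, hq2⟩ := exists_signedPow_sub hp (S.ev g t) (S.ev f t)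
      refine ⟨l * q, by positivity, ?_, by rw [hq2, S.ev_sub]; ring⟩
      have h1 : max |S.ev g t| |S.ev f t| ^ (p - 2) ≤ (D' * exp (η * t)) ^ (p - 2) :=
        Real.rpow_le_rpow ((abs_nonneg _).trans (le_max_left _ _)) (max_le (hgD t) (hfD t)) hp2.le
      rw [Real.mul_rpow hD'0 (exp_pos _).le, ← Real.exp_mul] at h1
      have h3 : η * t * (p - 2) = (p - 2) * η * t := by ring
      rw [h3] at h1
      have h4 := mul_le_mul_of_nonneg_left
        (hq1.trans (mul_le_mul_of_nonneg_left h1 (by linarith : 0 ≤ p - 1))) hl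
      linarith [exp_pos ((p - 2) * η * t)]
    · rw [abs_mul, abs_of_nonneg hl]
      refine mul_le_mul_of_nonneg_left ?_ hl
      linarith [abs_sub (signedPow p (S.ev f t)) (signedPow p (S.ev g t)), hbd f t, hbd g t]
    · have hgi : ∀ h : H, Integrable fun τ => green a b c (t - τ) * signedPow p (S.ev h τ) :=
        fun h => by
          have := S.integrable_signedPow_mul hp h (S.K t)
          refine this.congr (.of_forall fun τ => ?_)
          simp only [hS.ev_K]; ring
      have hk : ∀ h, S.Crit p l h →
          S.ev h t = l * ∫ τ, green a b c (t - τ) * signedPow p (S.ev h τ) := fun h hh => by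
        rw [Weak.ev_eq hS hh t, ← integral_const_mul]
        congr 1; ext τ; rw [signedPow]; ring
      rw [S.ev_sub, hk f hf, hk g hg, ← mul_sub, ← integral_sub (hgi f) (hgi g),
        ← integral_const_mul]
      congr 1; ext τ; ring
    · have h1 := integral_sub hif hig
      simp only [signedPow] at hA
      rw [hA, sub_self] at h1
      rw [← mul_zero l, ← h1, ← integral_const_mul]
      congr 1; ext τ; simp only [signedPow]; ring
  refine ext_inner_right ℝ fun k => ?_
  have h1 : S.ev f = S.ev g := funext fun t => by
    have := hev t
    rwa [S.ev_sub, sub_eq_zero] at this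
  rw [hf.inner_eq, hg.inner_eq, h1]

end KernelSystem

lemma signedPow_mul {p c : ℝ} (hc : 0 < c) (x : ℝ) :
    signedPow p (c * x) = c ^ (p - 1) * signedPow p x := by
  have h1 : c ^ (p - 1) = c ^ (p - 2) * c := by
    rw [← Real.rpow_add_one hc.ne']; ring_nf
  rw [signedPow, signedPow, abs_mul, abs_of_pos hc, Real.mul_rpow hc.le (abs_nonneg _), h1]
  ring

lemma signedPow_neg (p x : ℝ) : signedPow p (-x) = -signedPow p x := by
  rw [signedPow, signedPow, abs_neg, mul_neg]

namespace KernelSystem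

variable {H : Type*} [NormedAddCommGroup H] [InnerProductSpace ℝ H] (S : KernelSystem H)

/-- A positive, exponentially decaying, differentiable solution of the Euler-Lagrange equation. -/
structure IsGround (a p l : ℝ) (g : H) (φ' : ℝ → ℝ) : Prop where
  l_pos : 0 < l
  crit : S.Crit p l g
  pos : ∀ t, 0 < S.ev g t
  le : ∀ t, S.ev g t ≤ exp (-(a * |t|))
  hasDerivAt : ∀ t, HasDerivAt (S.ev g) (φ' t) t
  abs_deriv_le : ∀ t, |φ' t| ≤ a * S.ev g t
  continuous_deriv : Continuous φ'

variable {S} {a b c p l : ℝ} {g₀ : H} {φ' : ℝ → ℝ}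

namespace IsGround

lemma rpow_le (hg : S.IsGround a p l g₀ φ') {r : ℝ} (hr : 0 ≤ r) (t : ℝ) :
    |S.ev g₀ t| ^ r ≤ exp (-(r * a * |t|)) := by
  rw [abs_of_pos (hg.pos t)]
  refine (Real.rpow_le_rpow (hg.pos t).le (hg.le t) hr).trans_eq ?_
  rw [← Real.exp_mul]; ring_nf

lemma integrable_rpow (hg : S.IsGround a p l g₀ φ') (ha : 0 < a) {r : ℝ} (hr : 0 < r) :
    Integrable fun t => |S.ev g₀ t| ^ r := by
  refine (integrable_exp_neg_mul_abs (mul_pos hr ha)).mono'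
    (S.continuous_rpow_ev hr.le g₀).aestronglyMeasurable (.of_forall fun t => ?_)
  rw [Real.norm_eq_abs, abs_of_nonneg (by positivity)]
  exact hg.rpow_le hr.le t

lemma ne_zero (hg : S.IsGround a p l g₀ φ') : g₀ ≠ 0 := by
  rintro rfl
  have := hg.pos 0
  rw [ev, inner_zero_right] at this
  exact this.false

lemma signedPow_pos (hg : S.IsGround a p l g₀ φ') (t : ℝ) : 0 < signedPow p (S.ev g₀ t) :=
  mul_pos (Real.rpow_pos_of_pos (abs_pos.2 (hg.pos t).ne') _) (hg.pos t)

lemma signedPow_eq (hg : S.IsGround a p l g₀ φ') (t : ℝ) :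
    signedPow p (S.ev g₀ t) = |S.ev g₀ t| ^ (p - 1) := by
  have h := abs_pos.2 (hg.pos t).ne'
  have h2 : |S.ev g₀ t| ^ (p - 1) = |S.ev g₀ t| ^ (p - 2) * |S.ev g₀ t| := by
    rw [← Real.rpow_add_one h.ne']; ring_nf
  rw [h2, signedPow, abs_of_pos (hg.pos t)]

lemma integrable_exp_mul_signedPow (hg : S.IsGround a p l g₀ φ') (ha : 0 < a) (hp : 2 < p) :
    Integrable fun t => exp (-(a * t)) * signedPow p (S.ev g₀ t) := by
  refine (integrable_exp_neg_mul_abs (mul_pos (sub_pos.2 hp) ha)).mono'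
    (Continuous.aestronglyMeasurable ?_) (.of_forall fun t => ?_)
  · exact (by fun_prop : Continuous fun t : ℝ => exp (-(a * t))).mul
      ((continuous_signedPow hp.le).comp (S.continuous_ev g₀))
  · rw [Real.norm_eq_abs, abs_of_pos (mul_pos (exp_pos _) (hg.signedPow_pos t)), hg.signedPow_eq]
    refine (mul_le_mul_of_nonneg_left (hg.rpow_le (by linarith) t) (exp_pos _).le).trans ?_
    rw [← exp_add]
    refine exp_le_exp.2 ?_
    have := mul_le_mul_of_nonneg_left (neg_abs_le t) ha.le
    linarith

lemma coeff_pos (hg : S.IsGround a p l g₀ φ') (ha : 0 < a) (hp : 2 < p) :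
    0 < ∫ t, exp (-(a * t)) * signedPow p (S.ev g₀ t) := by
  refine (integral_pos_iff_support_of_nonneg
    (fun t => (mul_pos (exp_pos _) (hg.signedPow_pos t)).le)
    (hg.integrable_exp_mul_signedPow ha hp)).2 ?_
  have : Function.support (fun t => exp (-(a * t)) * signedPow p (S.ev g₀ t)) = Set.univ :=
    Set.eq_univ_of_forall fun t => (mul_pos (exp_pos _) (hg.signedPow_pos t)).ne'
  rw [this]
  simp

lemma coeff_V (a : ℝ) (g : H) (τ : ℝ) :
    ∫ t, exp (-(a * t)) * signedPow p (S.ev (S.V τ g) t) =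
      exp (-(a * τ)) * ∫ t, exp (-(a * t)) * signedPow p (S.ev g t) := by
  rw [← integral_add_right_eq_self _ τ, ← integral_const_mul]
  congr 1; ext t
  rw [S.ev_V, add_sub_cancel_right, mul_add, neg_add, exp_add]
  ring

/-- Critical vectors are translates of the ground state, up to sign. -/
lemma exists_eq_V [CompleteSpace H] (hg : S.IsGround a p l g₀ φ') (hS : S.IsGreen a b c)
    (hp : 2 < p) (hpb : b < (p - 1) * a) {g : H} (hcr : S.Crit p l g) (hne : g ≠ 0) :
    ∃ τ, g = S.V τ g₀ ∨ g = -S.V τ g₀ := by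
  have hA₀ := hg.coeff_pos hS.a_pos hp
  have key : ∀ g, S.Crit p l g → 0 < ∫ t, exp (-(a * t)) * signedPow p (S.ev g t) →
      ∃ τ, g = S.V τ g₀ := by
    intro g hcr hA
    refine ⟨-(log ((∫ t, exp (-(a * t)) * signedPow p (S.ev g t)) /
      ∫ t, exp (-(a * t)) * signedPow p (S.ev g₀ t)) / a), ?_⟩
    refine hcr.eq_of_coeff_eq hS hp hpb hg.l_pos.le (hg.crit.V _) ?_
    rw [coeff_V, mul_neg, neg_neg, mul_div_cancel₀ _ hS.a_pos.ne', exp_log (by positivity),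
      div_mul_cancel₀ _ hA₀.ne']
  rcases lt_trichotomy 0 (∫ t, exp (-(a * t)) * signedPow p (S.ev g t)) with hA | hA | hA
  · exact (key g hcr hA).imp fun _ h => Or.inl h
  · refine absurd (hcr.eq_of_coeff_eq hS hp hpb hg.l_pos.le crit_zero ?_) hne
    have h1 : ∀ t, S.ev (0 : H) t = 0 := fun t => inner_zero_right _
    simp only [h1, signedPow, mul_zero, integral_zero]
    exact hA.symm
  · obtain ⟨τ, h⟩ := key (-g) hcr.neg (by
      have h1 : ∀ t, S.ev (-g) t = -S.ev g t := fun t => inner_neg_right _ _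
      simp only [h1, signedPow_neg, mul_neg, integral_neg]
      linarith)
    exact ⟨τ, Or.inr (by rw [← h, neg_neg])⟩

/-- Maximizers are, up to a positive factor, critical. -/
lemma exists_crit_smul (hl : 0 < l) (hp : 2 < p) {g : H} (hg1 : ‖g‖ = 1)
    (hgF : S.F p g = S.kap p) : ∃ μ > 0, μ ^ (p - 2) * (l * S.kap p) = 1 ∧
      S.Crit p l (μ • g) := by
  have hκ := S.kap_pos hp
  have hp2 : 0 < p - 2 := by linarith
  set μ := ((l * S.kap p)⁻¹) ^ (p - 2)⁻¹ with hμ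
  have hμ0 : 0 < μ := by positivity
  have h1 : μ ^ (p - 2) * (l * S.kap p) = 1 := by
    rw [hμ, Real.rpow_inv_rpow (by positivity) hp2.ne', inv_mul_cancel₀ (by positivity)]
  refine ⟨μ, hμ0, h1, crit_iff.2 fun k => ?_⟩
  have h2 : μ ^ (p - 1) = μ ^ (p - 2) * μ := by
    rw [← Real.rpow_add_one hμ0.ne']; ring_nf
  simp only [S.ev_smul, signedPow_mul hμ0, mul_assoc]
  rw [integral_const_mul, S.euler_lagrange hp hg1 hgF, real_inner_smul_left, h2]
  linear_combination (-μ * inner ℝ g k) * h1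

lemma exists_maximizer [CompleteSpace H] [TopologicalSpace.SeparableSpace H] (hp : 2 < p) :
    ∃ w : H, ‖w‖ = 1 ∧ S.F p w = S.kap p := by
  obtain ⟨g, hg, hF⟩ := S.exists_seq_kap p
  obtain ⟨w, -, -, -, hw, hFw, -⟩ := S.exists_subseq_tendsto hp g hg (hF (S.bddAbove_F hp))
  exact ⟨w, hw, hFw⟩

/-- Every maximizer is a multiple of a translate of the ground state. -/
lemma maximizer_eq [CompleteSpace H] (hg : S.IsGround a p l g₀ φ') (hS : S.IsGreen a b c)
    (hp : 2 < p) (hpb : b < (p - 1) * a) {g : H} (hg1 : ‖g‖ = 1) (hgF : S.F p g = S.kap p) :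
    ‖g₀‖ ^ (p - 2) * (l * S.kap p) = 1 ∧
      ∃ s τ : ℝ, |s| = 1 ∧ g = s • S.V τ (‖g₀‖⁻¹ • g₀) := by
  obtain ⟨μ, hμ, h1, hcr⟩ := exists_crit_smul hg.l_pos hp hg1 hgF
  have hne : μ • g ≠ 0 := smul_ne_zero hμ.ne' (norm_ne_zero_iff.1 (by rw [hg1]; norm_num))
  have hnorm : ‖μ • g‖ = μ := by rw [norm_smul, hg1, Real.norm_eq_abs, abs_of_pos hμ, mul_one]
  obtain ⟨τ, h | h⟩ := hg.exists_eq_V hS hp hpb hcr hne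
  · have h2 : ‖g₀‖ = μ := by rw [← hnorm, h, LinearIsometryEquiv.norm_map]
    refine ⟨by rwa [h2], 1, τ, abs_one, ?_⟩
    rw [map_smul, ← h, h2, smul_smul, smul_smul, one_mul, inv_mul_cancel₀ hμ.ne', one_smul]
  · have h2 : ‖g₀‖ = μ := by rw [← hnorm, h, norm_neg, LinearIsometryEquiv.norm_map]
    refine ⟨by rwa [h2], -1, τ, by simp, ?_⟩
    rw [map_smul, neg_smul, one_smul, ← smul_neg, ← h, h2, smul_smul, inv_mul_cancel₀ hμ.ne',
      one_smul]

lemma norm_rpow_mul_kap [CompleteSpace H] [TopologicalSpace.SeparableSpace H]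
    (hg : S.IsGround a p l g₀ φ') (hS : S.IsGreen a b c)
    (hp : 2 < p) (hpb : b < (p - 1) * a) : ‖g₀‖ ^ (p - 2) * (l * S.kap p) = 1 := by
  obtain ⟨w, hw, hFw⟩ := exists_maximizer (S := S) hp
  exact (hg.maximizer_eq hS hp hpb hw hFw).1

lemma F_normalized [CompleteSpace H] [TopologicalSpace.SeparableSpace H]
    (hg : S.IsGround a p l g₀ φ') (hS : S.IsGreen a b c)
    (hp : 2 < p) (hpb : b < (p - 1) * a) : S.F p (‖g₀‖⁻¹ • g₀) = S.kap p := by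
  obtain ⟨w, hw, hFw⟩ := exists_maximizer (S := S) hp
  obtain ⟨-, s, τ, hs, h⟩ := hg.maximizer_eq hS hp hpb hw hFw
  rw [← hFw, h, S.F_smul p s, S.F_V, hs, Real.one_rpow, one_mul]

lemma hasDerivAt_signedPow_ev (hg : S.IsGround a p l g₀ φ') (hp : 2 < p) (t : ℝ) :
    HasDerivAt (fun t => signedPow p (S.ev g₀ t)) ((p - 1) * |S.ev g₀ t| ^ (p - 2) * φ' t) t :=
  (hasDerivAt_signedPow hp _).comp t (hg.hasDerivAt t)

lemma abs_deriv_signedPow_le (hg : S.IsGround a p l g₀ φ') (hp : 2 < p) (t : ℝ) :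
    |(p - 1) * |S.ev g₀ t| ^ (p - 2) * φ' t| ≤ (p - 1) * a * signedPow p (S.ev g₀ t) := by
  have hp1 : 0 < p - 1 := by linarith
  rw [abs_mul, abs_of_nonneg (show 0 ≤ (p - 1) * |S.ev g₀ t| ^ (p - 2) by positivity)]
  refine (mul_le_mul_of_nonneg_left (hg.abs_deriv_le t) (by positivity)).trans_eq ?_
  rw [signedPow]; ring

/-- The infinitesimal translation of the ground state. -/
def tangent (p l : ℝ) (g₀ : H) (φ' : ℝ → ℝ) : H :=
  l • ∫ t, (-((p - 1) * |S.ev g₀ t| ^ (p - 2) * φ' t)) • S.K t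

lemma hasDerivAt_V [CompleteSpace H] (hg : S.IsGround a p l g₀ φ') (ha : 0 < a) (hp : 2 < p) :
    Integrable (fun t => (-((p - 1) * |S.ev g₀ t| ^ (p - 2) * φ' t)) • S.K t) ∧
    HasDerivAt (fun τ => S.V τ g₀) (tangent (S := S) p l g₀ φ') 0 := by
  have hp1 : 0 < p - 1 := by linarith
  have hcont : Continuous fun t => signedPow p (S.ev g₀ t) :=
    (continuous_signedPow hp.le).comp (S.continuous_ev g₀)
  have hcont' : Continuous fun t => (p - 1) * |S.ev g₀ t| ^ (p - 2) * φ' t :=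
    ((S.continuous_rpow_ev (by linarith) g₀).const_mul _).mul hg.continuous_deriv
  have hKi : ∀ τ, Integrable fun t => signedPow p (S.ev g₀ (t - τ)) • S.K t := by
    intro τ
    refine (((hg.integrable_rpow ha hp1).comp_sub_right τ).mul_const ‖S.K 0‖).mono'
      ((hcont.comp (continuous_sub_right τ)).smul S.continuous_K).aestronglyMeasurable
      (.of_forall fun t => ?_)
    rw [norm_smul, S.norm_K, Real.norm_eq_abs, abs_of_pos (hg.signedPow_pos _), hg.signedPow_eq]
  have hV : ∀ τ, S.V τ g₀ = l • ∫ t, signedPow p (S.ev g₀ (t - τ)) • S.K t := by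
    intro τ
    refine ext_inner_left ℝ fun k => ?_
    rw [real_inner_smul_right, ← integral_inner (hKi τ), real_inner_comm, (hg.crit.V τ).inner_eq]
    congr 2; ext t
    rw [real_inner_smul_right, S.ev_V, real_inner_comm]
    rfl
  have main := hasDerivAt_integral_of_dominated_loc_of_deriv_le (μ := volume) (𝕜 := ℝ)
    (F := fun τ t => signedPow p (S.ev g₀ (t - τ)) • S.K t)
    (F' := fun τ t => (-((p - 1) * |S.ev g₀ (t - τ)| ^ (p - 2) * φ' (t - τ))) • S.K t)
    (x₀ := 0) (bound := fun t => (p - 1) * a * (exp ((p - 1) * a) *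
      exp (-((p - 1) * a * |t|))) * ‖S.K 0‖)
    (Metric.ball_mem_nhds (0 : ℝ) one_pos)
    (.of_forall fun τ => (hKi τ).aestronglyMeasurable) (hKi 0) ?_ ?_ ?_ ?_
  · simp only [sub_zero] at main
    refine ⟨main.1, ?_⟩
    simp only [hV]
    exact main.2.const_smul l
  · simp only [sub_zero]
    exact (hcont'.neg.smul S.continuous_K).aestronglyMeasurable
  · refine .of_forall fun t τ hτ => ?_
    rw [norm_smul, norm_neg, Real.norm_eq_abs, S.norm_K]
    refine mul_le_mul_of_nonneg_right ((hg.abs_deriv_signedPow_le hp _).trans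
      (mul_le_mul_of_nonneg_left ?_ (by positivity))) (norm_nonneg _)
    rw [hg.signedPow_eq]
    refine (hg.rpow_le hp1.le _).trans ?_
    rw [← exp_add]
    refine exp_le_exp.2 ?_
    rw [Metric.mem_ball, dist_zero_right, Real.norm_eq_abs] at hτ
    have h1 : |t| ≤ |t - τ| + 1 := by
      have := abs_add_le (t - τ) τ
      rw [sub_add_cancel] at this
      linarith
    have := mul_le_mul_of_nonneg_left h1 (show 0 ≤ (p - 1) * a by positivity)
    linarith
  · exact (((integrable_exp_neg_mul_abs (mul_pos hp1 ha)).const_mul _).const_mul _).mul_const _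
  · refine .of_forall fun t τ _ => ?_
    have h1 := (hg.hasDerivAt_signedPow_ev hp (t - τ)).comp τ ((hasDerivAt_id τ).const_sub t)
    have h2 := h1.smul_const (S.K t)
    rw [mul_neg_one] at h2
    exact h2

lemma ev_tangent [CompleteSpace H] (hg : S.IsGround a p l g₀ φ') (ha : 0 < a) (hp : 2 < p)
    (t : ℝ) : S.ev (tangent (S := S) p l g₀ φ') t = -φ' t := by
  have h1 : HasDerivAt (fun τ => S.ev (S.V τ g₀) t) (S.ev (tangent (S := S) p l g₀ φ') t) 0 := by
    have := (hasDerivAt_const (0 : ℝ) (S.K t)).inner ℝ (hg.hasDerivAt_V ha hp).2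
    simpa [ev] using this
  have h2 : HasDerivAt (fun τ => S.ev (S.V τ g₀) t) (-φ' t) 0 := by
    simp only [S.ev_V]
    have h3 : HasDerivAt (S.ev g₀) (φ' t) (t - 0) := by rw [sub_zero]; exact hg.hasDerivAt t
    have := h3.comp (0 : ℝ) ((hasDerivAt_id (0 : ℝ)).const_sub t)
    rw [mul_neg_one] at this
    exact this
  exact h1.unique h2

lemma weak_tangent [CompleteSpace H] (hg : S.IsGround a p l g₀ φ') (ha : 0 < a) (hp : 2 < p) :
    S.Weak ((p - 1) * l) (fun t => |S.ev g₀ t| ^ (p - 2)) (tangent (S := S) p l g₀ φ') := by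
  intro k
  rw [tangent, real_inner_smul_left, real_inner_comm, ← integral_inner (hg.hasDerivAt_V ha hp).1,
    mul_comm (p - 1) l, mul_assoc, ← integral_const_mul (p - 1)]
  congr 2; ext t
  have := hg.ev_tangent ha hp t
  rw [tangent] at this
  rw [this, real_inner_smul_right, real_inner_comm]
  simp only [ev]
  ring

lemma coeff_tangent_ne_zero [CompleteSpace H] (hg : S.IsGround a p l g₀ φ') (ha : 0 < a)
    (hp : 2 < p) : ∫ t, exp (-(a * t)) *
      (|S.ev g₀ t| ^ (p - 2) * S.ev (tangent (S := S) p l g₀ φ') t) ≠ 0 := by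
  have hp1 : 0 < p - 1 := by linarith
  have hi := hg.integrable_exp_mul_signedPow ha hp
  have hi' : Integrable fun t => exp (-(a * t)) * ((p - 1) * |S.ev g₀ t| ^ (p - 2) * φ' t) := by
    refine (hi.const_mul ((p - 1) * a)).mono' (Continuous.aestronglyMeasurable ?_)
      (.of_forall fun t => ?_)
    · exact (by fun_prop : Continuous fun t : ℝ => exp (-(a * t))).mul
        (((S.continuous_rpow_ev (by linarith) g₀).const_mul _).mul hg.continuous_deriv)
    · rw [norm_mul, Real.norm_eq_abs, abs_of_pos (exp_pos _), Real.norm_eq_abs, mul_left_comm]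
      exact mul_le_mul_of_nonneg_left (hg.abs_deriv_signedPow_le hp t) (exp_pos _).le
  have hd : ∀ t, HasDerivAt (fun t => exp (-(a * t)) * signedPow p (S.ev g₀ t))
      (exp (-(a * t)) * ((p - 1) * |S.ev g₀ t| ^ (p - 2) * φ' t) -
        a * (exp (-(a * t)) * signedPow p (S.ev g₀ t))) t := fun t => by
    have h1 : HasDerivAt (fun t => exp (-(a * t))) (exp (-(a * t)) * -(a * 1)) t :=
      ((hasDerivAt_id t).const_mul a).fun_neg.exp
    refine (h1.mul (hg.hasDerivAt_signedPow_ev hp t)).congr_deriv ?_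
    ring
  have h0 := integral_eq_zero_of_hasDerivAt_of_integrable hd (hi'.sub (hi.const_mul a)) hi
  rw [integral_sub hi' (hi.const_mul a), integral_const_mul] at h0
  have hA := hg.coeff_pos ha hp
  intro h
  have h2 : ∫ t, exp (-(a * t)) * ((p - 1) * |S.ev g₀ t| ^ (p - 2) * φ' t) = 0 := by
    rw [← mul_zero (-(p - 1)), ← h, ← integral_const_mul]
    congr 1; ext t
    rw [hg.ev_tangent ha hp]; ring
  rw [h2] at h0
  have := mul_pos ha hA
  linarith

/-- Nondegeneracy of the ground state. -/
lemma eq_smul_tangent [CompleteSpace H] (hg : S.IsGround a p l g₀ φ') (hS : S.IsGreen a b c)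
    (hp : 2 < p) (hpb : b < (p - 1) * a) {h : H}
    (hh : S.Weak ((p - 1) * l) (fun t => |S.ev g₀ t| ^ (p - 2)) h) :
    ∃ θ : ℝ, h = θ • tangent (S := S) p l g₀ φ' := by
  have hL : 0 ≤ (p - 1) * l := mul_nonneg (by linarith) hg.l_pos.le
  set η := tangent (S := S) p l g₀ φ' with hη
  have hw := hg.weak_tangent hS.a_pos hp
  rw [← hη] at hw
  have hne := hg.coeff_tangent_ne_zero hS.a_pos hp
  rw [← hη] at hne
  set A := ∫ t, exp (-(a * t)) * (|S.ev g₀ t| ^ (p - 2) * S.ev η t)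
  set B := ∫ t, exp (-(a * t)) * (|S.ev g₀ t| ^ (p - 2) * S.ev h t) with hB
  refine ⟨B / A, sub_eq_zero.1 ?_⟩
  refine Weak.eq_zero hS hp hpb hL hg.l_pos.le hg.crit (h := h - (B / A) • η) (fun k => ?_) ?_
  · rw [inner_sub_left, real_inner_smul_left, hh k, hw k, mul_left_comm, ← mul_sub,
      ← integral_const_mul, ← integral_sub (S.integrable_rpow_mul hp g₀ h k)
      ((S.integrable_rpow_mul hp g₀ η k).const_mul _)]
    congr 2; ext t
    rw [S.ev_sub, S.ev_smul]; ring
  · have h1 := hh.integrable_coeff hS hp hpb hL hg.l_pos.le hg.crit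
    have h2 := hw.integrable_coeff hS hp hpb hL hg.l_pos.le hg.crit
    have h3 := integral_sub h1 (h2.const_mul (B / A))
    rw [integral_const_mul, ← hB, div_mul_cancel₀ _ hne, sub_self] at h3
    rw [← h3]
    congr 1; ext t
    rw [S.ev_sub, S.ev_smul]; ring

/-- Stability for systems with a ground state. -/
theorem exists_stability [CompleteSpace H] [TopologicalSpace.SeparableSpace H]
    (hg : S.IsGround a p l g₀ φ') (hS : S.IsGreen a b c) (hp : 2 < p) (hpb : b < (p - 1) * a) :
    ∃ B > 0, ∀ g : H, B * S.orbitDist (‖g₀‖⁻¹ • g₀) g ≤ S.deficit p g := by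
  have hn : 0 < ‖g₀‖ := norm_pos_iff.2 hg.ne_zero
  have hp2 : 0 < p - 2 := by linarith
  have hV := (hg.hasDerivAt_V hS.a_pos hp).2
  refine S.exists_stability hp (w := ‖g₀‖⁻¹ • g₀)
    (η := ‖g₀‖⁻¹ • tangent (S := S) p l g₀ φ') ?_ (hg.F_normalized hS hp hpb) ?_ ?_ ?_ ?_
  · rw [norm_smul, norm_inv, norm_norm, inv_mul_cancel₀ hn.ne']
  · simp only [S.ev_smul, abs_mul, abs_inv, abs_norm]
    refine ((hg.integrable_rpow hS.a_pos hp2).const_mul (‖g₀‖⁻¹ ^ (p - 2))).congr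
      (.of_forall fun t => ?_)
    simp only
    rw [Real.mul_rpow (by positivity) (abs_nonneg _)]
  · simp only [map_smul]
    exact hV.const_smul _
  · intro h hh
    obtain ⟨θ, hθ⟩ := hg.eq_smul_tangent hS hp hpb (h := h) fun k => by
      have h1 := hh k
      have h2 : S.Q p (‖g₀‖⁻¹ • g₀) h k = (‖g₀‖ ^ (p - 2))⁻¹ * S.Q p g₀ h k := by
        rw [Q, Q, ← integral_const_mul, ← Real.inv_rpow hn.le]
        congr 1; ext t
        rw [S.ev_smul, abs_mul, abs_of_pos (inv_pos.2 hn),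
          Real.mul_rpow (by positivity) (abs_nonneg _)]
        ring
      have h3 := hg.norm_rpow_mul_kap hS hp hpb
      have h4 : ‖g₀‖ ^ (p - 2) ≠ 0 := (Real.rpow_pos_of_pos hn _).ne'
      rw [h2] at h1
      change inner ℝ h k = (p - 1) * l * S.Q p g₀ h k
      have h5 : (p - 1) * S.Q p g₀ h k = ‖g₀‖ ^ (p - 2) * (S.kap p * inner ℝ h k) := by
        rw [← h1]; field_simp
      linear_combination (-l) * h5 - inner ℝ h k * h3
    exact ⟨θ * ‖g₀‖, by rw [smul_smul, mul_assoc, mul_inv_cancel₀ hn.ne', mul_one, hθ]⟩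
  · intro g hg1 hgF
    obtain ⟨-, s, τ, -, h⟩ := hg.maximizer_eq hS hp hpb hg1 hgF
    exact ⟨s, τ, h⟩

end IsGround

end KernelSystem

/-- The Hilbert space of square integrable functions on the line. -/
abbrev L2 : Type := Lp ℝ 2 (volume : Measure ℝ)

lemma L2.inner_eq (g h : L2) : inner ℝ g h = ∫ t, g t * h t := by
  rw [L2.inner_def]
  congr 1; ext t
  rw [real_inner_eq_re_inner]
  simp [mul_comm]

lemma L2.norm_sq (h : L2) : ‖h‖ ^ 2 = ∫ t, h t ^ 2 := by
  rw [← real_inner_self_eq_norm_sq, L2.inner_eq]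
  simp only [sq]

lemma L2.inner_toLp {f g : ℝ → ℝ} (hf : MemLp f 2) (hg : MemLp g 2) :
    inner ℝ (hf.toLp f) (hg.toLp g) = ∫ t, f t * g t := by
  rw [L2.inner_eq]
  refine integral_congr_ae ?_
  filter_upwards [hf.coeFn_toLp, hg.coeFn_toLp] with t h1 h2
  rw [h1, h2]

/-- Translations of `L²`. -/
def translation (τ : ℝ) : L2 ≃ₗᵢ[ℝ] L2 where
  toFun h := DomAddAct.mk (-τ) +ᵥ h
  invFun h := DomAddAct.mk τ +ᵥ h
  map_add' f g := DomAddAct.vadd_Lp_add _ f g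
  map_smul' c f := by
    rcases f with ⟨⟨_⟩, _⟩; rfl
  left_inv h := by
    simp only [vadd_vadd, ← DomAddAct.mk_add, neg_add_cancel, DomAddAct.mk_zero, zero_vadd]
  right_inv h := by
    simp only [vadd_vadd, ← DomAddAct.mk_add, add_neg_cancel, DomAddAct.mk_zero, zero_vadd]
  norm_map' h := DomAddAct.norm_vadd_Lp _ h

lemma translation_add (s t : ℝ) (h : L2) :
    translation (s + t) h = translation s (translation t h) := by
  change DomAddAct.mk (-(s + t)) +ᵥ h = DomAddAct.mk (-s) +ᵥ (DomAddAct.mk (-t) +ᵥ h)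
  rw [vadd_vadd, ← DomAddAct.mk_add]
  congr 2; ring

lemma translation_toLp {f : ℝ → ℝ} (hf : MemLp f 2) {g : ℝ → ℝ} (hg : MemLp g 2) {τ : ℝ}
    (h : ∀ t, g t = f (t - τ)) : translation τ (hf.toLp f) = hg.toLp g := by
  change DomAddAct.mk (-τ) +ᵥ hf.toLp f = _
  rw [DomAddAct.mk_vadd_toLp]
  congr 1; ext t
  rw [h, vadd_eq_add]; ring_nf

/-- The fundamental solution of `-(D + b)(D - a)`. -/
def kern (a b x : ℝ) : ℝ := (if 0 ≤ x then exp (-(b * x)) else exp (a * x)) / (a + b)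

section kern

variable {a b : ℝ}

lemma kern_of_nonneg {x : ℝ} (hx : 0 ≤ x) : kern a b x = exp (-(b * x)) / (a + b) := by
  rw [kern, if_pos hx]

lemma kern_of_neg {x : ℝ} (hx : x < 0) : kern a b x = exp (a * x) / (a + b) := by
  rw [kern, if_neg hx.not_ge]

lemma measurable_kern (a b : ℝ) : Measurable (kern a b) := by
  unfold kern
  exact (Measurable.ite measurableSet_Ici (by fun_prop) (by fun_prop)).div_const _

lemma kern_pos (ha : 0 < a) (hb : 0 < b) (x : ℝ) : 0 < kern a b x := by
  unfold kern; split_ifs <;> positivity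

lemma kern_le (ha : 0 < a) (hb : 0 < b) (x : ℝ) :
    kern a b x ≤ exp (-(min a b * |x|)) / (a + b) := by
  unfold kern
  refine div_le_div_of_nonneg_right ?_ (by positivity)
  split_ifs with h
  · rw [abs_of_nonneg h, exp_le_exp]
    have := mul_le_mul_of_nonneg_right (min_le_right a b) h
    linarith
  · rw [abs_of_neg (not_le.1 h), exp_le_exp]
    have := mul_le_mul_of_nonneg_right (min_le_left a b) (neg_nonneg.2 (not_le.1 h).le)
    linarith

lemma kern_le_inv (ha : 0 < a) (hb : 0 < b) (x : ℝ) : kern a b x ≤ 1 / (a + b) := by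
  refine (kern_le ha hb x).trans (div_le_div_of_nonneg_right ?_ (by positivity))
  rw [exp_le_one_iff, neg_nonpos]
  positivity

lemma integrable_kern (ha : 0 < a) (hb : 0 < b) : Integrable (kern a b) := by
  refine ((integrable_exp_neg_mul_abs (lt_min ha hb)).div_const (a + b)).mono'
    (measurable_kern a b).aestronglyMeasurable (.of_forall fun x => ?_)
  rw [Real.norm_eq_abs, abs_of_pos (kern_pos ha hb x)]
  exact kern_le ha hb x

lemma memLp_kern (ha : 0 < a) (hb : 0 < b) (t : ℝ) : MemLp (fun τ => kern a b (t - τ)) 2 := by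
  have hm : AEStronglyMeasurable fun τ => kern a b (t - τ) :=
    ((measurable_kern a b).comp (measurable_const.sub measurable_id)).aestronglyMeasurable
  rw [memLp_two_iff_integrable_sq hm]
  refine (((integrable_kern ha hb).comp_sub_left t).const_mul (1 / (a + b))).mono' (hm.pow 2)
    (.of_forall fun τ => ?_)
  rw [Real.norm_eq_abs, abs_of_nonneg (sq_nonneg _), sq]
  exact mul_le_mul_of_nonneg_right (kern_le_inv ha hb _) (kern_pos ha hb _).le

lemma integrable_kern_mul (ha : 0 < a) (hb : 0 < b) (t : ℝ) {h : ℝ → ℝ} (hh : MemLp h 2) :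
    Integrable fun τ => kern a b (t - τ) * h τ :=
  (memLp_kern ha hb t).integrable_mul hh

lemma integrable_kern_mul_of_integrable (ha : 0 < a) (hb : 0 < b) (t : ℝ) {h : ℝ → ℝ}
    (hh : Integrable h) : Integrable fun τ => kern a b (t - τ) * h τ := by
  refine hh.bdd_mul (c := 1 / (a + b)) (memLp_kern ha hb t).1 (.of_forall fun τ => ?_)
  rw [Real.norm_eq_abs, abs_of_pos (kern_pos ha hb _)]
  exact kern_le_inv ha hb _

/-- Schur's test for the convolution with `kern`. -/
lemma integral_kern_mul_sq_le (ha : 0 < a) (hb : 0 < b) {h : ℝ → ℝ} (hh : MemLp h 2)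
    (hm : AEStronglyMeasurable fun t => ∫ τ, kern a b (t - τ) * h τ) :
    Integrable (fun t => (∫ τ, kern a b (t - τ) * h τ) ^ 2) ∧
    ∫ t, (∫ τ, kern a b (t - τ) * h τ) ^ 2 ≤ (∫ x, kern a b x) ^ 2 * ∫ t, h t ^ 2 := by
  set k := ∫ x, kern a b x with hk
  have hk0 : 0 < k := by
    refine (integral_pos_iff_support_of_nonneg (fun x => (kern_pos ha hb x).le)
      (integrable_kern ha hb)).2 ?_
    have : Function.support (kern a b) = Set.univ :=
      Set.eq_univ_of_forall fun x => (kern_pos ha hb x).ne'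
    rw [this]; simp
  have hh2 := hh.integrable_sq
  have hc := hh2.integrable_convolution (ContinuousLinearMap.mul ℝ ℝ) (integrable_kern ha hb)
  have hci := integral_convolution (μ := volume) (ContinuousLinearMap.mul ℝ ℝ) hh2
    (integrable_kern ha hb)
  change Integrable fun t => ∫ τ, h τ ^ 2 * kern a b (t - τ) at hc
  change ∫ t, ∫ τ, h τ ^ 2 * kern a b (t - τ) = _ at hci
  rw [ContinuousLinearMap.mul_apply'] at hci
  have hpt : ∀ t, (∫ τ, kern a b (t - τ) * h τ) ^ 2 ≤ k * ∫ τ, h τ ^ 2 * kern a b (t - τ) := by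
    intro t
    set v := ∫ τ, kern a b (t - τ) * h τ with hv
    set x := ∫ τ, h τ ^ 2 * kern a b (t - τ) with hx
    have h1 : ∫ τ, 2 * (v / k) * (kern a b (t - τ) * h τ) ≤
        ∫ τ, (h τ ^ 2 * kern a b (t - τ) + (v / k) ^ 2 * kern a b (t - τ)) := by
      refine integral_mono ((integrable_kern_mul ha hb t hh).const_mul _)
        (Integrable.add ?_ (((integrable_kern ha hb).comp_sub_left t).const_mul _)) fun τ => ?_
      · simpa only [mul_comm] using integrable_kern_mul_of_integrable ha hb t hh2
      · simp only
        nlinarith [mul_nonneg (kern_pos ha hb (t - τ)).le (sq_nonneg (h τ - v / k))]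
    rw [integral_const_mul, integral_add (by
      simpa only [mul_comm] using integrable_kern_mul_of_integrable ha hb t hh2)
      (((integrable_kern ha hb).comp_sub_left t).const_mul _), integral_const_mul,
      integral_sub_left_eq_self (kern a b) volume t, ← hk, ← hv, ← hx] at h1
    have h2 : 2 * (v / k) * v = 2 * (v ^ 2 / k) := by ring
    have h3 : (v / k) ^ 2 * k = v ^ 2 / k := by field_simp
    have h4 : v ^ 2 / k ≤ x := by linarith
    rwa [div_le_iff₀ hk0, mul_comm] at h4
  have hi : Integrable fun t => (∫ τ, kern a b (t - τ) * h τ) ^ 2 :=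
    (hc.const_mul k).mono' (hm.pow 2) (.of_forall fun t => by
      rw [Real.norm_eq_abs, abs_of_nonneg (sq_nonneg _)]; exact hpt t)
  refine ⟨hi, (integral_mono hi (hc.const_mul k) hpt).trans_eq ?_⟩
  rw [integral_const_mul, hci, ← hk]; ring

lemma integral_exp_mul_interval {r : ℝ} (hr : r ≠ 0) (u v : ℝ) :
    ∫ x in u..v, exp (r * x) = exp (r * v) / r - exp (r * u) / r := by
  rw [intervalIntegral.integral_comp_mul_left _ hr, integral_exp, smul_eq_mul]
  field_simp

lemma integral_kern_mul_kern_add (ha : 0 < a) (hab : a < b) {d : ℝ} (hd : 0 ≤ d) :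
    ∫ x, kern a b x * kern a b (x + d) = green a b (1 / (2 * (b ^ 2 - a ^ 2))) d := by
  have hb : 0 < b := ha.trans hab
  have hi : Integrable fun x => kern a b x * kern a b (x + d) := by
    have hm : MemLp (kern a b) 2 := by
      rw [memLp_two_iff_integrable_sq (measurable_kern a b).aestronglyMeasurable]
      have := (memLp_kern ha hb 0).integrable_sq.comp_sub_left 0
      simpa using this
    exact hm.integrable_mul (hm.comp_measurePreserving (measurePreserving_add_right volume d))
  have h1 : ∫ x in Set.Iic (-d), kern a b x * kern a b (x + d) =
      exp (-(a * d)) / (2 * a) / (a + b) ^ 2 := by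
    have : ∀ x ∈ Set.Iio (-d), kern a b x * kern a b (x + d) =
        exp (a * d) / (a + b) ^ 2 * exp (2 * a * x) := fun x hx => by
      have hx : x < -d := hx
      rw [kern_of_neg (by linarith), kern_of_neg (by linarith), div_mul_div_comm, ← exp_add,
        div_mul_eq_mul_div, ← exp_add, sq]
      ring_nf
    rw [integral_Iic_eq_integral_Iio, setIntegral_congr_fun measurableSet_Iio this,
      integral_const_mul, ← integral_Iic_eq_integral_Iio, integral_exp_mul_Iic (by positivity)]
    rw [show exp (-(a * d)) = exp (a * d) * exp (2 * a * -d) by rw [← exp_add]; ring_nf]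
    ring
  have h2 : ∫ x in Set.Ioi 0, kern a b x * kern a b (x + d) =
      exp (-(b * d)) / (2 * b) / (a + b) ^ 2 := by
    have : ∀ x ∈ Set.Ioi 0, kern a b x * kern a b (x + d) =
        exp (-(b * d)) / (a + b) ^ 2 * exp (-(2 * b) * x) := fun x hx => by
      have hx : 0 < x := hx
      rw [kern_of_nonneg (by linarith), kern_of_nonneg (by linarith), div_mul_div_comm,
        ← exp_add, div_mul_eq_mul_div, ← exp_add, sq]
      ring_nf
    rw [setIntegral_congr_fun measurableSet_Ioi this,
      integral_const_mul, integral_exp_mul_Ioi (by linarith), mul_zero, exp_zero]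
    field_simp
  have h3 : ∫ x in (-d)..0, kern a b x * kern a b (x + d) =
      (exp (-(a * d)) - exp (-(b * d))) / (b - a) / (a + b) ^ 2 := by
    have : ∀ x ∈ Set.Ioo (-d) 0, kern a b x * kern a b (x + d) =
        exp (-(b * d)) / (a + b) ^ 2 * exp ((a - b) * x) := fun x hx => by
      obtain ⟨hx1, hx2⟩ := hx
      rw [kern_of_neg hx2, kern_of_nonneg (by linarith), div_mul_div_comm,
        ← exp_add, div_mul_eq_mul_div, ← exp_add, sq]
      ring_nf
    rw [intervalIntegral.integral_of_le (by linarith), integral_Ioc_eq_integral_Ioo,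
      setIntegral_congr_fun measurableSet_Ioo this, ← integral_Ioc_eq_integral_Ioo,
      ← intervalIntegral.integral_of_le (by linarith), intervalIntegral.integral_const_mul,
      integral_exp_mul_interval (by linarith), mul_zero, exp_zero]
    have h4 : exp (-(a * d)) = exp (-(b * d)) * exp ((a - b) * -d) := by
      rw [← exp_add]; ring_nf
    have h5 : b - a ≠ 0 := by linarith
    have h6 : a - b = -(b - a) := by ring
    rw [h4, h6]
    field_simp
    ring
  rw [← intervalIntegral.integral_Iic_add_Ioi (b := 0) hi.integrableOn hi.integrableOn, h2]
  have h4 := intervalIntegral.integral_Iic_sub_Iic (a := -d) (b := 0) hi.integrableOn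
    hi.integrableOn
  rw [h3, h1] at h4
  rw [sub_eq_iff_eq_add.1 h4, green, abs_of_nonneg hd]
  have h5 : b - a ≠ 0 := by linarith
  have h6 : b ^ 2 - a ^ 2 = (b - a) * (a + b) := by ring
  rw [h6]
  field_simp
  ring

lemma integral_kern_mul_kern (ha : 0 < a) (hab : a < b) (s t : ℝ) :
    ∫ τ, kern a b (s - τ) * kern a b (t - τ) = green a b (1 / (2 * (b ^ 2 - a ^ 2))) (s - t) := by
  have key : ∀ s t : ℝ, s ≤ t → ∫ τ, kern a b (s - τ) * kern a b (t - τ) =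
      green a b (1 / (2 * (b ^ 2 - a ^ 2))) (s - t) := fun s t hst => by
    rw [← neg_sub t s, green_neg, ← integral_kern_mul_kern_add ha hab (sub_nonneg.2 hst),
      ← integral_sub_left_eq_self _ volume s]
    congr 1; ext τ
    ring_nf
  rcases le_total s t with h | h
  · exact key s t h
  · rw [← neg_sub t s, green_neg, ← key t s h]
    simp only [mul_comm]

/-- The vectors representing the convolution with `kern`. -/
def kernVec (ha : 0 < a) (hb : 0 < b) (t : ℝ) : L2 := (memLp_kern ha hb t).toLp _

lemma inner_kernVec (ha : 0 < a) (hb : 0 < b) (t : ℝ) (h : L2) :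
    inner ℝ (kernVec ha hb t) h = ∫ τ, kern a b (t - τ) * h τ := by
  rw [L2.inner_eq]
  refine integral_congr_ae ?_
  filter_upwards [(memLp_kern ha hb t).coeFn_toLp] with τ h1
  rw [kernVec, h1]

lemma inner_kernVec_kernVec (ha : 0 < a) (hab : a < b) (s t : ℝ) :
    inner ℝ (kernVec ha (ha.trans hab) s) (kernVec ha (ha.trans hab) t) =
      green a b (1 / (2 * (b ^ 2 - a ^ 2))) (s - t) := by
  rw [kernVec, kernVec, L2.inner_toLp, integral_kern_mul_kern ha hab]

lemma green_zero_pos (ha : 0 < a) (hab : a < b) :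
    0 < green a b (1 / (2 * (b ^ 2 - a ^ 2))) 0 := by
  have h1 : 0 < b ^ 2 - a ^ 2 := by nlinarith
  have h2 : 1 / b < 1 / a := one_div_lt_one_div_of_lt ha hab
  rw [green, abs_zero, mul_zero, mul_zero, neg_zero, exp_zero]
  exact mul_pos (by positivity) (sub_pos.2 h2)

lemma continuous_kernVec (ha : 0 < a) (hab : a < b) :
    Continuous (kernVec ha (ha.trans hab)) := by
  refine continuous_iff_continuousAt.2 fun t => ?_
  rw [ContinuousAt, tendsto_iff_norm_sub_tendsto_zero]
  set c := 1 / (2 * (b ^ 2 - a ^ 2))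
  have h1 : ∀ s, ‖kernVec ha (ha.trans hab) s - kernVec ha (ha.trans hab) t‖ =
      √(2 * green a b c 0 - 2 * green a b c (s - t)) := fun s => by
    rw [← Real.sqrt_sq (norm_nonneg _), norm_sub_sq_real, ← real_inner_self_eq_norm_sq,
      ← real_inner_self_eq_norm_sq, inner_kernVec_kernVec ha hab,
      inner_kernVec_kernVec ha hab, inner_kernVec_kernVec ha hab, sub_self, sub_self]
    congr 1; ring
  simp only [h1]
  have h2 : Continuous fun s => √(2 * green a b c 0 - 2 * green a b c (s - t)) :=
    (continuous_const.sub (((continuous_green a b c).comp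
      (continuous_sub_right t)).const_mul 2)).sqrt
  have h3 := h2.tendsto t
  simpa using h3

/-- The convolution with `kern` on `L²`. -/
def convSystem (ha : 0 < a) (hab : a < b) : KernelSystem L2 where
  K := kernVec ha (ha.trans hab)
  V := translation
  C := (∫ x, kern a b x) ^ 2
  C_nonneg := sq_nonneg _
  continuous_K := continuous_kernVec ha hab
  K_ne_zero h := by
    have := inner_kernVec_kernVec ha hab 0 0
    rw [h, inner_zero_left, sub_zero] at this
    exact (green_zero_pos ha hab).ne this
  V_K τ t := translation_toLp _ _ fun s => by ring_nf
  V_add := translation_add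
  integrable_sq h := by
    simp only [inner_kernVec]
    refine (integral_kern_mul_sq_le ha (ha.trans hab) (Lp.memLp h) ?_).1
    simp only [← inner_kernVec ha (ha.trans hab)]
    exact ((continuous_kernVec ha hab).inner continuous_const).aestronglyMeasurable
  integral_sq_le h := by
    simp only [inner_kernVec]
    rw [L2.norm_sq]
    refine (integral_kern_mul_sq_le ha (ha.trans hab) (Lp.memLp h) ?_).2
    simp only [← inner_kernVec ha (ha.trans hab)]
    exact ((continuous_kernVec ha hab).inner continuous_const).aestronglyMeasurable

lemma convSystem_ev (ha : 0 < a) (hab : a < b) (h : L2) (t : ℝ) :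
    (convSystem ha hab).ev h t = ∫ τ, kern a b (t - τ) * h τ := 
  inner_kernVec ha (ha.trans hab) t h

lemma convSystem_ev_toLp (ha : 0 < a) (hab : a < b) {f : ℝ → ℝ} (hf : MemLp f 2) (t : ℝ) :
    (convSystem ha hab).ev (hf.toLp f) t = ∫ τ, kern a b (t - τ) * f τ := by
  rw [convSystem_ev]
  refine integral_congr_ae ?_
  filter_upwards [hf.coeFn_toLp] with τ h1
  rw [h1]

lemma convSystem_isGreen (ha : 0 < a) (hab : a < b) :
    (convSystem ha hab).IsGreen a b (1 / (2 * (b ^ 2 - a ^ 2))) where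
  a_pos := ha
  a_lt_b := hab
  c_pos := by
    have h1 : 0 < b ^ 2 - a ^ 2 := by nlinarith
    positivity
  inner_K := inner_kernVec_kernVec ha hab

/-- The convolution with `kern` inverts `-(D + b)(D - a)`. -/
lemma integral_kern_mul_eq (ha : 0 < a) (hb : 0 < b) {φ φ₁ φ₂ : ℝ → ℝ} {M : ℝ}
    (h1 : ∀ t, HasDerivAt φ (φ₁ t) t) (h2 : ∀ t, HasDerivAt φ₁ (φ₂ t) t)
    (hM : ∀ t, |φ t| ≤ M) (hM1 : ∀ t, |φ₁ t| ≤ M) (t : ℝ)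
    (hi : Integrable fun τ => kern a b (t - τ) * -(φ₂ τ + (b - a) * φ₁ τ - a * b * φ τ)) :
    ∫ τ, kern a b (t - τ) * -(φ₂ τ + (b - a) * φ₁ τ - a * b * φ τ) = φ t := by
  have hab : 0 < a + b := by positivity
  rw [← intervalIntegral.integral_Iic_add_Ioi (b := t) hi.integrableOn hi.integrableOn]
  have hexp : ∀ r τ : ℝ, HasDerivAt (fun τ => exp (r * (t - τ)) / (a + b))
      (-r * (exp (r * (t - τ)) / (a + b))) τ := fun r τ => by
    have := ((((hasDerivAt_id τ).const_sub t).const_mul r).exp).div_const (a + b)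
    refine this.congr_deriv ?_
    simp only [id]; ring
  have key : ∀ u v r : ℝ, ∀ l : Filter ℝ,
      Tendsto (fun τ => exp (r * (t - τ))) l (nhds 0) →
      Tendsto (fun τ => exp (r * (t - τ)) / (a + b) * (φ₁ τ + u * φ τ)) l (nhds 0) := by
    intro u v r l hl
    have hz := (hl.div_const (a + b)).norm
    rw [zero_div, norm_zero] at hz
    have hz2 := hz.mul_const (M + |u| * M)
    rw [zero_mul] at hz2
    refine squeeze_zero_norm (fun τ => ?_) hz2
    rw [norm_mul]
    refine mul_le_mul_of_nonneg_left ?_ (norm_nonneg _)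
    rw [Real.norm_eq_abs]
    refine (abs_add_le _ _).trans (add_le_add (hM1 τ) ?_)
    rw [abs_mul]
    exact mul_le_mul_of_nonneg_left (hM τ) (abs_nonneg _)
  have e1 : ∫ τ in Set.Iic t, kern a b (t - τ) * -(φ₂ τ + (b - a) * φ₁ τ - a * b * φ τ) =
      -(φ₁ t - a * φ t) / (a + b) := by
    have hd : ∀ τ, HasDerivAt (fun τ => -(exp (-b * (t - τ)) / (a + b) * (φ₁ τ + -a * φ τ)))
        (exp (-b * (t - τ)) / (a + b) * -(φ₂ τ + (b - a) * φ₁ τ - a * b * φ τ)) τ := fun τ => by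
      refine ((hexp (-b) τ).mul ((h2 τ).add ((h1 τ).const_mul (-a)))).fun_neg.congr_deriv ?_
      simp only [Pi.add_apply]
      ring
    have hk : ∀ τ ∈ Set.Iic t, kern a b (t - τ) * -(φ₂ τ + (b - a) * φ₁ τ - a * b * φ τ) =
        exp (-b * (t - τ)) / (a + b) * -(φ₂ τ + (b - a) * φ₁ τ - a * b * φ τ) := fun τ hτ => by
      rw [kern_of_nonneg (sub_nonneg.2 hτ), neg_mul]
    rw [setIntegral_congr_fun measurableSet_Iic hk,
      integral_Iic_of_hasDerivAt_of_tendsto' (m := 0) (fun τ _ => hd τ)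
        (hi.integrableOn.congr_fun hk measurableSet_Iic)]
    · simp only [sub_self, mul_zero, exp_zero]; ring
    · rw [← neg_zero]
      refine (key _ 0 _ _ (tendsto_exp_atBot.comp ?_)).neg
      simp only [neg_mul]
      exact tendsto_neg_atTop_atBot.comp (Tendsto.const_mul_atTop hb
        (tendsto_atTop_add_const_left _ t tendsto_neg_atBot_atTop))
  have e2 : ∫ τ in Set.Ioi t, kern a b (t - τ) * -(φ₂ τ + (b - a) * φ₁ τ - a * b * φ τ) =
      (φ₁ t + b * φ t) / (a + b) := by
    have hd : ∀ τ, HasDerivAt (fun τ => -(exp (a * (t - τ)) / (a + b) * (φ₁ τ + b * φ τ)))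
        (exp (a * (t - τ)) / (a + b) * -(φ₂ τ + (b - a) * φ₁ τ - a * b * φ τ)) τ := fun τ => by
      refine ((hexp a τ).mul ((h2 τ).add ((h1 τ).const_mul b))).fun_neg.congr_deriv ?_
      simp only [Pi.add_apply]
      ring
    have hk : ∀ τ ∈ Set.Ioi t, kern a b (t - τ) * -(φ₂ τ + (b - a) * φ₁ τ - a * b * φ τ) =
        exp (a * (t - τ)) / (a + b) * -(φ₂ τ + (b - a) * φ₁ τ - a * b * φ τ) := fun τ hτ => by
      rw [kern_of_neg (sub_neg.2 hτ)]
    rw [setIntegral_congr_fun measurableSet_Ioi hk,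
      integral_Ioi_of_hasDerivAt_of_tendsto' (m := 0) (fun τ _ => hd τ)
        (hi.integrableOn.congr_fun hk measurableSet_Ioi)]
    · simp only [sub_self, mul_zero, exp_zero]; ring
    · rw [← neg_zero]
      refine (key _ 0 _ _ (tendsto_exp_atBot.comp (Tendsto.const_mul_atBot ha ?_))).neg
      exact tendsto_atBot_add_const_left _ t tendsto_neg_atTop_atBot
  rw [e1, e2]
  field_simp
  ring

/-- The adjoint identity for the convolution with `kern`. -/
lemma integral_mul_integral_kern (ha : 0 < a) (hb : 0 < b) {ψ : ℝ → ℝ} {P : ℝ}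
    (hψ : Integrable ψ) (hψP : ∀ t, |ψ t| ≤ P) {h : ℝ → ℝ} (hh : MemLp h 2) :
    ∫ τ, (∫ t, kern a b (t - τ) * ψ t) * h τ = ∫ t, ψ t * ∫ τ, kern a b (t - τ) * h τ := by
  have hrefl : Integrable fun x => kern a b (-x) := by
    simpa using (integrable_kern ha hb).comp_neg
  have i1 := hψ.convolution_integrand (μ := volume) (ContinuousLinearMap.mul ℝ ℝ) hrefl
  have i2 := hh.integrable_sq.convolution_integrand (μ := volume) (ContinuousLinearMap.mul ℝ ℝ)
    (integrable_kern ha hb)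
  simp only [ContinuousLinearMap.mul_apply', neg_sub] at i1 i2
  have hInt : Integrable (fun x : ℝ × ℝ => ψ x.1 * (kern a b (x.1 - x.2) * h x.2))
      (volume.prod volume) := by
    refine (i1.swap.norm.add (i2.const_mul P)).mono' ?_ (.of_forall fun x => ?_)
    · refine hψ.aestronglyMeasurable.comp_fst.mul (AEStronglyMeasurable.mul ?_
        hh.aestronglyMeasurable.comp_snd)
      exact ((measurable_kern a b).comp
        (measurable_fst.sub measurable_snd)).aestronglyMeasurable
    · have hk := (kern_pos ha hb (x.1 - x.2)).le
      have h1 : |h x.2| ≤ 1 + h x.2 ^ 2 := by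
        rw [← sq_abs]; nlinarith [sq_nonneg (|h x.2| - 1)]
      simp only [Function.comp_apply, Prod.fst_swap, Prod.snd_swap, norm_mul, Real.norm_eq_abs,
        abs_of_nonneg hk, Pi.add_apply]
      calc _ ≤ |ψ x.1| * (kern a b (x.1 - x.2) * (1 + h x.2 ^ 2)) := by gcongr
        _ = |ψ x.1| * kern a b (x.1 - x.2) + |ψ x.1| * (h x.2 ^ 2 * kern a b (x.1 - x.2)) := by
            ring
        _ ≤ _ := by gcongr; exact hψP _
  have hsw := integral_integral_swap (f := fun t τ => ψ t * (kern a b (t - τ) * h τ)) hInt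
  simp only [integral_const_mul] at hsw
  rw [hsw]
  congr 1; ext τ
  rw [← integral_mul_const]
  congr 1; ext t; ring

end kern

section Bubble

variable {a b : ℝ}

lemma sigmoid_mul_one_sub_pos (x : ℝ) : 0 < sigmoid x * (1 - sigmoid x) :=
  mul_pos (sigmoid_pos x) (sub_pos.2 (sigmoid_lt_one x))

lemma sigmoid_mul_one_sub_le (x : ℝ) : sigmoid x * (1 - sigmoid x) ≤ exp (-|x|) := by
  have key : ∀ x : ℝ, 0 ≤ x → sigmoid x * (1 - sigmoid x) ≤ exp (-x) := fun x _ => by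
    rw [← sigmoid_neg, ← sigmoid_mul_rexp_neg]
    have h1 := sigmoid_pos x
    have h2 := sigmoid_lt_one x
    have h3 := exp_pos (-x)
    nlinarith [mul_pos h1 h3]
  rcases le_total 0 x with hx | hx
  · rw [abs_of_nonneg hx]; exact key x hx
  · have := key (-x) (by linarith)
    rw [sigmoid_neg] at this
    rw [abs_of_nonpos hx]
    linarith

lemma integral_sigmoid_rpow {k : ℝ} (hk : 0 < k) :
    ∫ x, (sigmoid x * (1 - sigmoid x)) ^ k = Gamma k ^ 2 / Gamma (2 * k) := by
  have h1 := integral_image_eq_integral_abs_deriv_smul (s := Set.univ) MeasurableSet.univ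
    (fun x _ => (hasDerivAt_sigmoid x).hasDerivWithinAt) sigmoid_injective.injOn
    (fun s : ℝ => (s * (1 - s)) ^ (k - 1))
  rw [Set.image_univ, range_sigmoid, setIntegral_univ] at h1
  have h2 : ∀ x, |sigmoid x * (1 - sigmoid x)| • (sigmoid x * (1 - sigmoid x)) ^ (k - 1) =
      (sigmoid x * (1 - sigmoid x)) ^ k := fun x => by
    have := sigmoid_mul_one_sub_pos x
    rw [abs_of_pos this, smul_eq_mul, mul_comm, ← Real.rpow_add_one this.ne', sub_add_cancel]
  simp only [h2] at h1
  rw [← h1]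
  have h3 := ProbabilityTheory.beta_eq_betaIntegralReal k k hk hk
  rw [ProbabilityTheory.beta, ← two_mul, ← sq] at h3
  rw [h3, Complex.betaIntegral, intervalIntegral.integral_of_le zero_le_one,
    integral_Ioc_eq_integral_Ioo]
  have h4 : ∀ x ∈ Set.Ioo (0 : ℝ) 1, (x : ℂ) ^ ((k : ℂ) - 1) * (1 - (x : ℂ)) ^ ((k : ℂ) - 1) =
      (((x * (1 - x)) ^ (k - 1) : ℝ) : ℂ) := fun x hx => by
    have hx1 : 0 ≤ 1 - x := by linarith [hx.2]
    rw [Real.mul_rpow hx.1.le hx1, Complex.ofReal_mul, Complex.ofReal_cpow hx.1.le,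
      Complex.ofReal_cpow hx1]
    push_cast
    rfl
  rw [setIntegral_congr_fun measurableSet_Ioo h4, integral_complex_ofReal, Complex.ofReal_re]

/-- The bubble in logarithmic coordinates. -/
def bubble (a b t : ℝ) : ℝ :=
  (sigmoid ((b - a) * t) * (1 - sigmoid ((b - a) * t))) ^ (a / (b - a))

lemma bubble_pos (a b t : ℝ) : 0 < bubble a b t :=
  Real.rpow_pos_of_pos (sigmoid_mul_one_sub_pos _) _

lemma bubble_le (ha : 0 < a) (hab : a < b) (t : ℝ) : bubble a b t ≤ exp (-(a * |t|)) := by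
  have hd : 0 < b - a := sub_pos.2 hab
  refine (Real.rpow_le_rpow (sigmoid_mul_one_sub_pos _).le (sigmoid_mul_one_sub_le _)
    (by positivity)).trans_eq ?_
  rw [← Real.exp_mul, abs_mul, abs_of_pos hd]
  congr 1; field_simp

lemma bubble_rpow (a b r t : ℝ) : bubble a b t ^ r =
    (sigmoid ((b - a) * t) * (1 - sigmoid ((b - a) * t))) ^ (a / (b - a) * r) :=
  (Real.rpow_mul (sigmoid_mul_one_sub_pos _).le _ _).symm

lemma bubble_rpow_sub_two (ha : 0 < a) (hab : a < b) (t : ℝ) :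
    bubble a b t ^ (2 * b / a - 2) =
      (sigmoid ((b - a) * t) * (1 - sigmoid ((b - a) * t))) ^ 2 := by
  have hd : b - a ≠ 0 := (sub_pos.2 hab).ne'
  rw [bubble_rpow, ← Real.rpow_natCast]
  congr 1
  push_cast
  field_simp

lemma integral_bubble_rpow (ha : 0 < a) (hab : a < b) :
    ∫ t, bubble a b t ^ (2 * b / a) =
      (b - a)⁻¹ * (Gamma (2 * b / (b - a)) ^ 2 / Gamma (2 * (2 * b / (b - a)))) := by
  have hd : 0 < b - a := sub_pos.2 hab
  have hb : 0 < b := ha.trans hab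
  rw [← integral_sigmoid_rpow (by positivity)]
  have h1 := Measure.integral_comp_mul_left
    (fun x => (sigmoid x * (1 - sigmoid x)) ^ (2 * b / (b - a))) (b - a)
  rw [abs_of_pos (inv_pos.2 hd), smul_eq_mul] at h1
  rw [← h1]
  congr 1; ext t
  rw [bubble_rpow]
  congr 1
  field_simp

/-- The bubble times a function of the sigmoid. -/
def bubbleMul (a b : ℝ) (R : ℝ → ℝ) (t : ℝ) : ℝ := bubble a b t * R (sigmoid ((b - a) * t))

lemma hasDerivAt_sigmoid_mul (d t : ℝ) : HasDerivAt (fun t => sigmoid (d * t))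
    (d * (sigmoid (d * t) * (1 - sigmoid (d * t)))) t := by
  refine ((hasDerivAt_sigmoid (d * t)).comp t ((hasDerivAt_id t).const_mul d)).congr_deriv ?_
  ring

lemma hasDerivAt_bubbleMul (hab : a < b) {R R' : ℝ → ℝ} (hR : ∀ s, HasDerivAt R (R' s) s)
    (t : ℝ) : HasDerivAt (bubbleMul a b R)
      (bubbleMul a b (fun s => a * (1 - 2 * s) * R s + (b - a) * (s * (1 - s)) * R' s) t) t := by
  have hd : b - a ≠ 0 := (sub_pos.2 hab).ne'
  have h0 := hasDerivAt_sigmoid_mul (b - a) t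
  have hq := sigmoid_mul_one_sub_pos ((b - a) * t)
  have h1 := (h0.mul (h0.const_sub 1)).rpow_const (p := a / (b - a)) (Or.inl hq.ne')
  refine (h1.mul ((hR _).comp t h0)).congr_deriv ?_
  have h2 := Real.rpow_sub_one hq.ne' (a / (b - a))
  simp only [Pi.mul_apply, bubbleMul, bubble, Function.comp_apply]
  rw [h2]
  have h3 := (sigmoid_pos ((b - a) * t)).ne'
  have h4 := (sub_pos.2 (sigmoid_lt_one ((b - a) * t))).ne'
  generalize sigmoid ((b - a) * t) = s at h3 h4 ⊢
  field_simp
  ring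

lemma abs_bubbleMul_le (ha : 0 < a) (hab : a < b) {R : ℝ → ℝ} {M : ℝ}
    (hM : ∀ s, 0 ≤ s → s ≤ 1 → |R s| ≤ M) (t : ℝ) :
    |bubbleMul a b R t| ≤ M * exp (-(a * |t|)) := by
  rw [bubbleMul, abs_mul, abs_of_pos (bubble_pos a b t), mul_comm]
  have h1 := hM _ (sigmoid_pos ((b - a) * t)).le (sigmoid_lt_one ((b - a) * t)).le
  exact mul_le_mul h1 (bubble_le ha hab t) (bubble_pos a b t).le ((abs_nonneg _).trans h1)

lemma exists_abs_bubbleMul_le (ha : 0 < a) (hab : a < b) {R : ℝ → ℝ} (hR : Continuous R) :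
    ∃ M, ∀ t, |bubbleMul a b R t| ≤ M * exp (-(a * |t|)) := by
  obtain ⟨M, hM⟩ := (isCompact_Icc (a := (0 : ℝ)) (b := 1)).exists_bound_of_continuousOn
    hR.continuousOn
  exact ⟨M, abs_bubbleMul_le ha hab fun s h0 h1 => hM s ⟨h0, h1⟩⟩

lemma continuous_bubble (a b : ℝ) : Continuous (bubble a b) :=
  have h : Continuous fun t => sigmoid ((b - a) * t) :=
    continuous_sigmoid.comp (continuous_const.mul continuous_id)
  (h.mul (continuous_const.sub h)).rpow_const fun _ => Or.inl (sigmoid_mul_one_sub_pos _).ne'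

lemma continuous_bubbleMul (a b : ℝ) {R : ℝ → ℝ} (hR : Continuous R) :
    Continuous (bubbleMul a b R) :=
  (continuous_bubble a b).mul
    (hR.comp (continuous_sigmoid.comp (continuous_const.mul continuous_id)))

lemma integrable_bubbleMul (ha : 0 < a) (hab : a < b) {R : ℝ → ℝ} (hR : Continuous R) :
    Integrable (bubbleMul a b R) := by
  obtain ⟨M, hM⟩ := exists_abs_bubbleMul_le ha hab hR
  exact ((integrable_exp_neg_mul_abs ha).const_mul M).mono'
    (continuous_bubbleMul a b hR).aestronglyMeasurable (.of_forall hM)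

lemma memLp_bubbleMul (ha : 0 < a) (hab : a < b) {R : ℝ → ℝ} (hR : Continuous R) :
    MemLp (bubbleMul a b R) 2 := by
  rw [memLp_two_iff_integrable_sq (continuous_bubbleMul a b hR).aestronglyMeasurable]
  obtain ⟨M, hM⟩ := exists_abs_bubbleMul_le ha hab hR
  refine ((integrable_bubbleMul ha hab hR).norm.const_mul M).mono'
    ((continuous_bubbleMul a b hR).pow 2).aestronglyMeasurable (.of_forall fun t => ?_)
  have h1 : |bubbleMul a b R t| ≤ M := by
    have h2 : exp (-(a * |t|)) ≤ 1 := exp_le_one_iff.2 (neg_nonpos.2 (by positivity))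
    have h3 := hM t
    have h4 : 0 ≤ M := by
      by_contra! h
      nlinarith [abs_nonneg (bubbleMul a b R t), exp_pos (-(a * |t|))]
    nlinarith
  rw [norm_pow, Real.norm_eq_abs, sq]
  exact mul_le_mul_of_nonneg_right h1 (abs_nonneg _)

/-- The second-order operator applied to the bubble. -/
def bubbleSource (a b : ℝ) : ℝ → ℝ :=
  bubbleMul a b fun s => 4 * a * b * s - 2 * a * (a + b) * s ^ 2

lemma continuous_source_poly (a b : ℝ) :
    Continuous fun s : ℝ => 4 * a * b * s - 2 * a * (a + b) * s ^ 2 := by fun_prop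

lemma memLp_bubbleSource (ha : 0 < a) (hab : a < b) : MemLp (bubbleSource a b) 2 :=
  memLp_bubbleMul ha hab (continuous_source_poly a b)

lemma bubbleMul_le_const (ha : 0 < a) (hab : a < b) {R : ℝ → ℝ} (hR : Continuous R) :
    ∃ M, ∀ t, |bubbleMul a b R t| ≤ M := by
  obtain ⟨M, hM⟩ := (isCompact_Icc (a := (0 : ℝ)) (b := 1)).exists_bound_of_continuousOn
    hR.continuousOn
  have h0 : 0 ≤ M := (norm_nonneg _).trans (hM 0 (by simp))
  refine ⟨M, fun t => (abs_bubbleMul_le ha hab (fun s h0 h1 => hM s ⟨h0, h1⟩) t).trans ?_⟩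
  exact mul_le_of_le_one_right h0 (exp_le_one_iff.2 (neg_nonpos.2 (by positivity)))

lemma bubbleMul_one (a b : ℝ) : bubbleMul a b (fun _ => 1) = bubble a b := by
  ext t; rw [bubbleMul, mul_one]

lemma hasDerivAt_bubble (hab : a < b) (t : ℝ) :
    HasDerivAt (bubble a b) (bubbleMul a b (fun s => a * (1 - 2 * s)) t) t := by
  have h := hasDerivAt_bubbleMul hab (R := fun _ => 1) (R' := fun _ => 0)
    (fun s => hasDerivAt_const s _) t
  rw [bubbleMul_one] at h
  simpa using h

lemma hasDerivAt_deriv_bubble (hab : a < b) (t : ℝ) :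
    HasDerivAt (bubbleMul a b fun s => a * (1 - 2 * s))
      (bubbleMul a b (fun s => a * (1 - 2 * s) * (a * (1 - 2 * s)) +
        (b - a) * (s * (1 - s)) * (a * -2)) t) t :=
  hasDerivAt_bubbleMul hab (R' := fun _ => a * -2) (fun s => by
    refine ((((hasDerivAt_id s).const_mul 2).const_sub 1).const_mul a).congr_deriv ?_
    ring) t

lemma integral_kern_mul_bubbleSource (ha : 0 < a) (hab : a < b) (t : ℝ) :
    ∫ τ, kern a b (t - τ) * bubbleSource a b τ = bubble a b t := by
  have hb := ha.trans hab
  obtain ⟨M, hM⟩ := bubbleMul_le_const ha hab (R := fun _ => 1) continuous_const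
  obtain ⟨M₁, hM₁⟩ := bubbleMul_le_const ha hab (R := fun s => a * (1 - 2 * s)) (by fun_prop)
  rw [bubbleMul_one] at hM
  have h := integral_kern_mul_eq ha hb (hasDerivAt_bubble hab) (hasDerivAt_deriv_bubble hab)
    (fun t => (hM t).trans (le_max_left M M₁)) (fun t => (hM₁ t).trans (le_max_right M M₁)) t
  have h1 : ∀ τ, -(bubbleMul a b (fun s => a * (1 - 2 * s) * (a * (1 - 2 * s)) +
      (b - a) * (s * (1 - s)) * (a * -2)) τ + (b - a) * bubbleMul a b (fun s => a * (1 - 2 * s)) τ -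
      a * b * bubble a b τ) = bubbleSource a b τ := fun τ => by
    simp only [bubbleSource, bubbleMul]; ring
  simp only [h1] at h
  exact h (integrable_kern_mul ha hb t (memLp_bubbleSource ha hab))

/-- The eigenvalue in the Euler-Lagrange equation of the bubble. -/
def bubbleCoeff (a b : ℝ) : ℝ := 4 * a * b * (a + b) * (3 * b - a)

lemma bubbleCoeff_pos (ha : 0 < a) (hab : a < b) : 0 < bubbleCoeff a b := by
  have h1 : 0 < 3 * b - a := by linarith
  have h2 : 0 < b := by linarith
  unfold bubbleCoeff
  positivity

lemma integral_kern_mul_bubble_nonlinearity (ha : 0 < a) (hab : a < b) (τ : ℝ) :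
    bubbleCoeff a b * ∫ t, kern a b (t - τ) * bubbleMul a b (fun s => (s * (1 - s)) ^ 2) t =
      bubbleSource a b τ := by
  have hb := ha.trans hab
  have hR : ∀ s : ℝ, HasDerivAt (fun s => 4 * a * b * s - 2 * a * (a + b) * s ^ 2)
      (4 * a * b - 2 * a * (a + b) * (2 * s)) s := fun s => by
    refine (((hasDerivAt_id s).const_mul (4 * a * b)).sub
      ((hasDerivAt_pow 2 s).const_mul (2 * a * (a + b)))).congr_deriv ?_
    simp
  have hR1 : ∀ s : ℝ, HasDerivAt
      (fun s => a * (1 - 2 * s) * (4 * a * b * s - 2 * a * (a + b) * s ^ 2) +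
        (b - a) * (s * (1 - s)) * (4 * a * b - 2 * a * (a + b) * (2 * s)))
      (a * -2 * (4 * a * b * s - 2 * a * (a + b) * s ^ 2) +
        a * (1 - 2 * s) * (4 * a * b - 2 * a * (a + b) * (2 * s)) +
        ((b - a) * (1 - 2 * s) * (4 * a * b - 2 * a * (a + b) * (2 * s)) +
        (b - a) * (s * (1 - s)) * (-(2 * a * (a + b) * 2)))) s := fun s => by
    have e1 : HasDerivAt (fun s : ℝ => a * (1 - 2 * s)) (a * -2) s := by
      refine ((((hasDerivAt_id s).const_mul 2).const_sub 1).const_mul a).congr_deriv ?_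
      ring
    have e2 : HasDerivAt (fun s : ℝ => (b - a) * (s * (1 - s))) ((b - a) * (1 - 2 * s)) s := by
      refine (((hasDerivAt_id s).mul ((hasDerivAt_id s).const_sub 1)).const_mul
        (b - a)).congr_deriv ?_
      simp only [id]; ring
    have e3 : HasDerivAt (fun s : ℝ => 4 * a * b - 2 * a * (a + b) * (2 * s))
        (-(2 * a * (a + b) * 2)) s := by
      refine ((((hasDerivAt_id s).const_mul 2).const_mul (2 * a * (a + b))).const_sub
        (4 * a * b)).congr_deriv ?_
      ring
    exact (e1.mul (hR s)).add (e2.mul e3)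
  have d1 := hasDerivAt_bubbleMul hab hR
  have d2 := hasDerivAt_bubbleMul hab hR1
  obtain ⟨M, hM⟩ := bubbleMul_le_const ha hab (continuous_source_poly a b)
  obtain ⟨M₁, hM₁⟩ := bubbleMul_le_const ha hab
    (R := fun s => a * (1 - 2 * s) * (4 * a * b * s - 2 * a * (a + b) * s ^ 2) +
        (b - a) * (s * (1 - s)) * (4 * a * b - 2 * a * (a + b) * (2 * s))) (by fun_prop)
  have h := integral_kern_mul_eq hb ha d1 d2
    (fun t => (hM t).trans (le_max_left M M₁)) (fun t => (hM₁ t).trans (le_max_right M M₁)) τ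
  have h1 : ∀ t, -(bubbleMul a b (fun s => a * (1 - 2 * s) *
        (a * (1 - 2 * s) * (4 * a * b * s - 2 * a * (a + b) * s ^ 2) +
        (b - a) * (s * (1 - s)) * (4 * a * b - 2 * a * (a + b) * (2 * s))) +
        (b - a) * (s * (1 - s)) * (a * -2 * (4 * a * b * s - 2 * a * (a + b) * s ^ 2) +
        a * (1 - 2 * s) * (4 * a * b - 2 * a * (a + b) * (2 * s)) +
        ((b - a) * (1 - 2 * s) * (4 * a * b - 2 * a * (a + b) * (2 * s)) +
        (b - a) * (s * (1 - s)) * (-(2 * a * (a + b) * 2))))) t +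
      (a - b) * bubbleMul a b (fun s =>
        a * (1 - 2 * s) * (4 * a * b * s - 2 * a * (a + b) * s ^ 2) +
        (b - a) * (s * (1 - s)) * (4 * a * b - 2 * a * (a + b) * (2 * s))) t -
      b * a * bubbleMul a b (fun s => 4 * a * b * s - 2 * a * (a + b) * s ^ 2) t) =
      bubbleCoeff a b * bubbleMul a b (fun s => (s * (1 - s)) ^ 2) t := fun t => by
    simp only [bubbleMul, bubbleCoeff]; ring
  simp only [h1] at h
  have hψ := memLp_bubbleMul ha hab (R := fun s => (s * (1 - s)) ^ 2) (by fun_prop)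
  rw [bubbleSource, ← h (integrable_kern_mul hb ha τ (hψ.const_mul _)), ← integral_const_mul]
  refine integral_congr_ae ?_
  filter_upwards [Measure.ae_ne volume τ] with t ht
  have hk : kern a b (t - τ) = kern b a (τ - t) := by
    rcases lt_or_gt_of_ne ht with h | h
    · rw [kern_of_neg (by linarith), kern_of_nonneg (by linarith), add_comm]
      congr 2; ring
    · rw [kern_of_nonneg (by linarith), kern_of_neg (by linarith), add_comm]
      congr 2; ring
  rw [hk]; ring

/-- The source of the bubble as an element of `L²`. -/
def bubbleVec (ha : 0 < a) (hab : a < b) : L2 := (memLp_bubbleSource ha hab).toLp _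

lemma ev_bubbleVec (ha : 0 < a) (hab : a < b) (t : ℝ) :
    (convSystem ha hab).ev (bubbleVec ha hab) t = bubble a b t := by
  rw [bubbleVec, convSystem_ev_toLp, integral_kern_mul_bubbleSource ha hab]

lemma signedPow_bubble (ha : 0 < a) (hab : a < b) (t : ℝ) :
    signedPow (2 * b / a) (bubble a b t) = bubbleMul a b (fun s => (s * (1 - s)) ^ 2) t := by
  rw [signedPow, abs_of_pos (bubble_pos a b t), bubble_rpow_sub_two ha hab, bubbleMul, mul_comm]

lemma isGround_bubbleVec (ha : 0 < a) (hab : a < b) :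
    (convSystem ha hab).IsGround a (2 * b / a) (bubbleCoeff a b) (bubbleVec ha hab)
      (bubbleMul a b fun s => a * (1 - 2 * s)) where
  l_pos := bubbleCoeff_pos ha hab
  crit := by
    have hR : Continuous fun s : ℝ => (s * (1 - s)) ^ 2 := by fun_prop
    obtain ⟨P, hP⟩ := bubbleMul_le_const ha hab hR
    rw [KernelSystem.crit_iff]
    intro k
    simp only [ev_bubbleVec, signedPow_bubble ha hab]
    simp only [convSystem_ev]
    rw [← integral_mul_integral_kern ha (ha.trans hab) (integrable_bubbleMul ha hab hR) hP
      (Lp.memLp k), ← integral_const_mul, L2.inner_eq]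
    refine integral_congr_ae ?_
    filter_upwards [(memLp_bubbleSource ha hab).coeFn_toLp] with τ h1
    rw [bubbleVec, h1, ← integral_kern_mul_bubble_nonlinearity ha hab, mul_assoc]
  pos t := by rw [ev_bubbleVec]; exact bubble_pos a b t
  le t := by rw [ev_bubbleVec]; exact bubble_le ha hab t
  hasDerivAt t := by
    rw [show (convSystem ha hab).ev (bubbleVec ha hab) = bubble a b from
      funext (ev_bubbleVec ha hab)]
    exact hasDerivAt_bubble hab t
  abs_deriv_le t := by
    rw [ev_bubbleVec, bubbleMul, abs_mul, abs_of_pos (bubble_pos a b t), mul_comm a (bubble a b t)]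
    refine mul_le_mul_of_nonneg_left ?_ (bubble_pos a b t).le
    have h1 := sigmoid_pos ((b - a) * t)
    have h2 := sigmoid_lt_one ((b - a) * t)
    rw [abs_le]
    constructor <;> nlinarith
  continuous_deriv := continuous_bubbleMul a b (by fun_prop)

instance L2.instSeparableSpace : TopologicalSpace.SeparableSpace L2 :=
  haveI : Fact ((2 : ENNReal) ≠ ⊤) := ⟨ENNReal.ofNat_ne_top⟩
  inferInstance

/-- The best constant of the convolution system. -/
lemma kap_convSystem (ha : 0 < a) (hab : a < b) :
    (convSystem ha hab).kap (2 * b / a) ^ (-(2 / (2 * b / a))) =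
      bubbleCoeff a b * (∫ t, bubble a b t ^ (2 * b / a)) ^ (1 - 2 / (2 * b / a)) := by
  have hb := ha.trans hab
  have hg := isGround_bubbleVec ha hab
  have hp : 2 < 2 * b / a := by rw [lt_div_iff₀ ha]; linarith
  have hpb : b < (2 * b / a - 1) * a := by
    rw [sub_mul, div_mul_cancel₀ _ ha.ne']; linarith
  have h1 := hg.norm_rpow_mul_kap (convSystem_isGreen ha hab) hp hpb
  have hl := hg.l_pos
  set p := 2 * b / a
  set m := ∫ t, bubble a b t ^ p with hm
  have h2 : ‖bubbleVec ha hab‖ ^ 2 = bubbleCoeff a b * m := by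
    rw [← real_inner_self_eq_norm_sq, KernelSystem.crit_iff.1 hg.crit]
    congr 1
    refine integral_congr_ae (.of_forall fun t => ?_)
    have := bubble_pos a b t
    simp only [ev_bubbleVec, signedPow]
    rw [abs_of_pos this, mul_assoc, ← sq, ← Real.rpow_natCast (bubble a b t) 2,
      ← Real.rpow_add this]
    congr 1; push_cast; ring
  have hn : 0 < ‖bubbleVec ha hab‖ := norm_pos_iff.2 hg.ne_zero
  have hm0 : 0 < m := by
    have : 0 < bubbleCoeff a b * m := h2 ▸ by positivity
    exact pos_of_mul_pos_right this hl.le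
  have h3 : ‖bubbleVec ha hab‖ = (bubbleCoeff a b * m) ^ (1 / 2 : ℝ) := by
    rw [← h2, ← Real.sqrt_eq_rpow, Real.sqrt_sq hn.le]
  rw [h3, ← Real.rpow_mul (by positivity)] at h1
  set S := (convSystem ha hab).kap p
  have h4 : S = (bubbleCoeff a b)⁻¹ * (bubbleCoeff a b * m) ^ (-(1 / 2 * (p - 2))) := by
    rw [Real.rpow_neg (by positivity)]
    have h5 : (bubbleCoeff a b * m) ^ (1 / 2 * (p - 2)) ≠ 0 :=
      (Real.rpow_pos_of_pos (by positivity) _).ne'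
    rw [← mul_inv]
    refine eq_inv_of_mul_eq_one_left ?_
    linear_combination h1
  have hp0 : p ≠ 0 := by linarith
  rw [h4, Real.mul_rpow (by positivity) (by positivity), ← Real.rpow_mul (by positivity),
    Real.mul_rpow hl.le hm0.le, ← mul_assoc]
  rw [Real.inv_rpow hl.le, Real.rpow_neg hl.le, inv_inv, ← Real.rpow_add hl]
  have e1 : 2 / p + -(1 / 2 * (p - 2)) * -(2 / p) = 1 := by field_simp; ring
  have e2 : -(1 / 2 * (p - 2)) * -(2 / p) = 1 - 2 / p := by field_simp
  rw [e1, e2, Real.rpow_one]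

end Bubble

section Radial

variable {N : ℕ}

lemma hasFDerivAt_norm {x : EuclideanSpace ℝ (Fin N)} (hx : x ≠ 0) :
    HasFDerivAt (fun y : EuclideanSpace ℝ (Fin N) => ‖y‖) (‖x‖⁻¹ • innerSL ℝ x) x := by
  have hx0 : 0 < ‖x‖ := norm_pos_iff.2 hx
  have h1 := ((hasStrictFDerivAt_norm_sq x).hasFDerivAt).sqrt (by positivity)
  simp only [Real.sqrt_sq (norm_nonneg _)] at h1
  refine h1.congr_fderiv ?_
  ext y
  simp only [smul_apply, smul_eq_mul, nsmul_eq_mul]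
  field_simp
  simp

lemma hasFDerivAt_of_radial {f : EuclideanSpace ℝ (Fin N) → ℝ} {h : ℝ → ℝ} {h' : ℝ}
    (hf : ∀ y ≠ 0, f y = h ‖y‖) {x : EuclideanSpace ℝ (Fin N)} (hx : x ≠ 0)
    (hh : HasDerivAt h h' ‖x‖) : HasFDerivAt f ((h' * ‖x‖⁻¹) • innerSL ℝ x) x := by
  have h1 := hh.comp_hasFDerivAt x (hasFDerivAt_norm hx)
  rw [smul_smul] at h1
  refine h1.congr_of_eventuallyEq ?_
  filter_upwards [isOpen_ne.mem_nhds hx] with y hy using hf y hy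

lemma lap_of_radial {f : EuclideanSpace ℝ (Fin N) → ℝ} {h h₁ h₂ : ℝ → ℝ}
    (hf : ∀ y ≠ 0, f y = h ‖y‖) (hh : ∀ r > 0, HasDerivAt h (h₁ r) r)
    (hh₁ : ∀ r > 0, HasDerivAt h₁ (h₂ r) r) {x : EuclideanSpace ℝ (Fin N)} (hx : x ≠ 0) :
    lap f x = h₂ ‖x‖ + (N - 1) * (h₁ ‖x‖ / ‖x‖) := by
  have hx0 : 0 < ‖x‖ := norm_pos_iff.2 hx
  have key : ∀ i : Fin N, fderiv ℝ (fun y => fderiv ℝ f y (EuclideanSpace.single i 1)) x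
      (EuclideanSpace.single i 1) =
      (h₂ ‖x‖ / ‖x‖ - h₁ ‖x‖ / ‖x‖ ^ 2) / ‖x‖ * x i ^ 2 + h₁ ‖x‖ / ‖x‖ := fun i => by
    have e1 : (fun y => fderiv ℝ f y (EuclideanSpace.single i 1)) =ᶠ[nhds x]
        fun y => h₁ ‖y‖ * ‖y‖⁻¹ * y i := by
      filter_upwards [isOpen_ne.mem_nhds hx] with y hy
      rw [(hasFDerivAt_of_radial hf hy (hh _ (norm_pos_iff.2 hy))).fderiv]
      simp [EuclideanSpace.inner_single_right]
    have e2 : HasDerivAt (fun r => h₁ r * r⁻¹) (h₂ ‖x‖ * ‖x‖⁻¹ + h₁ ‖x‖ * -(‖x‖ ^ 2)⁻¹) ‖x‖ :=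
      (hh₁ _ hx0).mul (hasDerivAt_inv hx0.ne')
    have e3 := (hasFDerivAt_of_radial (f := fun y => h₁ ‖y‖ * ‖y‖⁻¹) (fun _ _ => rfl) hx e2).mul
      (EuclideanSpace.proj (𝕜 := ℝ) i).hasFDerivAt (x := x)
    rw [e1.fderiv_eq]
    refine (congrArg (fun L => L (EuclideanSpace.single i 1)) (HasFDerivAt.fderiv e3)).trans ?_
    simp [EuclideanSpace.inner_single_right]
    field_simp
    ring
  rw [lap, Finset.sum_congr rfl fun i _ => key i, Finset.sum_add_distrib, ← Finset.mul_sum,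
    ← EuclideanSpace.real_norm_sq_eq]
  simp
  field_simp
  ring

lemma wOp_of_radial (α : ℝ) {f : EuclideanSpace ℝ (Fin N) → ℝ} {h h₁ h₂ : ℝ → ℝ}
    (hf : ∀ y ≠ 0, f y = h ‖y‖) (hh : ∀ r > 0, HasDerivAt h (h₁ r) r)
    (hh₁ : ∀ r > 0, HasDerivAt h₁ (h₂ r) r) {x : EuclideanSpace ℝ (Fin N)} (hx : x ≠ 0) :
    wOp α f x = ‖x‖ ^ α * (h₂ ‖x‖ + (N - 1 + α) * (h₁ ‖x‖ / ‖x‖)) := by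
  have hx0 : 0 < ‖x‖ := norm_pos_iff.2 hx
  rw [wOp, lap_of_radial hf hh hh₁ hx,
    (hasFDerivAt_of_radial hf hx (hh _ (norm_pos_iff.2 hx))).fderiv, Real.rpow_sub hx0]
  simp
  field_simp
  ring

lemma wOp_of_log {α a b : ℝ} (hb : b = N / 2) (ha : a = b - (2 - α))
    {f : EuclideanSpace ℝ (Fin N) → ℝ} {φ φ₁ φ₂ : ℝ → ℝ}
    (hf : ∀ y ≠ 0, f y = ‖y‖ ^ (-a) * φ (log ‖y‖)) (hφ : ∀ t, HasDerivAt φ (φ₁ t) t)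
    (hφ₁ : ∀ t, HasDerivAt φ₁ (φ₂ t) t) {x : EuclideanSpace ℝ (Fin N)} (hx : x ≠ 0) :
    wOp α f x = ‖x‖ ^ (-b) *
      (φ₂ (log ‖x‖) + (b - a) * φ₁ (log ‖x‖) - a * b * φ (log ‖x‖)) := by
  have hx0 : 0 < ‖x‖ := norm_pos_iff.2 hx
  have hlog : ∀ {ψ ψ' : ℝ → ℝ} (c : ℝ), (∀ t, HasDerivAt ψ (ψ' t) t) → ∀ r > 0,
      HasDerivAt (fun r => r ^ c * ψ (log r)) (r ^ (c - 1) * (c * ψ (log r) + ψ' (log r))) r := by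
    intro ψ ψ' c hψ r hr
    refine ((Real.hasDerivAt_rpow_const (p := c) (Or.inl hr.ne')).mul
      ((hψ (log r)).comp r (Real.hasDerivAt_log hr.ne'))).congr_deriv ?_
    rw [Real.rpow_sub_one hr.ne']
    simp only [Function.comp_apply]
    field_simp
  have h1 := hlog (-a) hφ
  have h2 := hlog (-a - 1) (ψ := fun t => -a * φ t + φ₁ t) (ψ' := fun t => -a * φ₁ t + φ₂ t)
    fun t => ((hφ t).const_mul (-a)).add (hφ₁ t)
  rw [wOp_of_radial α (h := fun r => r ^ (-a) * φ (log r)) hf h1 h2 hx, Real.rpow_sub_one hx0.ne',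
    Real.rpow_sub_one hx0.ne']
  have e1 : ‖x‖ ^ (-b) = ‖x‖ ^ α * (‖x‖ ^ (-a) / ‖x‖ / ‖x‖) := by
    rw [← Real.rpow_sub_one hx0.ne', ← Real.rpow_sub_one hx0.ne', ← Real.rpow_add hx0, ha]
    congr 1; ring
  have e2 : (N : ℝ) - 1 + α = a + b + 1 := by rw [ha, hb]; ring
  rw [e1, e2]
  field_simp
  ring

/-- The surface area of the unit sphere. -/
def sphereArea (N : ℕ) : ℝ := 2 * π ^ ((N : ℝ) / 2) / Gamma ((N : ℝ) / 2)

lemma sphereArea_pos (hN : 0 < N) : 0 < sphereArea N := by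
  have : 0 < Gamma ((N : ℝ) / 2) := Gamma_pos_of_pos (by positivity)
  unfold sphereArea
  positivity

lemma nat_mul_volume_ball (hN : 0 < N) :
    N * volume.real (Metric.ball (0 : EuclideanSpace ℝ (Fin N)) 1) = sphereArea N := by
  have : Nonempty (Fin N) := ⟨⟨0, hN⟩⟩
  have h0 : (0 : ℝ) < (N : ℝ) / 2 := by positivity
  have hG := (Gamma_pos_of_pos h0).ne'
  rw [Measure.real, EuclideanSpace.volume_ball, Fintype.card_fin, ENNReal.ofReal_one, one_pow,
    one_mul, ENNReal.toReal_ofReal, Gamma_add_one h0.ne', sphereArea, Real.sqrt_eq_rpow,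
    ← Real.rpow_mul_natCast pi_pos.le]
  · rw [show (1 / 2 * (N : ℝ)) = (N : ℝ) / 2 by ring]
    field_simp
  · have := Gamma_pos_of_pos (add_pos h0 one_pos)
    positivity

lemma integral_radial (hN : 0 < N) (f : ℝ → ℝ) :
    ∫ x : EuclideanSpace ℝ (Fin N), f ‖x‖ =
      sphereArea N * ∫ t, exp (N * t) * f (exp t) := by
  have : Nonempty (Fin N) := ⟨⟨0, hN⟩⟩
  rw [integral_fun_norm_addHaar volume f, finrank_euclideanSpace_fin, nsmul_eq_mul, smul_eq_mul,
    ← mul_assoc, nat_mul_volume_ball hN]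
  congr 1
  have h1 := integral_image_eq_integral_abs_deriv_smul (s := Set.univ) MeasurableSet.univ
    (fun x _ => (Real.hasDerivAt_exp x).hasDerivWithinAt) Real.exp_injective.injOn
    (fun y => y ^ (N - 1) • f y)
  rw [Set.image_univ, Real.range_exp, setIntegral_univ] at h1
  rw [h1]
  congr 1; ext t
  rw [abs_of_pos (exp_pos t), smul_eq_mul, smul_eq_mul, ← mul_assoc, ← pow_succ',
    Nat.sub_add_cancel hN, ← Real.exp_nat_mul]

lemma integral_wOp_sq (hN : 0 < N) {α a b : ℝ} (hb : b = N / 2) (ha : a = b - (2 - α))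
    {f : EuclideanSpace ℝ (Fin N) → ℝ} {φ φ₁ φ₂ : ℝ → ℝ}
    (hf : ∀ y ≠ 0, f y = ‖y‖ ^ (-a) * φ (log ‖y‖)) (hφ : ∀ t, HasDerivAt φ (φ₁ t) t)
    (hφ₁ : ∀ t, HasDerivAt φ₁ (φ₂ t) t) :
    ∫ x, wOp α f x ^ 2 =
      sphereArea N * ∫ t, (-(φ₂ t + (b - a) * φ₁ t - a * b * φ t)) ^ 2 := by
  have : Nonempty (Fin N) := ⟨⟨0, hN⟩⟩
  obtain ⟨F, hF⟩ : ∃ F : ℝ → ℝ, ∀ r, F r =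
      (r ^ (-b) * (φ₂ (log r) + (b - a) * φ₁ (log r) - a * b * φ (log r))) ^ 2 :=
    ⟨_, fun _ => rfl⟩
  have h1 : ∫ x, wOp α f x ^ 2 = ∫ x : EuclideanSpace ℝ (Fin N), F ‖x‖ := by
    refine integral_congr_ae ?_
    filter_upwards [Measure.ae_ne volume 0] with x hx
    rw [hF, wOp_of_log hb ha hf hφ hφ₁ hx]
  rw [h1, integral_radial hN]
  congr 2; ext t
  have h2 : exp (N * t) * (exp t ^ (-b)) ^ 2 = 1 := by
    rw [← Real.exp_mul, ← Real.exp_nat_mul, ← Real.exp_add, hb, Real.exp_eq_one_iff]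
    push_cast; ring
  simp only [hF, Real.log_exp]
  rw [mul_pow, ← mul_assoc, h2, one_mul, neg_sq]

lemma integral_abs_rpow_radial (hN : 0 < N) {a p : ℝ} (hp : a * p = N)
    {f : EuclideanSpace ℝ (Fin N) → ℝ} {φ : ℝ → ℝ}
    (hf : ∀ y ≠ 0, f y = ‖y‖ ^ (-a) * φ (log ‖y‖)) :
    ∫ x, |f x| ^ p = sphereArea N * ∫ t, |φ t| ^ p := by
  have : Nonempty (Fin N) := ⟨⟨0, hN⟩⟩
  obtain ⟨F, hF⟩ : ∃ F : ℝ → ℝ, ∀ r, F r = |r ^ (-a) * φ (log r)| ^ p := ⟨_, fun _ => rfl⟩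
  have h1 : ∫ x, |f x| ^ p = ∫ x : EuclideanSpace ℝ (Fin N), F ‖x‖ := by
    refine integral_congr_ae ?_
    filter_upwards [Measure.ae_ne volume 0] with x hx
    rw [hF, hf x hx]
  rw [h1, integral_radial hN]
  congr 2; ext t
  simp only [hF, Real.log_exp]
  rw [← Real.exp_mul, abs_mul, abs_of_pos (exp_pos _), Real.mul_rpow (exp_pos _).le (abs_nonneg _),
    ← Real.exp_mul, ← mul_assoc, ← Real.exp_add, ← hp]
  have h2 : a * p * t + t * -a * p = 0 := by ring
  rw [h2, Real.exp_zero, one_mul]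

end Radial

section Profile

lemma exists_abs_exp_mul_comp_exp_le {V : ℝ → ℝ} (hV : Continuous V) (hVc : HasCompactSupport V)
    {c : ℝ} (hc : 0 < c) : ∃ M, ∀ t, |exp (c * t) * V (exp t)| ≤ M * exp (-(c * |t|)) := by
  obtain ⟨M, hM⟩ := hVc.exists_bound_of_continuous hV
  have hM0 : 0 ≤ M := (norm_nonneg _).trans (hM 0)
  obtain ⟨R, hR⟩ := hVc.isCompact.isBounded.subset_closedBall 0
  set T := log (max R 1) with hT
  have hT0 : 0 ≤ T := Real.log_nonneg (le_max_right _ _)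
  refine ⟨exp (2 * c * T) * M, fun t => ?_⟩
  rw [abs_mul, abs_of_pos (exp_pos _)]
  rcases le_or_gt t T with ht | ht
  · have h1 : exp (c * t) ≤ exp (2 * c * T) * exp (-(c * |t|)) := by
      rw [← Real.exp_add, Real.exp_le_exp]
      rcases le_total 0 t with h | h
      · rw [abs_of_nonneg h]; nlinarith
      · rw [abs_of_nonpos h]; nlinarith [mul_nonneg hc.le hT0]
    have h2 := mul_le_mul h1 (hM (exp t)) (norm_nonneg _) (by positivity)
    rw [Real.norm_eq_abs] at h2
    linarith
  · have h3 : V (exp t) = 0 := by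
      refine image_eq_zero_of_notMem_tsupport fun h => ?_
      have h4 := hR h
      rw [mem_closedBall_zero_iff, Real.norm_eq_abs, abs_of_pos (exp_pos t)] at h4
      have h5 : exp T < exp t := Real.exp_lt_exp.2 ht
      rw [hT, Real.exp_log (by positivity)] at h5
      exact absurd (h4.trans (le_max_left _ _)) h5.not_ge
    rw [h3, abs_zero, mul_zero]
    positivity

lemma exists_abs_exp_mul_comp_exp_le_const {V : ℝ → ℝ} (hV : Continuous V)
    (hVc : HasCompactSupport V) {c : ℝ} (hc : 0 < c) :
    ∃ M, ∀ t, |exp (c * t) * V (exp t)| ≤ M := by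
  obtain ⟨M, hM⟩ := exists_abs_exp_mul_comp_exp_le hV hVc hc
  have hM0 : 0 ≤ M := by
    have := (abs_nonneg _).trans (hM 0)
    simpa using this
  exact ⟨M, fun t => (hM t).trans (mul_le_of_le_one_right hM0
    (exp_le_one_iff.2 (neg_nonpos.2 (by positivity))))⟩

lemma memLp_exp_mul_comp_exp {V : ℝ → ℝ} (hV : Continuous V) (hVc : HasCompactSupport V)
    {c : ℝ} (hc : 0 < c) : MemLp (fun t => exp (c * t) * V (exp t)) 2 := by
  have hcont : Continuous fun t => exp (c * t) * V (exp t) := by fun_prop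
  rw [memLp_two_iff_integrable_sq hcont.aestronglyMeasurable]
  obtain ⟨M, hM⟩ := exists_abs_exp_mul_comp_exp_le hV hVc hc
  obtain ⟨P, hP⟩ := exists_abs_exp_mul_comp_exp_le_const hV hVc hc
  refine ((integrable_exp_neg_mul_abs hc).const_mul (P * M)).mono'
    (hcont.pow 2).aestronglyMeasurable (.of_forall fun t => ?_)
  rw [norm_pow, Real.norm_eq_abs, sq, mul_assoc]
  exact mul_le_mul (hP t) (hM t) (abs_nonneg _) ((abs_nonneg _).trans (hP t))

lemma hasDerivAt_exp_mul_comp_exp {V V' : ℝ → ℝ} (hV : ∀ r, HasDerivAt V (V' r) r) (c t : ℝ) :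
    HasDerivAt (fun t => exp (c * t) * V (exp t))
      (c * (exp (c * t) * V (exp t)) + exp ((c + 1) * t) * V' (exp t)) t := by
  refine ((((hasDerivAt_id t).const_mul c).exp).mul
    ((hV (exp t)).comp t (Real.hasDerivAt_exp t))).congr_deriv ?_
  rw [add_mul c 1 t, one_mul, Real.exp_add]
  simp only [id, Function.comp_apply]
  ring

/-- A radial test function in logarithmic coordinates. -/
lemma exists_log_profile {N : ℕ} (hN : 0 < N) {a : ℝ} (ha : 0 < a)
    {u : EuclideanSpace ℝ (Fin N) → ℝ} (hu : ContDiff ℝ (⊤ : ℕ∞) u) (huc : HasCompactSupport u)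
    (hr : ∀ x y, ‖x‖ = ‖y‖ → u x = u y) :
    ∃ (φ φ₁ φ₂ : ℝ → ℝ) (M : ℝ), (∀ y ≠ 0, u y = ‖y‖ ^ (-a) * φ (log ‖y‖)) ∧
      (∀ t, HasDerivAt φ (φ₁ t) t) ∧ (∀ t, HasDerivAt φ₁ (φ₂ t) t) ∧
      (∀ t, |φ t| ≤ M) ∧ (∀ t, |φ₁ t| ≤ M) ∧
      ∀ b, MemLp (fun t => -(φ₂ t + (b - a) * φ₁ t - a * b * φ t)) 2 := by
  set e : EuclideanSpace ℝ (Fin N) := EuclideanSpace.single ⟨0, hN⟩ 1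
  have he : ‖e‖ = 1 := by simp [e]
  set U : ℝ → ℝ := fun r => u (r • e) with hU
  have hU0 : ContDiff ℝ (⊤ : ℕ∞) U := hu.comp (contDiff_id.smul contDiff_const)
  have hU1 : ContDiff ℝ (⊤ : ℕ∞) (deriv U) := ((contDiff_infty_iff_deriv).1 hU0).2
  have hU2 : ContDiff ℝ (⊤ : ℕ∞) (deriv (deriv U)) := ((contDiff_infty_iff_deriv).1 hU1).2
  have hc0 : HasCompactSupport U := by
    obtain ⟨R, hR⟩ := huc.isCompact.isBounded.subset_closedBall 0
    refine HasCompactSupport.intro (isCompact_closedBall (0 : ℝ) R) fun r h => ?_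
    refine image_eq_zero_of_notMem_tsupport (f := u) fun h1 => h ?_
    have h2 := hR h1
    rwa [mem_closedBall_zero_iff, norm_smul, he, mul_one, ← mem_closedBall_zero_iff] at h2
  have hc1 := hc0.deriv
  have hc2 := hc1.deriv
  have hd0 : ∀ r, HasDerivAt U (deriv U r) r := fun r =>
    (hU0.differentiable (by simp) r).hasDerivAt
  have hd1 : ∀ r, HasDerivAt (deriv U) (deriv (deriv U) r) r := fun r =>
    (hU1.differentiable (by simp) r).hasDerivAt
  have ha1 : 0 < a + 1 := by linarith
  have ha2 : 0 < a + 1 + 1 := by linarith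
  obtain ⟨M, hM⟩ := exists_abs_exp_mul_comp_exp_le_const hU0.continuous hc0 ha
  obtain ⟨M₁, hM₁⟩ := exists_abs_exp_mul_comp_exp_le_const hU1.continuous hc1 ha1
  have m0 := memLp_exp_mul_comp_exp hU0.continuous hc0 ha
  have m1 := memLp_exp_mul_comp_exp hU1.continuous hc1 ha1
  have m2 := memLp_exp_mul_comp_exp hU2.continuous hc2 ha2
  have d0 := hasDerivAt_exp_mul_comp_exp hd0 a
  have d1 := hasDerivAt_exp_mul_comp_exp hd1 (a + 1)
  have hM0 : 0 ≤ M := (abs_nonneg _).trans (hM 0)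
  have hM10 : 0 ≤ M₁ := (abs_nonneg _).trans (hM₁ 0)
  refine ⟨_, _, _, M + a * M + M₁, fun y hy => ?_, d0,
    fun t => ((d0 t).const_mul a).add (d1 t), fun t => ?_, fun t => ?_, fun b => ?_⟩
  · have hy0 : 0 < ‖y‖ := norm_pos_iff.2 hy
    rw [Real.exp_log hy0, mul_comm a, ← Real.rpow_def_of_pos hy0, ← mul_assoc,
      ← Real.rpow_add hy0, neg_add_cancel, Real.rpow_zero, one_mul]
    refine hr _ _ ?_
    rw [norm_smul, he, mul_one, norm_norm]
  · have := mul_nonneg ha.le hM0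
    linarith [hM t]
  · refine (abs_add_le _ _).trans ?_
    rw [abs_mul, abs_of_pos ha]
    have := mul_le_mul_of_nonneg_left (hM t) ha.le
    linarith [hM₁ t]
  · have m3 := (m0.const_mul a).add m1
    have m4 := (m1.const_mul (a + 1)).add m2
    have m5 := ((((m3.const_mul a).add m4).add (m3.const_mul (b - a))).sub
      (m0.const_mul (a * b))).neg
    exact m5

end Profile

section Extremals

lemma Cconst_pos {N : ℕ} (hN : 0 < N) {α : ℝ} (hα1 : ((4 : ℝ) - N) / 2 < α) (hα2 : α < 2) :
    0 < Cconst N α := by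
  have h0 : (0 : ℝ) < N := by positivity
  have h1 : 0 < (N : ℝ) - 4 + 2 * α := by linarith
  have h2 : 0 < (N : ℝ) - 2 + α := by linarith
  have h3 : 0 < (N : ℝ) + 2 - α := by linarith
  unfold Cconst
  positivity

lemma bubble_eq {a b : ℝ} (hab : a < b) (t : ℝ) :
    bubble a b t = exp (a * t) * (1 + exp ((b - a) * t)) ^ (-(2 * a / (b - a))) := by
  have hd : b - a ≠ 0 := (sub_pos.2 hab).ne'
  have h1 : 0 < 1 + exp ((b - a) * t) := by positivity
  have h2 : sigmoid ((b - a) * t) * (1 - sigmoid ((b - a) * t)) =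
      exp ((b - a) * t) * (1 + exp ((b - a) * t)) ^ (-2 : ℝ) := by
    rw [Real.rpow_neg h1.le, Real.rpow_ofNat, sigmoid_def, Real.exp_neg]
    have := (exp_pos ((b - a) * t)).ne'
    field_simp
    ring
  rw [bubble, h2, Real.mul_rpow (exp_pos _).le (by positivity), ← Real.exp_mul,
    ← Real.rpow_mul h1.le]
  congr 2 <;> field_simp

lemma Usol_eq {N : ℕ} {α a b : ℝ} (hb : b = N / 2) (ha : a = b - (2 - α)) (hα2 : α < 2)
    (τ : ℝ) {y : EuclideanSpace ℝ (Fin N)} (hy : y ≠ 0) :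
    Usol N α (exp (-τ)) y = Cconst N α * (‖y‖ ^ (-a) * bubble a b (log ‖y‖ - τ)) := by
  have hy0 : 0 < ‖y‖ := norm_pos_iff.2 hy
  have hab : a < b := by linarith
  have e1 : ((N : ℝ) - 4 + 2 * α) / 2 = a := by rw [ha, hb]; ring
  have e2 : ((N : ℝ) - 4 + 2 * α) / (2 - α) = 2 * a / (b - a) := by rw [ha, hb]; ring
  have e3 : 2 - α = b - a := by rw [ha]; ring
  rw [Usol, e1, e2, e3, bubble_eq hab, ← Real.exp_mul, ← Real.exp_mul,
    Real.rpow_def_of_pos hy0 (b - a), Real.rpow_def_of_pos hy0 (-a), ← Real.exp_add, mul_assoc,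
    ← mul_assoc (exp _), ← Real.exp_add]
  congr 3
  · ring
  · congr 1; congr 1; ring

end Extremals

section Constants

lemma Srad_eq {N : ℕ} (hN : 0 < N) {α a b : ℝ} (hb : b = N / 2) (ha : a = b - (2 - α))
    (ha0 : 0 < a) (hab : a < b) :
    Srad N α = sphereArea N ^ (1 - 2 / (2 * b / a)) *
      (convSystem ha0 hab).kap (2 * b / a) ^ (-(2 / (2 * b / a))) := by
  have hb0 : 0 < b := ha0.trans hab
  have hd : 0 < b - a := sub_pos.2 hab
  have hN' : (N : ℝ) = 2 * b := by rw [hb]; ring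
  have hα : α = 2 - (b - a) := by rw [ha]; ring
  have hk : 0 < 2 * b / (b - a) := by positivity
  have hG1 := Gamma_pos_of_pos hk
  have hG2 := Gamma_pos_of_pos (mul_pos two_pos hk)
  have hσ := sphereArea_pos hN
  rw [kap_convSystem, integral_bubble_rpow ha0 hab, Srad, CM]
  have e1 : (4 - 2 * α) / (N : ℝ) = (b - a) / b := by rw [hN', hα]; field_simp; ring
  have e2 : 2 * (N : ℝ) / (2 - α) = 2 * (2 * b / (b - a)) := by
    rw [hN', show 2 - α = b - a by rw [ha]; ring]; ring
  have e3 : 1 - 2 / (2 * b / a) = (b - a) / b := by field_simp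
  have e4 : 4 / (2 * (2 * b / (b - a))) = (b - a) / b := by field_simp; ring
  have e5 : 2 * (2 * b / (b - a)) / 2 = 2 * b / (b - a) := by ring
  have e6 : (2 - α) / 2 = (b - a) / 2 := by rw [hα]; ring
  rw [e1, e2, e3, e4, e5, e6, ← sphereArea, Real.rpow_sub (by positivity), Real.rpow_ofNat]
  set k := (b - a) / b
  have e7 : (b - a)⁻¹ * (Gamma (2 * b / (b - a)) ^ 2 / Gamma (2 * (2 * b / (b - a)))) =
      ((b - a) / 2)⁻¹ * (Gamma (2 * b / (b - a)) ^ 2 / (2 * Gamma (2 * (2 * b / (b - a))))) := by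
    field_simp
  have e8 : ((b - a) / 2) ^ 4 * ((2 * (2 * b / (b - a)) - 4) * (2 * (2 * b / (b - a)) - 2) *
      (2 * (2 * b / (b - a))) * (2 * (2 * b / (b - a)) + 2)) = bubbleCoeff a b := by
    rw [bubbleCoeff]; field_simp; ring
  rw [e7, Real.mul_rpow (by positivity) (by positivity), Real.inv_rpow (by positivity), ← e8]
  ring

end Constants

lemma L2.norm_sq_toLp {f : ℝ → ℝ} (hf : MemLp f 2) : ‖hf.toLp f‖ ^ 2 = ∫ t, f t ^ 2 := by
  rw [← real_inner_self_eq_norm_sq, L2.inner_toLp]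
  simp only [sq]

lemma exists_radial_stability (N : ℕ) (hN : 0 < N) (α : ℝ) (hα1 : ((4 : ℝ) - N) / 2 < α)
    (hα2 : α < 2) :
    ∃ B : ℝ, 0 < B ∧ ∀ u : EuclideanSpace ℝ (Fin N) → ℝ,
      ContDiff ℝ (⊤ : ℕ∞) u → HasCompactSupport u → (∀ x y, ‖x‖ = ‖y‖ → u x = u y) →
      B * sInf {d : ℝ | ∃ c : ℝ, ∃ lam : ℝ, 0 < lam ∧
          d = ∫ x, (wOp α (fun y => u y - c * Usol N α lam y) x) ^ 2} ≤
        (∫ x, (wOp α u x) ^ 2) -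
          Srad N α * (∫ x, |u x| ^ (pexp N α)) ^ (((N : ℝ) - 4 + 2 * α) / (N : ℝ)) := by
  obtain ⟨b, hb⟩ : ∃ b : ℝ, b = N / 2 := ⟨_, rfl⟩
  obtain ⟨a, ha⟩ : ∃ a : ℝ, a = b - (2 - α) := ⟨_, rfl⟩
  have ha0 : 0 < a := by rw [ha, hb]; linarith
  have hab : a < b := by linarith
  have hb0 := ha0.trans hab
  have hN' : (N : ℝ) = 2 * b := by rw [hb]; ring
  have hα : α = 2 - (b - a) := by rw [ha]; ring
  have hp : pexp N α = 2 * b / a := by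
    rw [pexp, hN', hα]
    rw [show 2 * b - 4 + 2 * (2 - (b - a)) = 2 * a by ring]
    field_simp
  have hq : ((N : ℝ) - 4 + 2 * α) / (N : ℝ) = 2 / (2 * b / a) := by
    rw [hN', hα]; field_simp; ring
  have hσ := sphereArea_pos hN
  have hC := Cconst_pos hN hα1 hα2
  set g₀ := bubbleVec ha0 hab
  obtain ⟨B, hB, hBg⟩ := (isGround_bubbleVec ha0 hab).exists_stability
    (convSystem_isGreen ha0 hab) (by rw [lt_div_iff₀ ha0]; linarith)
    (by rw [sub_mul, div_mul_cancel₀ _ ha0.ne']; linarith)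
  refine ⟨B, hB, fun u hu huc hur => ?_⟩
  obtain ⟨φ, φ₁, φ₂, M, hφ, d1, d2, hM, hM₁, hG⟩ := exists_log_profile hN ha0 hu huc hur
  have hG := hG b
  set g := hG.toLp _
  have hev : ∀ t, (convSystem ha0 hab).ev g t = φ t := fun t => by
    rw [convSystem_ev_toLp]
    exact integral_kern_mul_eq ha0 hb0 d1 d2 hM hM₁ t (integrable_kern_mul ha0 hb0 t hG)
  have h1 : ∫ x, wOp α u x ^ 2 = sphereArea N * ‖g‖ ^ 2 := by
    rw [integral_wOp_sq hN hb ha hφ d1 d2, L2.norm_sq_toLp]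
  have h2 : ∫ x, |u x| ^ (2 * b / a) =
      sphereArea N * (convSystem ha0 hab).F (2 * b / a) g := by
    rw [integral_abs_rpow_radial hN (by rw [hN']; field_simp) hφ]
    simp only [KernelSystem.F, hev]
  have h3 : ∀ c τ : ℝ, ∫ x, wOp α (fun y => u y - c / Cconst N α * Usol N α (exp (-τ)) y) x ^ 2 =
      sphereArea N * ‖g - c • (convSystem ha0 hab).V τ g₀‖ ^ 2 := fun c τ => by
    have hs : MemLp (fun t => bubbleSource a b (t - τ)) 2 :=
      (memLp_bubbleSource ha0 hab).comp_measurePreserving (measurePreserving_sub_right volume τ)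
    have e1 : g - c • (convSystem ha0 hab).V τ g₀ = (hG.sub (hs.const_smul c)).toLp _ := by
      rw [MemLp.toLp_sub hG (hs.const_smul c), MemLp.toLp_const_smul c hs]
      congr 2
      exact translation_toLp _ hs fun t => rfl
    have e2 : ∀ t, HasDerivAt (fun t => φ t - c * bubble a b (t - τ))
        (φ₁ t - c * bubbleMul a b (fun s => a * (1 - 2 * s)) (t - τ)) t := fun t =>
      (d1 t).sub (((hasDerivAt_bubble hab (t - τ)).comp_sub_const t τ).const_mul c)
    have e3 := fun t => (d2 t).sub
      (((hasDerivAt_deriv_bubble hab (t - τ)).comp_sub_const t τ).const_mul c)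
    rw [integral_wOp_sq hN hb ha (fun y hy => ?_) e2 e3, e1, L2.norm_sq_toLp]
    · congr 2; ext t
      simp only [Pi.sub_apply, Pi.smul_apply, smul_eq_mul, bubbleSource, bubbleMul, bubble]
      ring
    · rw [Usol_eq hb ha hα2 τ hy, hφ y hy]
      field_simp
  have h4 : sInf {d : ℝ | ∃ c : ℝ, ∃ lam : ℝ, 0 < lam ∧
      d = ∫ x, (wOp α (fun y => u y - c * Usol N α lam y) x) ^ 2} ≤
      sphereArea N * (convSystem ha0 hab).orbitDist (‖g₀‖⁻¹ • g₀) g := by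
    rw [← div_le_iff₀' hσ]
    refine le_ciInf fun x => ?_
    rw [div_le_iff₀' hσ, map_smul, smul_smul, ← h3]
    refine csInf_le ⟨0, ?_⟩ ⟨_, _, exp_pos _, rfl⟩
    rintro d ⟨c, lam, -, rfl⟩
    positivity
  have h5 : sphereArea N ^ (1 - 2 / (2 * b / a)) * sphereArea N ^ (2 / (2 * b / a)) =
      sphereArea N := by
    rw [← Real.rpow_add hσ, sub_add_cancel, Real.rpow_one]
  have hF : 0 ≤ (convSystem ha0 hab).F (2 * b / a) g := by
    unfold KernelSystem.F; positivity
  rw [hp, hq, h1, h2, Srad_eq hN hb ha ha0 hab, Real.mul_rpow hσ.le hF]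
  refine (mul_le_mul_of_nonneg_left h4 hB.le).trans ?_
  have h6 := mul_le_mul_of_nonneg_left (hBg g) hσ.le
  rw [KernelSystem.deficit] at h6
  refine (le_of_eq (by ring)).trans (h6.trans_eq ?_)
  linear_combination (-(convSystem ha0 hab).kap (2 * b / a) ^ (-(2 / (2 * b / a))) *
    (convSystem ha0 hab).F (2 * b / a) g ^ (2 / (2 * b / a))) * (-h5)

/-- quantitative stability (remainder term) for the radial weighted inequality:
the deficit controls `B` times the squared distance to the manifold of extremals
`{c U_{λ,α} : c ∈ ℝ, λ > 0}`, measured in the weighted second-order energy. -/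
theorem stmt19 (N : ℕ) (hN : 2 ≤ N) (α : ℝ) (hα1 : ((4 : ℝ) - N)/2 < α) (hα2 : α < 2) :
    ∃ B : ℝ, 0 < B ∧ ∀ u : EuclideanSpace ℝ (Fin N) → ℝ,
      ContDiff ℝ (⊤ : ℕ∞) u → HasCompactSupport u →
      (∀ x y : EuclideanSpace ℝ (Fin N), ‖x‖ = ‖y‖ → u x = u y) →
      (∫ x, (wOp α u x)^2)
          - Srad N α * (∫ x, |u x| ^ (pexp N α)) ^ (((N : ℝ) - 4 + 2*α)/(N : ℝ))
        ≥ B * sInf {d : ℝ | ∃ c : ℝ, ∃ lam : ℝ, 0 < lam ∧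
            d = ∫ x, (wOp α (fun y => u y - c * Usol N α lam y) x)^2} :=
  exists_radial_stability N (by omega) α hα1 hα2

end
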